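/- Let P_1(d),...,P_ℓ(d) be polynomials with integer coefficients satisfying P_i(0)=0 for i=1,...,ℓ, and let k = max_i deg P_i ≥ 2. There exists a constant C > 0, depending only on P_1,...,P_ℓ, such that for every integer N ≥ 3 and every set A ⊆ {1,...,N} with the property that for every nonzero integer d the set {P_1(d),...,P_ℓ(d)} is NOT contained in the difference set A − A = {a − a' : a, a' ∈ A}, one has |A|/N ≤ C · (log log N / log N)^{1/(ℓ(k−1))}. -/

import Mathlib

open Finset Pointwise

namespace MomentCurve

/-- The additive character `x ↦ exp (2πix)` of the real line. -/
noncomputable def e (x : ℝ) : ℂ := Complex.exp (2 * Real.pi * x * Complex.I)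

lemma e_add (x y : ℝ) : e (x + y) = e x * e y := by
  rw [e, e, e, ← Complex.exp_add]; push_cast; ring_nf

@[simp] lemma e_zero : e 0 = 1 := by simp [e]

@[simp] lemma norm_e (x : ℝ) : ‖e x‖ = 1 := by
  have : (2 * Real.pi * x * Complex.I : ℂ) = ((2 * Real.pi * x : ℝ) : ℂ) * Complex.I := by
    push_cast; ring
  rw [e, this, Complex.norm_exp_ofReal_mul_I]

@[simp] lemma e_int (n : ℤ) : e n = 1 := by
  rw [e, Complex.exp_eq_one_iff]
  exact ⟨n, by push_cast; ring⟩

lemma e_add_int (x : ℝ) (n : ℤ) : e (x + n) = e x := by simp [e_add]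

lemma e_eq_of_sub_int {x y : ℝ} (n : ℤ) (h : x - y = n) : e x = e y := by
  rw [← e_add_int y n, ← h]; congr 1; ring

lemma e_neg (x : ℝ) : e (-x) = starRingEnd ℂ (e x) := by
  rw [e, e, ← Complex.exp_conj]
  congr 1
  simp only [map_mul, map_ofNat, Complex.conj_ofReal, Complex.conj_I]
  push_cast
  ring

lemma e_sub (x y : ℝ) : e (x - y) = e x * starRingEnd ℂ (e y) := by
  rw [sub_eq_add_neg, e_add, e_neg]

lemma e_nat_mul (n : ℕ) (x : ℝ) : e (n * x) = e x ^ n := by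
  rw [e, e, ← Complex.exp_nat_mul]; push_cast; ring_nf

lemma e_sum {ι : Type*} (s : Finset ι) (f : ι → ℝ) : e (∑ i ∈ s, f i) = ∏ i ∈ s, e (f i) := by
  classical
  induction s using Finset.induction_on with
  | empty => simp
  | insert a s ha ih => rw [sum_insert ha, prod_insert ha, e_add, ih]

lemma e_eq_one_iff (x : ℝ) : e x = 1 ↔ ∃ n : ℤ, x = n := by
  constructor
  · intro h
    rw [e, Complex.exp_eq_one_iff] at h
    obtain ⟨n, hn⟩ := h
    refine ⟨n, ?_⟩
    have h2 : (2 * Real.pi * Complex.I : ℂ) ≠ 0 := Complex.two_pi_I_ne_zero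
    have : (2 * Real.pi * Complex.I : ℂ) * x = (2 * Real.pi * Complex.I : ℂ) * n := by
      rw [mul_comm _ (n : ℂ), ← hn]; ring
    have := mul_left_cancel₀ h2 this
    exact_mod_cast this
  · rintro ⟨n, rfl⟩; simp

lemma norm_e_sub_one_le (x : ℝ) : ‖e x - 1‖ ≤ 7 * |x| := by
  have h := Real.norm_exp_I_mul_ofReal_sub_one_le (x := 2 * Real.pi * x)
  have h2 : e x = Complex.exp (Complex.I * ((2 * Real.pi * x : ℝ) : ℂ)) := by
    rw [e]; push_cast; ring_nf
  rw [h2]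
  refine h.trans ?_
  rw [Real.norm_eq_abs, abs_mul, abs_of_pos (by positivity)]
  have : Real.pi < 3.15 := Real.pi_lt_d2
  gcongr; linarith

lemma norm_e_sub_e_le (x y : ℝ) : ‖e x - e y‖ ≤ 7 * |x - y| := by
  have : e x - e y = e y * (e (x - y) - 1) := by
    rw [mul_sub, ← e_add]; simp
  rw [this, norm_mul, norm_e, one_mul]
  exact norm_e_sub_one_le _

lemma norm_e_sub_e_le_of_int (x y : ℝ) (n : ℤ) : ‖e x - e y‖ ≤ 7 * |x - y - n| := by
  rw [← e_add_int y n]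
  refine (norm_e_sub_e_le _ _).trans_eq ?_
  congr 2; ring

/-- The distance from `1` on the circle is bounded below by the distance to the integers. -/
lemma four_mul_le_norm_e_sub_one {x : ℝ} (hx : |x| ≤ 1 / 2) : 4 * |x| ≤ ‖e x - 1‖ := by
  have h2 : e x = Complex.exp (Complex.I * ((2 * Real.pi * x : ℝ) : ℂ)) := by
    rw [e]; push_cast; ring_nf
  rw [h2, Complex.norm_exp_I_mul_ofReal_sub_one, norm_mul, Real.norm_eq_abs, Real.norm_eq_abs,
    abs_of_pos (by norm_num : (0:ℝ) < 2)]
  have hpi := Real.pi_pos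
  have key : 2 / Real.pi * |Real.pi * x| ≤ |Real.sin (Real.pi * x)| := by
    apply Real.mul_abs_le_abs_sin
    rw [abs_mul, abs_of_pos hpi]; nlinarith
  rw [show 2 * Real.pi * x / 2 = Real.pi * x by ring]
  rw [abs_mul, abs_of_pos hpi] at key
  have : 2 / Real.pi * (Real.pi * |x|) = 2 * |x| := by field_simp
  linarith

lemma sum_range_add_one_of_periodic {ψ : ℤ → ℂ} {n : ℕ} (h : ∀ x, ψ (x + n) = ψ x) :
    ∑ z ∈ range n, ψ (z + 1) = ∑ z ∈ range n, ψ z := by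
  have h1 := Finset.sum_range_succ (fun z : ℕ => ψ z) n
  have h2 := Finset.sum_range_succ' (fun z : ℕ => ψ z) n
  have h3 := h 0
  simp only [zero_add] at h3
  push_cast at h1 h2
  rw [h3] at h1
  exact add_right_cancel (h2.symm.trans h1)

lemma sum_range_add_of_periodic {ψ : ℤ → ℂ} {n : ℕ} (h : ∀ x, ψ (x + n) = ψ x) (c : ℕ) :
    ∑ z ∈ range n, ψ (z + c) = ∑ z ∈ range n, ψ z := by
  induction c with
  | zero => simp
  | succ c ih =>
    rw [← ih, ← sum_range_add_one_of_periodic (ψ := fun x => ψ (x + c))]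
    · refine sum_congr rfl fun z _ => ?_
      congr 1; push_cast; ring
    · intro x
      rw [← h (x + c)]; congr 1; ring

lemma sum_range_mul {ψ : ℤ → ℂ} (n m : ℕ) :
    ∑ z ∈ range (n * m), ψ z = ∑ u ∈ range m, ∑ z ∈ range n, ψ (z + n * u) := by
  induction m with
  | zero => simp
  | succ m ih =>
    rw [Nat.mul_succ, sum_range_add, ih, sum_range_succ]
    congr 1
    refine sum_congr rfl fun z _ => ?_
    congr 1; push_cast; ring

lemma periodic_mul {ψ : ℤ → ℂ} {n : ℕ} (h : ∀ x, ψ (x + n) = ψ x) (x : ℤ) (u : ℕ) :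
    ψ (x + n * u) = ψ x := by
  induction u with
  | zero => simp
  | succ u ih => rw [← ih, ← h (x + n * u)]; congr 1; push_cast; ring

lemma sum_range_mul_of_periodic {ψ : ℤ → ℂ} {n : ℕ} (h : ∀ x, ψ (x + n) = ψ x) (m : ℕ) :
    ∑ z ∈ range (n * m), ψ z = m * ∑ z ∈ range n, ψ z := by
  rw [sum_range_mul]
  simp [periodic_mul h]

end MomentCurve

namespace MomentCurve

/-- In a field where `1, …, n` are invertible, the first `n` power sums determine the elementary
symmetric functions. -/
lemma aeval_esymm_eq_of_sum_pow_eq {F : Type*} [Field F] {n : ℕ}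
    (hF : ∀ j : ℕ, 1 ≤ j → j ≤ n → (j : F) ≠ 0) {x y : Fin n → F}
    (h : ∀ j : ℕ, 1 ≤ j → j ≤ n → ∑ i, x i ^ j = ∑ i, y i ^ j) (k : ℕ) (hk : k ≤ n) :
    MvPolynomial.aeval x (MvPolynomial.esymm (Fin n) F k) =
      MvPolynomial.aeval y (MvPolynomial.esymm (Fin n) F k) := by
  induction k using Nat.strong_induction_on with
  | _ k ih =>
    rcases Nat.eq_zero_or_pos k with rfl | hk0
    · simp
    apply mul_left_cancel₀ (hF k hk0 hk)
    have key := MvPolynomial.mul_esymm_eq_sum (Fin n) F k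
    have kx := congrArg (MvPolynomial.aeval x) key
    have ky := congrArg (MvPolynomial.aeval y) key
    simp only [map_mul, map_natCast, map_pow, map_neg, map_one, map_sum] at kx ky
    rw [kx, ky]
    congr 1
    refine sum_congr rfl fun a ha => ?_
    rw [mem_filter, Finset.HasAntidiagonal.mem_antidiagonal] at ha
    rw [ih a.1 ha.2 (by omega)]
    congr 1
    simp only [MvPolynomial.psum, map_sum, map_pow, MvPolynomial.aeval_X]
    exact h a.2 (by omega) (by omega)

lemma ofFn_perm_of_sum_pow_eq {F : Type*} [Field F] {n : ℕ}
    (hF : ∀ j : ℕ, 1 ≤ j → j ≤ n → (j : F) ≠ 0) {x y : Fin n → F}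
    (h : ∀ j : ℕ, 1 ≤ j → j ≤ n → ∑ i, x i ^ j = ∑ i, y i ^ j) :
    (List.ofFn x).Perm (List.ofFn y) := by
  rw [← Multiset.coe_eq_coe, ← Fin.univ_val_map, ← Fin.univ_val_map,
    ← Polynomial.roots_multiset_prod_X_sub_C (Multiset.map x univ.val),
    ← Polynomial.roots_multiset_prod_X_sub_C (Multiset.map y univ.val),
    Multiset.prod_X_sub_X_eq_sum_esymm, Multiset.prod_X_sub_X_eq_sum_esymm]
  congr 1
  simp only [Multiset.card_map, card_val, card_univ, Fintype.card_fin]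
  refine sum_congr rfl fun j hj => ?_
  rw [← MvPolynomial.aeval_esymm_eq_multiset_esymm (Fin n) F,
    ← MvPolynomial.aeval_esymm_eq_multiset_esymm (Fin n) F,
    aeval_esymm_eq_of_sum_pow_eq hF h j (by simpa [Nat.lt_succ_iff] using hj)]

lemma card_sum_pow_eq_le {F : Type*} [Field F] [Fintype F] [DecidableEq F] {n : ℕ}
    (hF : ∀ j : ℕ, 1 ≤ j → j ≤ n → (j : F) ≠ 0) (x : Fin n → F) :
    #{y : Fin n → F | ∀ j : Fin n, ∑ i, x i ^ (j + 1 : ℕ) = ∑ i, y i ^ (j + 1 : ℕ)}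
      ≤ n.factorial := by
  calc _ = #(({y : Fin n → F | ∀ j : Fin n, ∑ i, x i ^ (j + 1 : ℕ) =
            ∑ i, y i ^ (j + 1 : ℕ)} : Finset (Fin n → F)).image List.ofFn) :=
        (card_image_of_injective _ List.ofFn_injective).symm
    _ ≤ #((List.ofFn x).permutations.toFinset) := by
        refine card_le_card fun l hl => ?_
        obtain ⟨y, hy, rfl⟩ := mem_image.1 hl
        rw [mem_filter] at hy
        rw [List.mem_toFinset, List.mem_permutations]
        refine (ofFn_perm_of_sum_pow_eq hF fun j h1 h2 => ?_).symm
        have := hy.2 ⟨j - 1, by omega⟩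
        simpa [Nat.sub_add_cancel h1] using this
    _ ≤ (List.ofFn x).permutations.length := List.toFinset_card_le _
    _ = n.factorial := by rw [List.length_permutations, List.length_ofFn]

lemma addChar_sum {G R ι : Type*} [AddCommMonoid G] [CommMonoid R] (ψ : AddChar G R)
    (s : Finset ι) (f : ι → G) : ψ (∑ i ∈ s, f i) = ∏ i ∈ s, ψ (f i) := by
  classical
  induction s using Finset.induction_on with
  | empty => simp
  | insert a s ha ih => rw [sum_insert ha, prod_insert ha, AddChar.map_add_eq_mul, ih]

section Mordell

variable {p : ℕ} [Fact p.Prime]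

/-- The exponential sum of the polynomial `∑ a_j x^(j+1)` over the prime field. -/
noncomputable def vecSum (n : ℕ) (a : Fin n → ZMod p) : ℂ :=
  ∑ x : ZMod p, ZMod.stdAddChar (∑ j, a j * x ^ (j + 1 : ℕ))

lemma norm_stdAddChar (x : ZMod p) : ‖(ZMod.stdAddChar x : ℂ)‖ = 1 :=
  AddChar.norm_apply _ _

lemma conj_stdAddChar (x : ZMod p) :
    starRingEnd ℂ (ZMod.stdAddChar x) = ZMod.stdAddChar (-x) := by
  rw [AddChar.map_neg_eq_inv, Complex.inv_def, Complex.normSq_eq_norm_sq, norm_stdAddChar]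
  simp

lemma vecSum_pow (n : ℕ) (a : Fin n → ZMod p) : vecSum n a ^ n =
    ∑ x : Fin n → ZMod p, ZMod.stdAddChar (∑ j, a j * ∑ i, x i ^ (j + 1 : ℕ)) := by
  rw [vecSum, Fintype.sum_pow]
  refine sum_congr rfl fun x _ => ?_
  rw [← addChar_sum, sum_comm]
  simp_rw [mul_sum]

lemma sum_norm_vecSum_pow_le {n : ℕ} (hn : n < p) :
    ∑ a : Fin n → ZMod p, ‖vecSum n a‖ ^ (2 * n) ≤ (p : ℝ) ^ (2 * n) * n.factorial := by
  have hF : ∀ j : ℕ, 1 ≤ j → j ≤ n → (j : ZMod p) ≠ 0 := by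
    intro j h1 h2 h0
    rw [ZMod.natCast_eq_zero_iff] at h0
    have := Nat.le_of_dvd h1 h0
    omega
  have h1 : ∀ a : Fin n → ZMod p, ((‖vecSum n a‖ ^ (2 * n) : ℝ) : ℂ) =
      ∑ x : Fin n → ZMod p, ∑ y : Fin n → ZMod p, ∏ j, (ZMod.stdAddChar
        (a j * (∑ i, x i ^ (j + 1 : ℕ) - ∑ i, y i ^ (j + 1 : ℕ))) : ℂ) := by
    intro a
    have : ((‖vecSum n a‖ ^ (2 * n) : ℝ) : ℂ) =
        vecSum n a ^ n * starRingEnd ℂ (vecSum n a ^ n) := by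
      rw [Complex.mul_conj, Complex.normSq_eq_norm_sq, norm_pow, ← pow_mul, mul_comm n 2]
    rw [this, vecSum_pow, map_sum, sum_mul_sum]
    refine sum_congr rfl fun x _ => sum_congr rfl fun y _ => ?_
    rw [conj_stdAddChar, ← AddChar.map_add_eq_mul, ← addChar_sum]
    congr 1
    rw [← sub_eq_add_neg, ← sum_sub_distrib]
    simp_rw [mul_sub]
  have h2 : ((∑ a : Fin n → ZMod p, ‖vecSum n a‖ ^ (2 * n) : ℝ) : ℂ) =
      ((∑ x : Fin n → ZMod p, (p : ℝ) ^ n * (#{y : Fin n → ZMod p | ∀ j : Fin n,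
        ∑ i, x i ^ (j + 1 : ℕ) = ∑ i, y i ^ (j + 1 : ℕ)} : ℝ) : ℝ) : ℂ) := by
    rw [Complex.ofReal_sum]
    simp_rw [h1]
    rw [sum_comm, Complex.ofReal_sum]
    refine sum_congr rfl fun x _ => ?_
    rw [sum_comm, card_filter]
    push_cast
    rw [mul_sum]
    refine sum_congr rfl fun y _ => ?_
    have := (prod_univ_sum (fun _ : Fin n => (univ : Finset (ZMod p)))
      (fun j t => (ZMod.stdAddChar
        (t * (∑ i, x i ^ (j + 1 : ℕ) - ∑ i, y i ^ (j + 1 : ℕ))) : ℂ)))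
    rw [Fintype.piFinset_univ] at this
    rw [← this]
    simp_rw [AddChar.sum_mulShift _ (ZMod.isPrimitive_stdAddChar p), ZMod.card, sub_eq_zero]
    split_ifs with hc
    · simp [hc]
    · push Not at hc
      obtain ⟨j, hj⟩ := hc
      rw [prod_eq_zero (mem_univ j)]
      · simp
      · rw [if_neg hj]; simp
  have h3 := Complex.ofReal_injective h2
  rw [h3]
  calc _ ≤ ∑ x : Fin n → ZMod p, (p : ℝ) ^ n * n.factorial := by
        gcongr with x
        exact card_sum_pow_eq_le hF x
    _ = _ := by
        simp [sum_const, ZMod.card]; ring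

open Polynomial in
lemma eq_zero_of_eval_add_eq {F : (ZMod p)[X]} {t K : ZMod p} (hF2 : 2 ≤ F.natDegree)
    (hFp : F.natDegree < p) (h : ∀ y, F.eval (y + t) = F.eval y + K) : t = 0 := by
  by_contra ht
  have hi : ∀ i : ℕ, F.eval (i * t) = F.eval 0 + i * K := by
    intro i
    induction i with
    | zero => simp
    | succ i ih =>
      rw [Nat.cast_succ, add_mul, one_mul, h, ih]; ring
  set G : (ZMod p)[X] := F.comp (C t * X) - (C (F.eval 0) + C K * X) with hG
  have hdeg1 : (F.comp (C t * X)).natDegree = F.natDegree := by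
    rw [natDegree_comp, natDegree_C_mul_X _ ht, mul_one]
  have hdeg2 : (C (F.eval 0) + C K * X).natDegree ≤ 1 := by
    compute_degree
  have hGdeg : G.natDegree = F.natDegree := by
    rw [hG, natDegree_sub_eq_left_of_natDegree_lt, hdeg1]
    omega
  have hG0 : G ≠ 0 := by
    intro h0; rw [h0] at hGdeg; simp at hGdeg; omega
  have hroot : ∀ z : ZMod p, G.IsRoot z := by
    intro z
    have := hi z.val
    rw [ZMod.natCast_zmod_val] at this
    simp only [hG, IsRoot, eval_sub, eval_comp, eval_add, eval_mul, eval_C, eval_X]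
    rw [mul_comm t z, this]; ring
  have hcard : #(univ : Finset (ZMod p)) ≤ G.natDegree := by
    apply card_le_degree_of_subset_roots
    intro z _
    rw [mem_roots hG0]
    exact hroot z
  rw [card_univ, ZMod.card, hGdeg] at hcard
  omega

open Polynomial in
/-- The nonconstant coefficients of `F (cx + h)`. -/
noncomputable def affineCoeffs (F : (ZMod p)[X]) (n : ℕ) (c h : ZMod p) : Fin n → ZMod p :=
  fun j => (F.comp (C c * X + C h)).coeff (j + 1)

open Polynomial in
lemma eval_eq_coeff_zero_add {F : (ZMod p)[X]} {n : ℕ} (hF : F.natDegree ≤ n) (x : ZMod p) :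
    F.eval x = F.coeff 0 + ∑ j : Fin n, F.coeff (j + 1) * x ^ (j + 1 : ℕ) := by
  rw [eval_eq_sum_range' (Nat.lt_succ_of_le hF), sum_range_succ',
    Fin.sum_univ_eq_sum_range (fun j => F.coeff (j + 1) * x ^ (j + 1)), add_comm]
  simp

open Polynomial in
lemma natDegree_affine_comp {F : (ZMod p)[X]} {c : ZMod p} (hc : c ≠ 0) (h : ZMod p) :
    (F.comp (C c * X + C h)).natDegree = F.natDegree := by
  rw [natDegree_comp, natDegree_linear hc, mul_one]

open Polynomial in
lemma norm_vecSum_affineCoeffs {F : (ZMod p)[X]} {n : ℕ} (hF : F.natDegree = n) {c : ZMod p}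
    (hc : c ≠ 0) (h : ZMod p) : ‖vecSum n (affineCoeffs F n c h)‖ =
      ‖∑ x : ZMod p, (ZMod.stdAddChar (F.eval x) : ℂ)‖ := by
  have h1 : ∑ x : ZMod p, (ZMod.stdAddChar (F.eval x) : ℂ) =
      ∑ x : ZMod p, ZMod.stdAddChar (F.eval (c * x + h)) := by
    refine (Fintype.sum_bijective (fun x => c * x + h) ?_ _ _ fun x => rfl).symm
    rw [← Finite.injective_iff_bijective]
    intro x y hxy
    exact mul_left_cancel₀ hc (add_right_cancel hxy)
  have h2 : ∀ x, (ZMod.stdAddChar (F.eval (c * x + h)) : ℂ) =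
      ZMod.stdAddChar ((F.comp (C c * X + C h)).coeff 0) * ZMod.stdAddChar
        (∑ j, affineCoeffs F n c h j * x ^ (j + 1 : ℕ)) := by
    intro x
    rw [← AddChar.map_add_eq_mul]
    have := eval_eq_coeff_zero_add (natDegree_affine_comp (F := F) hc h).le x
    rw [eval_comp] at this
    simp only [eval_add, eval_mul, eval_C, eval_X] at this
    rw [this, hF]
    rfl
  rw [h1]
  simp_rw [h2]
  rw [← mul_sum, norm_mul, norm_stdAddChar, one_mul, vecSum]

open Polynomial in
lemma affineCoeffs_card_fiber_le {F : (ZMod p)[X]} {n : ℕ} (hF : F.natDegree = n) (hn2 : 2 ≤ n)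
    (hnp : n < p) (a : Fin n → ZMod p) :
    #{u ∈ (univ.erase (0 : ZMod p)) ×ˢ (univ : Finset (ZMod p)) |
      affineCoeffs F n u.1 u.2 = a} ≤ n := by
  have hF0 : F ≠ 0 := by rintro rfl; simp at hF; omega
  have hlead : F.leadingCoeff ≠ 0 := leadingCoeff_ne_zero.2 hF0
  calc _ ≤ #((nthRoots n (a ⟨n - 1, by omega⟩ / F.leadingCoeff)).toFinset) := by
        refine card_le_card_of_injOn Prod.fst ?_ ?_
        · intro u hu
          simp only [coe_filter, mem_product, mem_erase, mem_univ, and_true,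
            Set.mem_ofPred_eq, ne_eq] at hu
          rw [mem_coe, Multiset.mem_toFinset, mem_nthRoots (by omega), ← hu.2,
            eq_div_iff hlead]
          have h1 := leadingCoeff_comp (p := F) (q := C u.1 * X + C u.2)
            (by rw [natDegree_linear hu.1]; omega)
          rw [leadingCoeff_linear hu.1] at h1
          rw [affineCoeffs]
          simp only
          rw [Nat.sub_add_cancel (by omega), mul_comm]
          rw [leadingCoeff, natDegree_affine_comp hu.1, hF] at h1
          exact h1.symm
        · rintro ⟨c, h⟩ hu ⟨c', h'⟩ hu' hcc
          simp only [coe_filter, mem_product, mem_erase, mem_univ, and_true,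
            Set.mem_ofPred_eq, ne_eq] at hu hu' hcc
          subst hcc
          have hsub : h - h' = 0 := by
            apply eq_zero_of_eval_add_eq (F := F)
              (K := (F.comp (C c * X + C h)).coeff 0 - (F.comp (C c * X + C h')).coeff 0)
              (by omega) (by omega)
            intro y
            obtain ⟨x, hx⟩ : ∃ x, c * x + h' = y :=
              ⟨(y - h') / c, by rw [mul_div_cancel₀ _ hu.1]; ring⟩
            have e1 := eval_eq_coeff_zero_add (natDegree_affine_comp (F := F) hu.1 h).le x
            have e2 := eval_eq_coeff_zero_add (natDegree_affine_comp (F := F) hu.1 h').le x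
            have e3 : ∀ j : Fin n, (F.comp (C c * X + C h)).coeff (j + 1) =
              (F.comp (C c * X + C h')).coeff (j + 1) :=
              fun j => congrFun (hu.2.trans hu'.2.symm) j
            rw [hF] at e1 e2
            simp only [e3] at e1
            rw [eval_comp] at e1 e2
            simp only [eval_add, eval_mul, eval_C, eval_X] at e1 e2
            rw [← hx, show c * x + h' + (h - h') = c * x + h by ring, e1, e2]
            ring
          rw [sub_eq_zero.1 hsub]
    _ ≤ (nthRoots n (a ⟨n - 1, by omega⟩ / F.leadingCoeff)).card := Multiset.toFinset_card_le _
    _ ≤ n := card_nthRoots _ _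

open Polynomial in
/-- **Mordell's bound** for complete exponential sums to a prime modulus. -/
lemma mordell_pow {F : (ZMod p)[X]} {n : ℕ} (hF : F.natDegree = n) (hn2 : 2 ≤ n) (hnp : n < p) :
    ‖∑ x : ZMod p, (ZMod.stdAddChar (F.eval x) : ℂ)‖ ^ (2 * n) * ((p : ℝ) * (p - 1)) ≤
      (p : ℝ) ^ (2 * n) * (n * n.factorial) := by
  have hp1 : 1 ≤ p := by omega
  set s := (univ.erase (0 : ZMod p)) ×ˢ (univ : Finset (ZMod p)) with hs
  have hcard : (#s : ℝ) = (p : ℝ) * (p - 1) := by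
    rw [hs, card_product, card_erase_of_mem (mem_univ _), card_univ, ZMod.card]
    push_cast [Nat.cast_sub hp1]; ring
  calc _ = ∑ u ∈ s, ‖vecSum n (affineCoeffs F n u.1 u.2)‖ ^ (2 * n) := by
        rw [← hcard, mul_comm, ← nsmul_eq_mul, ← sum_const]
        refine sum_congr rfl fun u hu => ?_
        rw [norm_vecSum_affineCoeffs hF]
        exact (mem_erase.1 (mem_product.1 hu).1).1
    _ = ∑ a : Fin n → ZMod p, ∑ u ∈ s with affineCoeffs F n u.1 u.2 = a,
          ‖vecSum n (affineCoeffs F n u.1 u.2)‖ ^ (2 * n) := by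
        rw [sum_fiberwise]
    _ = ∑ a : Fin n → ZMod p, #{u ∈ s | affineCoeffs F n u.1 u.2 = a} *
          ‖vecSum n a‖ ^ (2 * n) := by
        refine sum_congr rfl fun a _ => ?_
        rw [← nsmul_eq_mul, ← sum_const]
        refine sum_congr rfl fun u hu => ?_
        rw [(mem_filter.1 hu).2]
    _ ≤ ∑ a : Fin n → ZMod p, n * ‖vecSum n a‖ ^ (2 * n) := by
        gcongr with a
        exact_mod_cast affineCoeffs_card_fiber_le hF hn2 hnp a
    _ = n * ∑ a : Fin n → ZMod p, ‖vecSum n a‖ ^ (2 * n) := by rw [mul_sum]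
    _ ≤ n * ((p : ℝ) ^ (2 * n) * n.factorial) := by
        gcongr
        exact sum_norm_vecSum_pow_le hnp
    _ = _ := by ring

end Mordell

end MomentCurve

namespace MomentCurve

open Polynomial

/-- The complete exponential sum `∑_{x mod q} e(F(x)/q)`. -/
noncomputable def gaussSum (F : ℤ[X]) (q : ℕ) : ℂ :=
  ∑ x ∈ range q, e (((F.eval (x : ℤ) : ℤ) : ℝ) / q)

lemma norm_gaussSum_le (F : ℤ[X]) (q : ℕ) : ‖gaussSum F q‖ ≤ q := by
  refine (norm_sum_le _ _).trans ?_
  simp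

lemma e_div_eq_of_dvd {q : ℕ} (hq : q ≠ 0) {a b : ℤ} (h : (q : ℤ) ∣ a - b) :
    e ((a : ℝ) / q) = e ((b : ℝ) / q) := by
  obtain ⟨c, hc⟩ := h
  refine e_eq_of_sub_int c ?_
  have : (q : ℝ) ≠ 0 := by exact_mod_cast hq
  rw [← sub_div, div_eq_iff this]
  have h2 : ((a - b : ℤ) : ℝ) = ((q * c : ℤ) : ℝ) := by rw [hc]
  push_cast at h2; linarith

lemma e_eval_periodic (F : ℤ[X]) {q : ℕ} (hq : q ≠ 0) (x : ℤ) :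
    e (((F.eval (x + q) : ℤ) : ℝ) / q) = e (((F.eval x : ℤ) : ℝ) / q) := by
  refine e_div_eq_of_dvd hq ?_
  have := Polynomial.sub_dvd_eval_sub (x + q) x F
  simpa using this

/-- The coefficients of `F(x₀ + pX)`. -/
lemma coeff_comp_affine (p : ℕ) (F : ℤ[X]) (x₀ : ℤ) (j : ℕ) :
    (F.comp (C x₀ + C (p : ℤ) * X)).coeff j = (taylor x₀ F).coeff j * (p : ℤ) ^ j := by
  have : F.comp (C x₀ + C (p : ℤ) * X) = (taylor x₀ F).comp (C (p : ℤ) * X) := by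
    rw [taylor_apply, comp_assoc]; simp [add_comm]
  rw [this, comp_C_mul_X_coeff]

lemma gaussSum_pow_split {p : ℕ} (F : ℤ[X]) {m : ℕ} (hm : 1 ≤ m) : gaussSum F (p ^ m) =
    ∑ x ∈ range p, ∑ z ∈ range (p ^ (m - 1)),
      e (((F.eval ((x : ℤ) + p * (z : ℤ)) : ℤ) : ℝ) / (p ^ m : ℕ)) := by
  have h1 : p ^ m = p * p ^ (m - 1) := by rw [← pow_succ']; congr 1; omega
  rw [sum_comm, gaussSum]
  conv_lhs => rw [show range (p ^ m) = range (p * p ^ (m - 1)) by rw [← h1]]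
  exact sum_range_mul (ψ := fun x => e (((F.eval x : ℤ) : ℝ) / (p ^ m : ℕ))) p (p ^ (m - 1))

section PrimePower

variable {p : ℕ} [hp : Fact p.Prime]

lemma map_zmod_eq_zero_iff (g : ℤ[X]) :
    g.map (Int.castRingHom (ZMod p)) = 0 ↔ ∀ i, (p : ℤ) ∣ g.coeff i := by
  rw [Polynomial.ext_iff]
  simp [ZMod.intCast_zmod_eq_zero_iff_dvd]

lemma exists_pow_mul_map_ne_zero {H : ℤ[X]} (hH : H ≠ 0) :
    ∃ (τ : ℕ) (g : ℤ[X]), H = C ((p : ℤ) ^ τ) * g ∧ g.map (Int.castRingHom (ZMod p)) ≠ 0 := by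
  have hfin : FiniteMultiplicity (C (p : ℤ)) H := by
    apply FiniteMultiplicity.of_not_isUnit _ hH
    rw [Polynomial.isUnit_C, Int.isUnit_iff]
    have := hp.out.two_le
    omega
  obtain ⟨g, h1, h2⟩ := hfin.exists_eq_pow_mul_and_not_dvd
  refine ⟨_, g, by rw [C_pow]; exact h1, ?_⟩
  rwa [Ne, map_zmod_eq_zero_iff, ← C_dvd_iff_dvd_coeff]

/-- An integer polynomial is nonconstant modulo `p`. -/
def NonconstMod (p : ℕ) (F : ℤ[X]) : Prop := ∃ j, 1 ≤ j ∧ ¬ (p : ℤ) ∣ F.coeff j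

lemma pow_le_of_derivative_eq {k : ℕ} {F g : ℤ[X]} {τ : ℕ} (hk : F.natDegree ≤ k)
    (hF : NonconstMod p F) (hd : derivative F = C ((p : ℤ) ^ τ) * g) : p ^ τ ≤ k := by
  obtain ⟨j, hj, hpj⟩ := hF
  have h1 : (derivative F).coeff (j - 1) = F.coeff j * j := by
    rw [coeff_derivative]
    have : j - 1 + 1 = j := by omega
    rw [this]; congr 1; exact_mod_cast this
  rw [hd, coeff_C_mul] at h1
  have h2 : (p : ℤ) ^ τ ∣ F.coeff j * j := ⟨_, h1.symm⟩
  have h3 : IsCoprime ((p : ℤ) ^ τ) (F.coeff j) := by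
    apply IsCoprime.pow_left
    rw [Prime.coprime_iff_not_dvd (Nat.prime_iff_prime_int.1 hp.out)]
    exact hpj
  have h4 := h3.dvd_of_dvd_mul_left h2
  have h5 : p ^ τ ∣ j := by exact_mod_cast h4
  refine (Nat.le_of_dvd hj h5).trans ((le_natDegree_of_ne_zero ?_).trans hk)
  intro h0; apply hpj; rw [h0]; exact dvd_zero _

lemma gaussSum_prime (F : ℤ[X]) : gaussSum F p =
    ∑ x : ZMod p, (ZMod.stdAddChar ((F.map (Int.castRingHom (ZMod p))).eval x) : ℂ) := by
  rw [gaussSum]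
  refine Finset.sum_bij' (fun x _ => (x : ZMod p)) (fun x _ => x.val) ?_ ?_ ?_ ?_ ?_
  · intro x _; exact mem_univ _
  · intro x _; exact mem_range.2 (ZMod.val_lt x)
  · intro x hx; exact ZMod.val_cast_of_lt (mem_range.1 hx)
  · intro x _; simp
  · intro x _
    have : (F.map (Int.castRingHom (ZMod p))).eval (x : ZMod p) = ((F.eval (x:ℤ) : ℤ) : ZMod p) := by simp
    rw [this, ZMod.stdAddChar_coe, e]
    congr 1; push_cast; ring

lemma gaussSum_prime_le {k : ℕ} {P : ℝ} (hk : 1 ≤ k) (hP1 : 1 ≤ P) (hP : P ^ k = p) {F : ℤ[X]}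
    (hFk : F.natDegree ≤ k) (hF : NonconstMod p F) (hkp : k < p) :
    ‖gaussSum F p‖ * P ≤ 2 * k * k.factorial * p := by
  set f := F.map (Int.castRingHom (ZMod p)) with hf
  have hfk : f.natDegree ≤ k := natDegree_map_le.trans hFk
  have hf1 : 1 ≤ f.natDegree := by
    obtain ⟨j, hj, hpj⟩ := hF
    refine hj.trans (le_natDegree_of_ne_zero ?_)
    rw [hf, coeff_map]
    simp [ZMod.intCast_zmod_eq_zero_iff_dvd, hpj]
  rw [gaussSum_prime, ← hf]
  have hp2 : (2 : ℝ) ≤ p := by exact_mod_cast hp.out.two_le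
  rcases hf1.eq_or_lt with h1 | h2
  · have hz : ∑ x : ZMod p, (ZMod.stdAddChar (f.eval x) : ℂ) = 0 := by
      obtain ⟨a, ha, b, hb⟩ := natDegree_eq_one.1 h1.symm
      have : ∀ x : ZMod p, f.eval x = a * x + b := fun x => by rw [← hb]; simp
      simp_rw [this]
      have hs : ∑ x : ZMod p, (ZMod.stdAddChar (a * x + b) : ℂ) =
          ∑ x : ZMod p, (ZMod.stdAddChar x : ℂ) :=
        Fintype.sum_bijective (fun x => a * x + b)
          ((AddGroup.addRight_bijective b).comp (mulLeft_bijective₀ a ha)) _ _ fun x => rfl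
      rw [hs]
      apply AddChar.sum_eq_zero_of_ne_one
      intro h
      have := (ZMod.isPrimitive_stdAddChar p) (a := 1) one_ne_zero
      apply this
      rw [AddChar.mulShift_one, h]
    rw [hz]; simp; positivity
  · have hm := mordell_pow (F := f) rfl h2 (hfk.trans_lt hkp)
    set n := f.natDegree with hn
    set S := ‖∑ x : ZMod p, (ZMod.stdAddChar (f.eval x) : ℂ)‖ with hS
    have hS0 : 0 ≤ S := norm_nonneg _
    refine le_of_pow_le_pow_left₀ (n := 2 * n) (by omega) (by positivity) ?_
    have e1 : P ^ (2 * n) ≤ (p : ℝ) ^ 2 := by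
      rw [← hP, ← pow_mul]
      exact pow_le_pow_right₀ hP1 (by omega)
    have e2 : (p : ℝ) ^ 2 ≤ 2 * (p * (p - 1)) := by nlinarith
    have e3 : (n * n.factorial : ℝ) ≤ k * k.factorial := by
      have := Nat.factorial_le hfk
      gcongr
    have hkf : (1 : ℝ) ≤ k * k.factorial := by
      have h1 : (1 : ℝ) ≤ k := by exact_mod_cast hk
      have h2 : (1 : ℝ) ≤ k.factorial := by exact_mod_cast Nat.factorial_pos k
      nlinarith
    calc (S * P) ^ (2 * n) = S ^ (2 * n) * P ^ (2 * n) := mul_pow _ _ _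
      _ ≤ S ^ (2 * n) * (2 * (p * (p - 1))) := by gcongr; exact e1.trans e2
      _ = 2 * (S ^ (2 * n) * (p * (p - 1))) := by ring
      _ ≤ 2 * (p ^ (2 * n) * (n * n.factorial)) := by gcongr
      _ ≤ 2 * (p ^ (2 * n) * (k * k.factorial)) := by gcongr
      _ = (2 * (k * k.factorial)) * p ^ (2 * n) := by ring
      _ ≤ (2 * (k * k.factorial)) ^ (2 * n) * p ^ (2 * n) := by
        gcongr
        exact le_self_pow₀ (by linarith) (by omega)
      _ = _ := by rw [← mul_pow]; ring

lemma NonconstMod.taylor {F : ℤ[X]} (hF : NonconstMod p F) (x₀ : ℤ) :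
    NonconstMod p (taylor x₀ F) := by
  by_contra h
  simp only [NonconstMod, not_exists, not_and, not_not] at h
  obtain ⟨j, hj, hpj⟩ := hF
  apply hpj
  have h0 : (Polynomial.taylor x₀ F - C ((Polynomial.taylor x₀ F).coeff 0)).map (Int.castRingHom (ZMod p)) = 0 := by
    rw [map_zmod_eq_zero_iff]
    intro i
    rcases Nat.eq_zero_or_pos i with rfl | hi
    · simp
    · rw [coeff_sub, coeff_C, if_neg (by omega), sub_zero]; exact h i hi
  have h1 : F = Polynomial.taylor (-x₀) (Polynomial.taylor x₀ F - C ((Polynomial.taylor x₀ F).coeff 0)) +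
      C ((Polynomial.taylor x₀ F).coeff 0) := by
    rw [map_sub, taylor_taylor, taylor_C]; simp
  have h2 : (F.map (Int.castRingHom (ZMod p))).coeff j = 0 := by
    rw [h1, Polynomial.map_add, map_taylor, h0]
    rw [map_zero, zero_add, map_C, coeff_C, if_neg (by omega)]
  rw [coeff_map] at h2
  simpa [ZMod.intCast_zmod_eq_zero_iff_dvd] using h2

/-- At a residue where the derivative of `F`, divided by its content power `p^τ`, does not vanish
modulo `p`, the local sum is zero. -/
lemma local_sum_eq_zero {F g : ℤ[X]} {τ m : ℕ} (hd : derivative F = C ((p : ℤ) ^ τ) * g)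
    (hm : 2 * τ + 2 ≤ m) {x₀ : ℤ} (hx : ¬ (p : ℤ) ∣ g.eval x₀) :
    ∑ z ∈ range (p ^ (m - 1)), e (((F.eval (x₀ + p * (z : ℤ)) : ℤ) : ℝ) / (p ^ m : ℕ)) = 0 := by
  have hp0 : p ≠ 0 := hp.out.ne_zero
  have hpm : p ^ m ≠ 0 := pow_ne_zero _ hp0
  set ψ : ℤ → ℂ := fun z => e (((F.eval (x₀ + p * z) : ℤ) : ℝ) / (p ^ m : ℕ)) with hψ
  have hper : ∀ z, ψ (z + (p ^ (m - 1) : ℕ)) = ψ z := by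
    intro z
    refine e_div_eq_of_dvd hpm ?_
    refine dvd_trans ?_ (Polynomial.sub_dvd_eval_sub _ _ F)
    refine ⟨1, ?_⟩
    obtain ⟨m', rfl⟩ : ∃ m', m = m' + 1 := ⟨m - 1, by omega⟩
    simp only [Nat.add_sub_cancel]
    push_cast; ring
  obtain ⟨b, hb⟩ : ∃ b, m = b + 2 + τ := ⟨m - 2 - τ, by omega⟩
  set ω := e (((g.eval x₀ : ℤ) : ℝ) / p) with hω
  have hω1 : ω ≠ 1 := by
    intro h
    rw [hω, e_eq_one_iff] at h
    obtain ⟨c, hc⟩ := h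
    apply hx
    rw [div_eq_iff (by exact_mod_cast hp0)] at hc
    exact ⟨c, by rw [mul_comm]; exact_mod_cast hc⟩
  have hshift : ∀ z : ℤ, ψ (z + (p ^ b : ℕ)) = ω * ψ z := by
    intro z
    have hp0' : (p : ℝ) ≠ 0 := by exact_mod_cast hp0
    have h1 : ω = e (((p ^ (m - 1) * g.eval x₀ : ℤ) : ℝ) / (p ^ m : ℕ)) := by
      rw [hω]; congr 1
      obtain ⟨m', rfl⟩ : ∃ m', m = m' + 1 := ⟨m - 1, by omega⟩
      simp only [Nat.add_sub_cancel]
      push_cast; field_simp; ring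
    rw [h1, hψ, ← e_add, ← add_div, ← Int.cast_add]
    refine e_div_eq_of_dvd hpm ?_
    obtain ⟨c, hc⟩ := Polynomial.binomExpansion F (x₀ + p * z) (p ^ (b + 1))
    have h2 : x₀ + p * (z + (p ^ b : ℕ)) = x₀ + p * z + (p : ℤ) ^ (b + 1) := by push_cast; ring
    have h3 : (x₀ + p * z) - x₀ ∣ g.eval (x₀ + p * z) - g.eval x₀ :=
      Polynomial.sub_dvd_eval_sub _ _ g
    obtain ⟨w, hw⟩ := h3
    have h4 : g.eval (x₀ + p * z) = g.eval x₀ + p * (z * w) := by linear_combination hw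
    obtain ⟨t, ht⟩ : ∃ t, 2 * (b + 1) = m + t := ⟨2 * (b + 1) - m, by omega⟩
    have h5 : ((p : ℤ) ^ (b + 1)) ^ 2 = p ^ m * p ^ t := by rw [← pow_mul, ← pow_add, mul_comm, ht]
    have h6 : (p : ℤ) ^ τ * p ^ (b + 1) = p ^ (m - 1) := by rw [← pow_add]; congr 1; omega
    have h7 : (p : ℤ) ^ (m - 1) * p = p ^ m := by rw [← pow_succ]; congr 1; omega
    rw [h2, hc, hd, eval_mul, eval_C, h4, h5]
    refine ⟨z * w + c * p ^ t, ?_⟩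
    push_cast
    linear_combination (g.eval x₀ + p * (z * w)) * h6 + (z * w) * h7
  have h8 := sum_range_add_of_periodic hper (p ^ b)
  simp_rw [hshift, ← mul_sum] at h8
  have h9 : (ω - 1) * ∑ z ∈ range (p ^ (m - 1)), ψ z = 0 := by rw [sub_mul, h8]; ring
  exact (mul_eq_zero.1 h9).resolve_left (sub_ne_zero.2 hω1)

/-- Recentring a polynomial at a residue class modulo `p`. -/
lemma exists_recentred {k : ℕ} {F g : ℤ[X]} {τ : ℕ} (hk : F.natDegree ≤ k)
    (hF : NonconstMod p F) (hd : derivative F = C ((p : ℤ) ^ τ) * g)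
    (hg : g.map (Int.castRingHom (ZMod p)) ≠ 0) (x₀ : ℤ) :
    ∃ (s : ℕ) (F₁ : ℤ[X]) (τ₁ : ℕ) (g₁ : ℤ[X]), 1 ≤ s ∧ s ≤ k ∧
      (∀ z, F.eval (x₀ + p * z) = F.eval x₀ + (p : ℤ) ^ s * F₁.eval z) ∧
      F₁.natDegree ≤ k ∧ NonconstMod p F₁ ∧ derivative F₁ = C ((p : ℤ) ^ τ₁) * g₁ ∧
      g₁.map (Int.castRingHom (ZMod p)) ≠ 0 ∧
      (g₁.map (Int.castRingHom (ZMod p))).natDegree ≤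
        (g.map (Int.castRingHom (ZMod p))).rootMultiplicity (x₀ : ZMod p) := by
  have hp0 : (p : ℤ) ≠ 0 := by exact_mod_cast hp.out.ne_zero
  have hpp := Nat.prime_iff_prime_int.1 hp.out
  set W := F.comp (C x₀ + C (p : ℤ) * X) - C (F.eval x₀) with hW
  have hW0 : W.coeff 0 = 0 := by
    rw [hW, coeff_sub, coeff_comp_affine, taylor_coeff_zero]; simp
  have hWj : ∀ j, 1 ≤ j → W.coeff j = (taylor x₀ F).coeff j * (p : ℤ) ^ j := by
    intro j hj
    rw [hW, coeff_sub, coeff_comp_affine, coeff_C, if_neg (by omega), sub_zero]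
  obtain ⟨j, hj1, hpj⟩ := hF.taylor x₀
  have htj : (taylor x₀ F).coeff j ≠ 0 := fun h => hpj (by rw [h]; exact dvd_zero _)
  have hjk : j ≤ k := by
    refine (le_natDegree_of_ne_zero htj).trans ?_
    rwa [natDegree_taylor]
  have hWne : W ≠ 0 := by
    intro h
    have := hWj j hj1
    rw [h, coeff_zero] at this
    exact mul_ne_zero htj (pow_ne_zero _ hp0) this.symm
  obtain ⟨s, F₁, hWs, hF₁⟩ := exists_pow_mul_map_ne_zero (p := p) hWne
  have hps : (p : ℤ) ^ s ≠ 0 := pow_ne_zero _ hp0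
  have hF₁c : ∀ i, (p : ℤ) ^ s * F₁.coeff i = W.coeff i := fun i => by rw [hWs, coeff_C_mul]
  have hF₁0 : F₁.coeff 0 = 0 := by
    have := hF₁c 0
    rw [hW0] at this
    exact (mul_eq_zero.1 this).resolve_left hps
  have hs_le : s ≤ j := by
    have h1 := hF₁c j
    rw [hWj j hj1] at h1
    have h2 : (p : ℤ) ^ s ∣ (taylor x₀ F).coeff j * (p : ℤ) ^ j := ⟨_, h1.symm⟩
    have h3 : IsCoprime ((p : ℤ) ^ s) ((taylor x₀ F).coeff j) :=
      IsCoprime.pow_left ((Prime.coprime_iff_not_dvd hpp).2 hpj)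
    have h4 : p ^ s ∣ p ^ j := by exact_mod_cast h3.dvd_of_dvd_mul_left h2
    exact (Nat.pow_dvd_pow_iff_le_right hp.out.one_lt).1 h4
  have hs1 : 1 ≤ s := by
    by_contra h
    have hs0 : s = 0 := by omega
    apply hF₁
    rw [map_zmod_eq_zero_iff]
    intro i
    rcases Nat.eq_zero_or_pos i with rfl | hi
    · rw [hF₁0]; exact dvd_zero _
    · have := hF₁c i
      rw [hs0, pow_zero, one_mul, hWj i hi] at this
      rw [this]
      exact Dvd.dvd.mul_left (dvd_pow_self _ (by omega)) _
  have hF₁nc : NonconstMod p F₁ := by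
    by_contra h
    simp only [NonconstMod, not_exists, not_and, not_not] at h
    apply hF₁
    rw [map_zmod_eq_zero_iff]
    intro i
    rcases Nat.eq_zero_or_pos i with rfl | hi
    · rw [hF₁0]; exact dvd_zero _
    · exact h i hi
  have hF₁deg : F₁.natDegree ≤ k := by
    have h1 : W.natDegree = F₁.natDegree := by rw [hWs, natDegree_C_mul hps]
    rw [← h1, hW]
    refine (natDegree_sub_le _ _).trans (max_le ?_ (by simp))
    refine natDegree_comp_le.trans ?_
    have : (C x₀ + C (p : ℤ) * X).natDegree ≤ 1 := by
      rw [add_comm]; exact natDegree_linear_le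
    nlinarith
  have hdne : derivative F₁ ≠ 0 := by
    obtain ⟨i, hi, hpi⟩ := hF₁nc
    intro h
    have := congrArg (fun f => coeff f (i - 1)) h
    simp only [coeff_derivative, coeff_zero] at this
    rw [show i - 1 + 1 = i by omega] at this
    rcases mul_eq_zero.1 this with h | h
    · apply hpi; rw [h]; exact dvd_zero _
    · omega
  obtain ⟨τ₁, g₁, hg₁, hg₁ne⟩ := exists_pow_mul_map_ne_zero (p := p) hdne
  refine ⟨s, F₁, τ₁, g₁, hs1, hs_le.trans hjk, ?_, hF₁deg, hF₁nc, hg₁, hg₁ne, ?_⟩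
  · intro z
    have := congrArg (eval z) hWs
    rw [hW] at this
    simp only [eval_sub, eval_comp, eval_add, eval_mul, eval_C, eval_X] at this
    linarith
  · -- compare derivatives of the two sides of `W = p ^ s * F₁`
    have hder : C ((p : ℤ) ^ (s + τ₁)) * g₁ = C ((p : ℤ) ^ (1 + τ)) * g.comp (C x₀ + C (p : ℤ) * X) := by
      have h1 := congrArg derivative hWs
      rw [hW, derivative_sub, derivative_C, sub_zero, derivative_comp, hd, derivative_C_mul, hg₁] at h1
      simp only [derivative_add, derivative_C, derivative_C_mul_X, zero_add, mul_comp, C_comp] at h1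
      rw [pow_add, pow_add, C_mul, C_mul, pow_one]
      linear_combination -h1
    have hco : ∀ i, (p : ℤ) ^ (s + τ₁) * g₁.coeff i =
        p ^ (1 + τ + i) * (taylor x₀ g).coeff i := by
      intro i
      have := congrArg (fun f => coeff f i) hder
      simp only [coeff_C_mul, coeff_comp_affine] at this
      rw [this]; ring
    have key : ∀ {a b : ℕ} {u v : ℤ}, (p : ℤ) ^ a * u = p ^ b * v → ¬ (p : ℤ) ∣ v → a ≤ b := by
      intro a b u v h hv
      have h2 : (p : ℤ) ^ a ∣ v * p ^ b := ⟨u, by rw [h]; ring⟩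
      have h4 : p ^ a ∣ p ^ b := by
        exact_mod_cast (IsCoprime.pow_left ((Prime.coprime_iff_not_dvd hpp).2 hv)).dvd_of_dvd_mul_left h2
      exact (Nat.pow_dvd_pow_iff_le_right hp.out.one_lt).1 h4
    have hcast : ∀ f : ℤ[X], ∀ i, (f.map (Int.castRingHom (ZMod p))).coeff i ≠ 0 →
        ¬ (p : ℤ) ∣ f.coeff i := by
      intro f i h h2
      apply h
      rw [coeff_map]
      simpa [ZMod.intCast_zmod_eq_zero_iff_dvd] using h2
    have hμ : ¬ (p : ℤ) ∣ (taylor x₀ g).coeff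
        ((g.map (Int.castRingHom (ZMod p))).rootMultiplicity (x₀ : ZMod p)) := by
      apply hcast
      rw [rootMultiplicity_eq_natTrailingDegree, map_taylor, taylor_apply]
      simp only [eq_intCast]
      rw [← trailingCoeff, Ne, trailingCoeff_eq_zero]
      have := (taylor_eq_zero (x₀ : ZMod p) (g.map (Int.castRingHom (ZMod p)))).not.2 hg
      rwa [taylor_apply] at this
    have hr : ¬ (p : ℤ) ∣ g₁.coeff (g₁.map (Int.castRingHom (ZMod p))).natDegree := by
      apply hcast
      rw [coeff_natDegree]
      exact leadingCoeff_ne_zero.2 hg₁ne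
    have i1 := key (hco _) hμ
    have i2 := key (hco _).symm hr
    omega

/-- The constant in Hua's estimate at a prime power. -/
def huaConst (k : ℕ) : ℕ := k ^ 3 + 2 * k * k.factorial

lemma sum_rootMultiplicity_le {g : (ZMod p)[X]} (s : Finset ℕ) (hs : s ⊆ range p) :
    ∑ x ∈ s, g.rootMultiplicity (x : ZMod p) ≤ g.natDegree := by
  classical
  have hinj : Set.InjOn (fun x : ℕ => (x : ZMod p)) s := by
    intro x hx y hy h
    have h1 := ZMod.val_cast_of_lt (mem_range.1 (hs hx))
    have h2 := ZMod.val_cast_of_lt (mem_range.1 (hs hy))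
    rw [← h1, ← h2]; exact congrArg ZMod.val h
  calc ∑ x ∈ s, g.rootMultiplicity (x : ZMod p)
      = ∑ a ∈ s.image (fun x : ℕ => (x : ZMod p)), g.roots.count a := by
        rw [sum_image hinj]; simp [count_roots]
    _ ≤ ∑ a : ZMod p, g.roots.count a := sum_le_sum_of_subset (subset_univ _)
    _ = g.roots.card := Multiset.sum_count_eq_card (by simp)
    _ ≤ _ := card_roots' _

/-- **Hua's estimate** at a prime power, in inductive form. -/
lemma gaussSum_primePow_aux {k : ℕ} {P : ℝ} (hk : 1 ≤ k) (hP1 : 1 ≤ P) (hP : P ^ k = p) (m : ℕ) :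
    ∀ (F g : ℤ[X]) (τ : ℕ), F.natDegree ≤ k → NonconstMod p F →
      derivative F = C ((p : ℤ) ^ τ) * g → g.map (Int.castRingHom (ZMod p)) ≠ 0 →
      ‖gaussSum F (p ^ m)‖ * P ^ m ≤
        (max 1 (g.map (Int.castRingHom (ZMod p))).natDegree : ℕ) * huaConst k * p ^ m := by
  induction m using Nat.strong_induction_on with
  | _ m ih =>
  intro F g τ hFk hF hd hg
  set r := (g.map (Int.castRingHom (ZMod p))).natDegree with hr
  have hp1 : (1 : ℝ) ≤ p := by exact_mod_cast hp.out.one_lt.le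
  have hp0 : (0 : ℝ) < p := by linarith
  have hPp : P ≤ p := by rw [← hP]; exact le_self_pow₀ hP1 (by omega)
  have htriv := norm_gaussSum_le F (p ^ m)
  push_cast at htriv
  have hK1 : (k : ℝ) ^ 3 ≤ huaConst k := by
    rw [huaConst]; push_cast
    have : (0 : ℝ) ≤ 2 * k * k.factorial := by positivity
    linarith
  have hK2 : (2 * k * k.factorial : ℝ) ≤ huaConst k := by
    rw [huaConst]; push_cast
    have : (0 : ℝ) ≤ (k : ℝ) ^ 3 := by positivity
    linarith
  have hk1 : (1 : ℝ) ≤ k := by exact_mod_cast hk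
  have hmax : (1 : ℝ) ≤ (max 1 r : ℕ) := by exact_mod_cast le_max_left 1 r
  -- it suffices to have the bound with `huaConst k` alone in the small cases
  have small : ‖gaussSum F (p ^ m)‖ * P ^ m ≤ huaConst k * p ^ m →
      ‖gaussSum F (p ^ m)‖ * P ^ m ≤ (max 1 r : ℕ) * huaConst k * p ^ m := by
    intro h
    refine h.trans ?_
    rw [mul_assoc]
    exact le_mul_of_one_le_left (by positivity) hmax
  have small2 : P ^ m ≤ huaConst k → ‖gaussSum F (p ^ m)‖ * P ^ m ≤ huaConst k * p ^ m := by
    intro h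
    rw [mul_comm]
    gcongr
  rcases Nat.lt_or_ge m (2 * τ + 2) with hmτ | hmτ
  · apply small
    rcases Nat.eq_zero_or_pos τ with h0 | hτ
    · have : m = 0 ∨ m = 1 := by omega
      rcases this with rfl | rfl
      · apply small2
        rw [pow_zero]
        exact (one_le_pow₀ hk1).trans hK1
      · rcases Nat.lt_or_ge k p with hkp | hkp
        · have := gaussSum_prime_le hk hP1 hP hFk hF hkp
          simp only [pow_one]
          refine this.trans ?_
          gcongr
        · apply small2
          rw [pow_one]
          have : (p : ℝ) ≤ k := by exact_mod_cast hkp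
          exact (hPp.trans this).trans ((le_self_pow₀ hk1 (by norm_num)).trans hK1)
    · apply small2
      have h1 : ((p ^ τ : ℕ) : ℝ) ≤ k := by exact_mod_cast pow_le_of_derivative_eq hFk hF hd
      calc P ^ m ≤ (p : ℝ) ^ m := by gcongr
        _ ≤ (p : ℝ) ^ (τ * 3) := pow_le_pow_right₀ hp1 (by omega)
        _ = ((p ^ τ : ℕ) : ℝ) ^ 3 := by push_cast; rw [pow_mul]
        _ ≤ (k : ℝ) ^ 3 := by gcongr
        _ ≤ _ := hK1
  · rw [gaussSum_pow_split F (by omega)]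
    set I : ℕ → ℂ := fun x => ∑ z ∈ range (p ^ (m - 1)),
      e (((F.eval ((x : ℤ) + p * (z : ℤ)) : ℤ) : ℝ) / (p ^ m : ℕ)) with hI
    have hzero : ∀ x ∈ range p, ¬ (p : ℤ) ∣ g.eval (x : ℤ) → I x = 0 := fun x _ hx =>
      local_sum_eq_zero hd hmτ hx
    have hmain : ∀ x ∈ range p, (p : ℤ) ∣ g.eval (x : ℤ) → ‖I x‖ * P ^ m ≤
        (g.map (Int.castRingHom (ZMod p))).rootMultiplicity (x : ZMod p) *
          (huaConst k * (p : ℝ) ^ m) := by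
      intro x _ hx
      have hroot : 1 ≤ (g.map (Int.castRingHom (ZMod p))).rootMultiplicity (x : ZMod p) := by
        rw [Nat.one_le_iff_ne_zero, ← Nat.pos_iff_ne_zero, rootMultiplicity_pos hg, IsRoot.def]
        have := Polynomial.eval_map_apply (Int.castRingHom (ZMod p)) (p := g) (x : ℤ)
        simp only [eq_intCast, Int.cast_natCast] at this
        rw [this, ZMod.intCast_zmod_eq_zero_iff_dvd]; exact hx
      obtain ⟨s, F₁, τ₁, g₁, hs1, hsk, hev, hF₁k, hF₁, hd₁, hg₁, hdeg⟩ :=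
        exists_recentred hFk hF hd hg (x : ℤ)
      rw [Int.cast_natCast] at hdeg
      set μ := (g.map (Int.castRingHom (ZMod p))).rootMultiplicity (x : ZMod p) with hμ
      have hμ1 : (1 : ℝ) ≤ μ := by exact_mod_cast hroot
      have hpm : (p : ℝ) ^ m = p ^ (m - 1) * p := by rw [← pow_succ]; congr 1; omega
      rcases Nat.lt_or_ge s m with hsm | hsm
      · set J := ∑ z ∈ range (p ^ (m - 1)),
          e (((F₁.eval (z : ℤ) : ℤ) : ℝ) / (p ^ (m - s) : ℕ)) with hJ
        have hpms : p ^ (m - s) ≠ 0 := pow_ne_zero _ hp.out.ne_zero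
        have h1 : I x = e (((F.eval (x : ℤ) : ℤ) : ℝ) / (p ^ m : ℕ)) * J := by
          rw [hI, hJ, mul_sum]
          refine sum_congr rfl fun z _ => ?_
          rw [← e_add, hev]
          congr 1
          have : (p : ℝ) ^ m = p ^ s * p ^ (m - s) := by rw [← pow_add]; congr 1; omega
          push_cast
          rw [this, add_div, mul_div_mul_left _ _ (by positivity)]
        have h2 : J = (p ^ (s - 1) : ℕ) * gaussSum F₁ (p ^ (m - s)) := by
          have h3 : p ^ (m - 1) = p ^ (m - s) * p ^ (s - 1) := by rw [← pow_add]; congr 1; omega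
          rw [hJ, h3, gaussSum]
          exact sum_range_mul_of_periodic
            (ψ := fun z : ℤ => e (((F₁.eval z : ℤ) : ℝ) / (p ^ (m - s) : ℕ)))
            (e_eval_periodic F₁ hpms) (p ^ (s - 1))
        have h4 := ih (m - s) (by omega) F₁ g₁ τ₁ hF₁k hF₁ hd₁ hg₁
        have h5 : ((max 1 (g₁.map (Int.castRingHom (ZMod p))).natDegree : ℕ) : ℝ) ≤ μ := by
          exact_mod_cast max_le hroot hdeg
        have h6 : P ^ s ≤ p := by rw [← hP]; exact pow_le_pow_right₀ hP1 hsk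
        have h7 : P ^ m = P ^ (m - s) * P ^ s := by rw [← pow_add]; congr 1; omega
        have h8 : (p : ℝ) ^ m = p ^ (s - 1) * p ^ (m - s) * p := by
          rw [← pow_add, ← pow_succ]; congr 1; omega
        have h9 : ‖I x‖ = p ^ (s - 1) * ‖gaussSum F₁ (p ^ (m - s))‖ := by
          rw [h1, h2, norm_mul, norm_e, one_mul, norm_mul]; simp
        calc ‖I x‖ * P ^ m
            = p ^ (s - 1) * (‖gaussSum F₁ (p ^ (m - s))‖ * P ^ (m - s)) * P ^ s := by
              rw [h9, h7]; ring
          _ ≤ p ^ (s - 1) * (μ * huaConst k * p ^ (m - s)) * p := by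
              have h10 := h4.trans (mul_le_mul_of_nonneg_right
                (mul_le_mul_of_nonneg_right h5 (Nat.cast_nonneg (huaConst k)))
                (by positivity : (0 : ℝ) ≤ p ^ (m - s)))
              gcongr
          _ = _ := by rw [h8]; ring
      · have h1 : ‖I x‖ ≤ (p : ℝ) ^ (m - 1) := by
          refine (norm_sum_le _ _).trans ?_
          simp
        have h2 : P ^ m ≤ p := by rw [← hP]; exact pow_le_pow_right₀ hP1 (hsm.trans hsk)
        have h3 : (1 : ℝ) ≤ huaConst k := (one_le_pow₀ hk1).trans hK1
        calc ‖I x‖ * P ^ m ≤ p ^ (m - 1) * p := by gcongr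
          _ = p ^ m := hpm.symm
          _ ≤ μ * (huaConst k * p ^ m) := by
            refine (le_mul_of_one_le_left (by positivity) h3).trans ?_
            exact le_mul_of_one_le_left (by positivity) hμ1
    calc ‖∑ x ∈ range p, I x‖ * P ^ m
        = ‖∑ x ∈ range p with (p : ℤ) ∣ g.eval ((x : ℕ) : ℤ), I x‖ * P ^ m := by
          congr 2
          rw [sum_filter]
          refine sum_congr rfl fun x hx => ?_
          split_ifs with h
          · rfl
          · exact hzero x hx h
      _ ≤ (∑ x ∈ range p with (p : ℤ) ∣ g.eval ((x : ℕ) : ℤ), ‖I x‖) * P ^ m := by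
          gcongr; exact norm_sum_le _ _
      _ = ∑ x ∈ range p with (p : ℤ) ∣ g.eval ((x : ℕ) : ℤ), ‖I x‖ * P ^ m := sum_mul _ _ _
      _ ≤ ∑ x ∈ range p with (p : ℤ) ∣ g.eval ((x : ℕ) : ℤ),
          (g.map (Int.castRingHom (ZMod p))).rootMultiplicity (x : ZMod p) *
          (huaConst k * (p : ℝ) ^ m) :=
          sum_le_sum fun x hx => hmain x (mem_filter.1 hx).1 (mem_filter.1 hx).2
      _ = ((∑ x ∈ range p with (p : ℤ) ∣ g.eval ((x : ℕ) : ℤ),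
          (g.map (Int.castRingHom (ZMod p))).rootMultiplicity (x : ZMod p) : ℕ) : ℝ) *
          (huaConst k * (p : ℝ) ^ m) := by rw [← sum_mul]; push_cast; rfl
      _ ≤ (max 1 r : ℕ) * (huaConst k * (p : ℝ) ^ m) := by
          gcongr
          exact (sum_rootMultiplicity_le _ (filter_subset _ _)).trans (le_max_right _ _)
      _ = _ := by ring

/-- **Hua's estimate** at a prime power. -/
lemma gaussSum_primePow_le {k : ℕ} {P : ℝ} (hk : 1 ≤ k) (hP1 : 1 ≤ P) (hP : P ^ k = p) (m : ℕ)
    {F : ℤ[X]} (hFk : F.natDegree ≤ k) (hF : NonconstMod p F) :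
    ‖gaussSum F (p ^ m)‖ * P ^ m ≤ (k * huaConst k : ℕ) * p ^ m := by
  have hdne : derivative F ≠ 0 := by
    obtain ⟨i, hi, hpi⟩ := hF
    intro h
    have := congrArg (fun f => coeff f (i - 1)) h
    simp only [coeff_derivative, coeff_zero] at this
    rw [show i - 1 + 1 = i by omega] at this
    rcases mul_eq_zero.1 this with h | h
    · apply hpi; rw [h]; exact dvd_zero _
    · omega
  obtain ⟨τ, g, hd, hg⟩ := exists_pow_mul_map_ne_zero (p := p) hdne
  refine (gaussSum_primePow_aux hk hP1 hP m F g τ hFk hF hd hg).trans ?_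
  have h1 : g.natDegree ≤ k := by
    have h2 : (derivative F).natDegree = g.natDegree := by
      rw [hd, natDegree_C_mul (pow_ne_zero _ (by exact_mod_cast hp.out.ne_zero))]
    rw [← h2]
    exact (natDegree_derivative_le F).trans (by omega)
  have h3 : max 1 (g.map (Int.castRingHom (ZMod p))).natDegree ≤ k :=
    max_le hk (natDegree_map_le.trans h1)
  rw [Nat.cast_mul]
  gcongr

end PrimePower

end MomentCurve

namespace MomentCurve

open Polynomial

lemma sum_range_mul_of_coprime {a b : ℕ} (hab : a.Coprime b) (ha : a ≠ 0) (hb : b ≠ 0)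
    {f g : ℕ → ℂ} (hf : ∀ x, f (x % a) = f x) (hg : ∀ x, g (x % b) = g x) :
    ∑ x ∈ range (a * b), f x * g x = (∑ x ∈ range a, f x) * ∑ x ∈ range b, g x := by
  rw [sum_mul_sum, ← sum_product']
  refine sum_bij' (fun x _ => (x % a, x % b))
    (fun ij _ => (Nat.chineseRemainder hab ij.1 ij.2 : ℕ)) ?_ ?_ ?_ ?_ ?_
  · intro x _
    rw [mem_product, mem_range, mem_range]
    exact ⟨Nat.mod_lt _ (Nat.pos_of_ne_zero ha), Nat.mod_lt _ (Nat.pos_of_ne_zero hb)⟩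
  · intro ij _
    exact mem_range.2 (Nat.chineseRemainder_lt_mul hab _ _ ha hb)
  · intro x hx
    have h := Nat.chineseRemainder_modEq_unique hab (a := x % a) (b := x % b) (z := x)
      (Nat.mod_modEq x a).symm (Nat.mod_modEq x b).symm
    have h2 := Nat.chineseRemainder_lt_mul hab (x % a) (x % b) ha hb
    exact ((Nat.ModEq.eq_of_lt_of_lt h (mem_range.1 hx) h2)).symm
  · rintro ⟨i, j⟩ hij
    rw [mem_product, mem_range, mem_range] at hij
    have h := (Nat.chineseRemainder hab i j).2
    ext
    · exact (Nat.mod_eq_of_modEq h.1 hij.1)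
    · exact (Nat.mod_eq_of_modEq h.2 hij.2)
  · intro x _
    simp only [hf, hg]

lemma gaussSum_mul {a b : ℕ} (hab : a.Coprime b) (ha : a ≠ 0) (hb : b ≠ 0) (F : ℤ[X]) {u v : ℤ}
    (huv : u * a + v * b = 1) :
    gaussSum F (a * b) = gaussSum (C v * F) a * gaussSum (C u * F) b := by
  have key : ∀ (G : ℤ[X]) (q : ℕ), q ≠ 0 → ∀ x : ℕ,
      e (((G.eval ((x % q : ℕ) : ℤ) : ℤ) : ℝ) / q) = e (((G.eval (x : ℤ) : ℤ) : ℝ) / q) := by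
    intro G q hq x
    refine e_div_eq_of_dvd hq (dvd_trans ?_ (Polynomial.sub_dvd_eval_sub _ _ G))
    rw [← dvd_neg, neg_sub]
    push_cast
    exact Int.dvd_self_sub_emod
  rw [gaussSum, gaussSum, gaussSum, ← sum_range_mul_of_coprime hab ha hb (key _ a ha) (key _ b hb)]
  refine sum_congr rfl fun x _ => ?_
  rw [← e_add]
  congr 1
  have ha' : (a : ℝ) ≠ 0 := by exact_mod_cast ha
  have hb' : (b : ℝ) ≠ 0 := by exact_mod_cast hb
  have h : (u * a + v * b : ℝ) = 1 := by exact_mod_cast huv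
  simp only [eval_mul, eval_C]
  push_cast
  field_simp
  linear_combination (-((F.eval (x : ℤ) : ℤ) : ℝ)) * h

lemma NonconstMod.C_mul {p : ℕ} (hp : p.Prime) {F : ℤ[X]} (hF : NonconstMod p F) {v : ℤ}
    (hv : ¬ (p : ℤ) ∣ v) : NonconstMod p (C v * F) := by
  obtain ⟨j, hj, h⟩ := hF
  refine ⟨j, hj, ?_⟩
  rw [coeff_C_mul]
  exact (Nat.prime_iff_prime_int.1 hp).not_dvd_mul hv h

/-- **Hua's estimate** for complete exponential sums. -/
lemma gaussSum_le {k : ℕ} (hk : 1 ≤ k) (q : ℕ) (hq : q ≠ 0) :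
    ∀ F : ℤ[X], F.natDegree ≤ k → (∀ p, p.Prime → p ∣ q → NonconstMod p F) →
    ‖gaussSum F q‖ ^ k * q ≤ ((k * huaConst k : ℕ) ^ #q.primeFactors * q : ℝ) ^ k := by
  induction q using Nat.recOnPosPrimePosCoprime with
  | prime_pow p m hp hm =>
    intro F hFk hF
    have : Fact p.Prime := ⟨hp⟩
    have hp1 : (1 : ℝ) ≤ p := by exact_mod_cast hp.one_lt.le
    set P : ℝ := (p : ℝ) ^ ((k : ℝ)⁻¹) with hP
    have hPk : P ^ k = p := Real.rpow_inv_natCast_pow (by positivity) (by omega)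
    have hP1 : 1 ≤ P := Real.one_le_rpow hp1 (by positivity)
    have h := gaussSum_primePow_le hk hP1 hPk m hFk (hF p hp (dvd_pow_self _ hm.ne'))
    rw [Nat.primeFactors_prime_pow hm.ne' hp, card_singleton, pow_one]
    calc ‖gaussSum F (p ^ m)‖ ^ k * (p ^ m : ℕ) = (‖gaussSum F (p ^ m)‖ * P ^ m) ^ k := by
          rw [mul_pow, ← pow_mul, mul_comm m k, pow_mul, hPk]; push_cast; rfl
      _ ≤ ((k * huaConst k : ℕ) * p ^ m) ^ k := by gcongr
      _ = _ := by push_cast; rfl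
  | zero => exact absurd rfl hq
  | one =>
    intro F _ _
    have := norm_gaussSum_le F 1
    have h2 : ‖gaussSum F 1‖ ^ k ≤ 1 := pow_le_one₀ (norm_nonneg _) (by simpa using this)
    simpa using h2
  | coprime a b ha hb hab iha ihb =>
    intro F hFk hF
    obtain ⟨u, v, huv⟩ := Nat.isCoprime_iff_coprime.2 hab
    rw [gaussSum_mul hab (by omega) (by omega) F huv]
    have h1 := iha (by omega) (C v * F) ((natDegree_C_mul_le _ _).trans hFk) fun p hp hpa =>
      (hF p hp (hpa.mul_right b)).C_mul hp fun hpv => hp.one_lt.ne' (by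
        have h : (p : ℤ) ∣ 1 := huv ▸ dvd_add
          ((Int.natCast_dvd_natCast.2 hpa).mul_left u) (hpv.mul_right _)
        exact Nat.dvd_one.1 (by exact_mod_cast h))
    have h2 := ihb (by omega) (C u * F) ((natDegree_C_mul_le _ _).trans hFk) fun p hp hpb =>
      (hF p hp (hpb.mul_left a)).C_mul hp fun hpu => hp.one_lt.ne' (by
        have h : (p : ℤ) ∣ 1 := huv ▸ dvd_add
          (hpu.mul_right _) ((Int.natCast_dvd_natCast.2 hpb).mul_left v)
        exact Nat.dvd_one.1 (by exact_mod_cast h))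
    rw [hab.primeFactors_mul, card_union_of_disjoint hab.disjoint_primeFactors, norm_mul]
    calc _ = (‖gaussSum (C v * F) a‖ ^ k * a) * (‖gaussSum (C u * F) b‖ ^ k * b) := by
          push_cast; ring
      _ ≤ _ := mul_le_mul h1 h2 (by positivity) (by positivity)
      _ = _ := by rw [← mul_pow]; push_cast; ring

end MomentCurve

namespace MomentCurve

open ArithmeticFunction

/-- The arithmetic function `n ↦ φ(n)/n`. -/
noncomputable def totientRatio : ArithmeticFunction ℝ := ⟨fun n => (n.totient : ℝ) / n, by simp⟩

lemma totientRatio_apply (n : ℕ) : totientRatio n = (n.totient : ℝ) / n := rfl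

lemma totientRatio_isMultiplicative : totientRatio.IsMultiplicative := by
  refine ⟨by simp [totientRatio_apply], fun {m n} h => ?_⟩
  simp only [totientRatio_apply, Nat.totient_mul h]
  push_cast
  rw [mul_div_mul_comm]

/-- Iterated weighted divisor functions. -/
noncomputable def divisorWeight : ℕ → ArithmeticFunction ℝ
  | 0 => 1
  | j + 1 => (totientRatio.pmul (divisorWeight j)) * (zeta : ArithmeticFunction ℝ)

lemma divisorWeight_isMultiplicative (j : ℕ) : (divisorWeight j).IsMultiplicative := by
  induction j with
  | zero => exact isMultiplicative_one
  | succ j ih =>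
    exact (totientRatio_isMultiplicative.pmul ih).mul isMultiplicative_zeta.natCast

lemma divisorWeight_succ_apply (j n : ℕ) :
    divisorWeight (j + 1) n = ∑ u ∈ n.divisors, (u.totient : ℝ) / u * divisorWeight j u := by
  rw [divisorWeight, coe_mul_zeta_apply]; rfl

lemma divisorWeight_nonneg (j n : ℕ) : 0 ≤ divisorWeight j n := by
  induction j generalizing n with
  | zero => rw [divisorWeight, one_apply]; split_ifs <;> norm_num
  | succ j ih =>
    rw [divisorWeight_succ_apply]
    exact sum_nonneg fun u _ => mul_nonneg (by positivity) (ih u)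

lemma divisorWeight_succ_prime_pow (j : ℕ) {p a : ℕ} (hp : p.Prime) (ha : 1 ≤ a) :
    1 + (1 - 1 / (p : ℝ)) * divisorWeight j (p ^ a) ≤ divisorWeight (j + 1) (p ^ a) := by
  have hp0 : (p : ℝ) ≠ 0 := by exact_mod_cast hp.ne_zero
  rw [divisorWeight_succ_apply]
  have hne : (1 : ℕ) ≠ p ^ a := (Nat.one_lt_pow (by omega) hp.one_lt).ne
  have hsub : ({1, p ^ a} : Finset ℕ) ⊆ (p ^ a).divisors := by
    intro x hx
    rw [mem_insert, mem_singleton] at hx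
    rw [Nat.mem_divisors]
    refine ⟨?_, pow_ne_zero _ hp.ne_zero⟩
    rcases hx with rfl | rfl <;> simp
  refine le_trans (le_of_eq ?_) (sum_le_sum_of_subset_of_nonneg hsub fun u _ _ =>
    mul_nonneg (by positivity) (divisorWeight_nonneg j u))
  rw [sum_pair hne, (divisorWeight_isMultiplicative j).map_one, Nat.totient_prime_pow hp (by omega)]
  have h1 : (p : ℝ) ^ a = p ^ (a - 1) * p := by rw [← pow_succ]; congr 1; omega
  have h2 : (p : ℝ) ^ (a - 1) ≠ 0 := pow_ne_zero _ hp0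
  push_cast [Nat.cast_sub hp.one_lt.le]
  rw [h1]
  field_simp
  simp

lemma le_divisorWeight_prime_pow (j : ℕ) {p a : ℕ} (hp : p.Prime) (ha : 1 ≤ a) :
    j * (1 - 1 / (p : ℝ)) ^ j ≤ divisorWeight j (p ^ a) := by
  have hp1 : (1 : ℝ) ≤ p := by exact_mod_cast hp.one_lt.le
  have h0 : 0 ≤ 1 - 1 / (p : ℝ) := by rw [sub_nonneg, div_le_one (by linarith)]; exact hp1
  have h1 : 1 - 1 / (p : ℝ) ≤ 1 := by rw [sub_le_self_iff]; positivity
  induction j with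
  | zero => simpa using divisorWeight_nonneg 0 _
  | succ j ih =>
    refine le_trans ?_ (divisorWeight_succ_prime_pow j hp ha)
    have h2 := mul_le_mul_of_nonneg_left ih h0
    have h3 : (1 - 1 / (p : ℝ)) ^ (j + 1) ≤ 1 := pow_le_one₀ h0 h1
    push_cast
    rw [add_mul, pow_succ'] at *
    linarith [mul_left_comm (1 - 1 / (p : ℝ)) j ((1 - 1 / (p : ℝ)) ^ j)]

lemma half_le_divisorWeight_prime_pow {j : ℕ} {p a : ℕ} (hp : p.Prime) (ha : 1 ≤ a)
    (hj : 2 * j ≤ p) : (j : ℝ) / 2 ≤ divisorWeight j (p ^ a) := by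
  refine le_trans ?_ (le_divisorWeight_prime_pow j hp ha)
  have hp0 : (0 : ℝ) < p := by exact_mod_cast hp.pos
  have hp1 : (1 : ℝ) ≤ p := by exact_mod_cast hp.one_lt.le
  have hb := one_add_mul_le_pow (a := -(1 / (p : ℝ))) (by
    have : 1 / (p : ℝ) ≤ 1 := by rw [div_le_one hp0]; exact hp1
    linarith) j
  rw [← sub_eq_add_neg] at hb
  have h2 : (j : ℝ) * (1 / p) ≤ 1 / 2 := by
    rw [mul_one_div, div_le_div_iff₀ hp0 (by norm_num)]
    have : (2 * j : ℝ) ≤ p := by exact_mod_cast hj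
    linarith
  have h3 : 1 / 2 ≤ (1 - 1 / (p : ℝ)) ^ j := by linarith
  have := mul_le_mul_of_nonneg_left h3 (Nat.cast_nonneg (α := ℝ) j)
  linarith

lemma one_le_divisorWeight_prime_pow {j : ℕ} {p a : ℕ} (hp : p.Prime) (ha : 1 ≤ a) (hj : 1 ≤ j) :
    1 ≤ divisorWeight j (p ^ a) := by
  obtain ⟨i, rfl⟩ : ∃ i, j = i + 1 := ⟨j - 1, by omega⟩
  refine le_trans ?_ (divisorWeight_succ_prime_pow i hp ha)
  have hp1 : (1 : ℝ) ≤ p := by exact_mod_cast hp.one_lt.le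
  have h0 : 0 ≤ 1 - 1 / (p : ℝ) := by rw [sub_nonneg, div_le_one (by linarith)]; exact hp1
  have := mul_nonneg h0 (divisorWeight_nonneg i (p ^ a))
  linarith

lemma le_divisorWeight {D : ℕ} (hD : 1 ≤ D) {q : ℕ} (hq : q ≠ 0) :
    (D : ℝ) ^ #q.primeFactors ≤ D ^ (4 * D) * divisorWeight (2 * D) q := by
  have hD1 : (1 : ℝ) ≤ D := by exact_mod_cast hD
  rw [(divisorWeight_isMultiplicative _).multiplicative_factorization _ hq, Finsupp.prod,
    Nat.support_factorization]
  have hcard : #{p ∈ q.primeFactors | p < 4 * D} ≤ 4 * D := by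
    refine (card_le_card (t := range (4 * D)) fun p hp => ?_).trans (card_range _).le
    exact mem_range.2 (mem_filter.1 hp).2
  rw [← card_filter_add_card_filter_not (s := q.primeFactors) (fun p => p < 4 * D),
    pow_add]
  have ha : ∀ p ∈ q.primeFactors, 1 ≤ q.factorization p := fun p hp =>
    (Nat.prime_of_mem_primeFactors hp).factorization_pos_of_dvd hq
      (Nat.dvd_of_mem_primeFactors hp)
  refine mul_le_mul (pow_le_pow_right₀ hD1 hcard) ?_ (by positivity) (by positivity)
  rw [← prod_const, ← prod_filter_mul_prod_filter_not q.primeFactors (fun p => p < 4 * D)]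
  refine le_trans ?_ (le_mul_of_one_le_left ?_ ?_)
  · refine prod_le_prod (fun _ _ => by positivity) fun p hp => ?_
    rw [mem_filter] at hp
    have := half_le_divisorWeight_prime_pow (j := 2 * D) (Nat.prime_of_mem_primeFactors hp.1)
      (ha p hp.1) (by omega)
    push_cast at this
    linarith
  · exact prod_nonneg fun p _ => divisorWeight_nonneg _ _
  · refine Finset.one_le_prod fun p hp => ?_
    rw [mem_filter] at hp
    exact one_le_divisorWeight_prime_pow (Nat.prime_of_mem_primeFactors hp.1)
      (ha p hp.1) (by omega)

lemma card_gcd_eq_mul {q u : ℕ} (hq : q ≠ 0) (hu : u ∣ q) (m : ℕ) :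
    #{n ∈ Ico 1 (1 + q * m) | q.gcd n = q / u} = m * u.totient := by
  induction m with
  | zero => simp
  | succ m ih =>
    have hper : Function.Periodic (fun n => q.gcd n = q / u) q := fun n => by simp
    have h1 := Nat.filter_Ico_card_eq_of_periodic (1 + q * m) q _ hper
    rw [Nat.count_eq_card_filter_range, ← Nat.totient_div_of_dvd (Nat.div_dvd_of_dvd hu),
      Nat.div_div_self hu hq] at h1
    have h2 : Ico 1 (1 + q * (m + 1)) = Ico 1 (1 + q * m) ∪ Ico (1 + q * m) (1 + q * m + q) := by
      rw [Ico_union_Ico_eq_Ico (by omega) (by omega)]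
      congr 1; ring
    rw [h2, filter_union, card_union_of_disjoint, ih, h1]
    · ring
    · exact disjoint_filter_filter (Ico_disjoint_Ico_consecutive _ _ _)

lemma sum_divisors_le_sum_gcd {q B : ℕ} (hq : 1 ≤ q) (hqB : q ≤ B) {g : ℕ → ℝ} (hg : ∀ u, 0 ≤ g u) :
    (B : ℝ) / (2 * q) * ∑ u ∈ q.divisors, u.totient * g u ≤
      ∑ n ∈ Icc 1 B, g (q / q.gcd n) := by
  have hq0 : q ≠ 0 := by omega
  rw [← sum_fiberwise_of_maps_to (s := Icc 1 B) (t := q.divisors) (g := fun n => q / q.gcd n)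
    (fun n _ => Nat.mem_divisors.2 ⟨Nat.div_dvd_of_dvd (Nat.gcd_dvd_left _ _), hq0⟩), mul_sum]
  refine sum_le_sum fun u hu => ?_
  have hu' := Nat.dvd_of_mem_divisors hu
  have hu0 : u ≠ 0 := fun h => hq0 (by rw [h] at hu'; exact zero_dvd_iff.1 hu')
  have h1 : ∑ n ∈ Icc 1 B with q / q.gcd n = u, g (q / q.gcd n) =
      #{n ∈ Icc 1 B | q / q.gcd n = u} * g u := by
    rw [← nsmul_eq_mul, ← sum_const]
    exact sum_congr rfl fun n hn => by rw [(mem_filter.1 hn).2]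
  rw [h1, ← mul_assoc]
  refine mul_le_mul_of_nonneg_right ?_ (hg u)
  have h2 : #{n ∈ Ico 1 (1 + q * (B / q)) | q.gcd n = q / u} ≤ #{n ∈ Icc 1 B | q / q.gcd n = u} := by
    refine card_le_card fun n hn => ?_
    rw [mem_filter, mem_Ico] at hn
    have := Nat.mul_div_le B q
    rw [mem_filter, mem_Icc, hn.2, Nat.div_div_self hu' hq0]
    exact ⟨⟨hn.1.1, by omega⟩, rfl⟩
  rw [card_gcd_eq_mul hq0 hu'] at h2
  have h3 : (B : ℝ) / (2 * q) ≤ (B / q : ℕ) := by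
    have h4 : B < q * (B / q) + q := by
      have := Nat.lt_mul_div_succ B hq
      linarith [Nat.mul_succ q (B / q)]
    have h5 : 1 ≤ B / q := Nat.div_pos hqB hq
    have h6 : B ≤ (B / q) * (2 * q) := by nlinarith
    rw [div_le_iff₀ (by positivity)]
    exact_mod_cast h6
  calc (B : ℝ) / (2 * q) * u.totient ≤ (B / q : ℕ) * u.totient := by gcongr
    _ ≤ _ := by exact_mod_cast h2

lemma exists_divisor_pigeonhole_aux {ι : Type*} (s : Finset ι) {E : ι → ℝ} (hE : ∀ i ∈ s, 0 ≤ E i)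
    {B : ℕ} (hB : 1 ≤ B) (J : ℕ) : ∀ q : ι → ℕ, (∀ i ∈ s, 1 ≤ q i ∧ q i ≤ B) →
    ∃ Q : ℕ, 1 ≤ Q ∧ Q ≤ B ^ J ∧
      (1 / 2 : ℝ) ^ J * ∑ i ∈ s, E i * (divisorWeight J (q i) / q i) ≤
        ∑ i ∈ s with q i ∣ Q, E i := by
  induction J with
  | zero =>
    intro q _
    refine ⟨1, le_rfl, by simp, ?_⟩
    rw [pow_zero, one_mul, sum_filter]
    refine sum_le_sum fun i _ => ?_
    rw [divisorWeight, one_apply]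
    simp only [Nat.dvd_one]
    split_ifs with h <;> simp [h]
  | succ J ih =>
    intro q hq
    set g : ℕ → ℝ := fun u => divisorWeight J u / u with hg
    have hg0 : ∀ u, 0 ≤ g u := fun u => div_nonneg (divisorWeight_nonneg _ _) (by positivity)
    have hBpos : (0 : ℝ) < B := by exact_mod_cast hB
    obtain ⟨n, hn, hnS⟩ : ∃ n ∈ Icc 1 B,
        (1 / 2 : ℝ) * ∑ i ∈ s, E i * (divisorWeight (J + 1) (q i) / q i) ≤
          ∑ i ∈ s, E i * g (q i / (q i).gcd n) := by
      apply exists_le_of_sum_le (nonempty_Icc.2 hB)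
      rw [sum_const, Nat.card_Icc, nsmul_eq_mul, sum_comm, mul_sum, mul_sum]
      refine sum_le_sum fun i hi => ?_
      rw [← mul_sum]
      have h1 := mul_le_mul_of_nonneg_left
        (sum_divisors_le_sum_gcd (hq i hi).1 (hq i hi).2 hg0) (hE i hi)
      refine le_trans (le_of_eq ?_) h1
      have h2 : ∑ u ∈ (q i).divisors, (u.totient : ℝ) * g u = divisorWeight (J + 1) (q i) := by
        rw [divisorWeight_succ_apply]
        exact sum_congr rfl fun u _ => by rw [hg]; ring
      rw [h2, Nat.add_sub_cancel]
      field_simp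
    rw [mem_Icc] at hn
    obtain ⟨Q, hQ1, hQB, hQ⟩ := ih (fun i => q i / (q i).gcd n) fun i hi => by
      have h1 := Nat.gcd_le_left n (hq i hi).1
      have h2 : 0 < (q i).gcd n := Nat.gcd_pos_of_pos_left _ (hq i hi).1
      exact ⟨Nat.div_pos h1 h2, (Nat.div_le_self _ _).trans (hq i hi).2⟩
    refine ⟨n * Q, Nat.mul_pos hn.1 hQ1, ?_, ?_⟩
    · rw [pow_succ']; exact Nat.mul_le_mul hn.2 hQB
    · calc _ = (1 / 2 : ℝ) ^ J * ((1 / 2 : ℝ) *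
            ∑ i ∈ s, E i * (divisorWeight (J + 1) (q i) / q i)) := by ring
        _ ≤ (1 / 2 : ℝ) ^ J * ∑ i ∈ s, E i * g (q i / (q i).gcd n) := by gcongr
        _ ≤ ∑ i ∈ s with q i / (q i).gcd n ∣ Q, E i := hQ
        _ ≤ _ := by
          refine sum_le_sum_of_subset_of_nonneg (fun i hi => ?_) fun i hi _ =>
            hE i (mem_filter.1 hi).1
          rw [mem_filter] at hi ⊢
          refine ⟨hi.1, ?_⟩
          rw [← Nat.mul_div_cancel' (Nat.gcd_dvd_left (q i) n)]
          exact mul_dvd_mul (Nat.gcd_dvd_right _ _) hi.2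

/-- Given moduli `q i ≤ B` with weights, some `Q` bounded by a power of `B` is divisible by moduli
carrying a proportion of the total of the weights divided by the moduli, even when the weights
are amplified by `D ^ ω(q i)`. -/
lemma exists_divisor_pigeonhole {D : ℕ} (hD : 1 ≤ D) {ι : Type*} (s : Finset ι) {E : ι → ℝ}
    (hE : ∀ i ∈ s, 0 ≤ E i) {B : ℕ} (hB : 1 ≤ B) (q : ι → ℕ) (hq : ∀ i ∈ s, 1 ≤ q i ∧ q i ≤ B) :
    ∃ Q : ℕ, 1 ≤ Q ∧ Q ≤ B ^ (2 * D) ∧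
      ∑ i ∈ s, E i * ((D : ℝ) ^ #(q i).primeFactors / q i) ≤
        (D : ℝ) ^ (4 * D) * 2 ^ (2 * D) * ∑ i ∈ s with q i ∣ Q, E i := by
  obtain ⟨Q, hQ1, hQB, hQ⟩ := exists_divisor_pigeonhole_aux s hE hB (2 * D) q hq
  refine ⟨Q, hQ1, hQB, ?_⟩
  calc _ ≤ ∑ i ∈ s, (D : ℝ) ^ (4 * D) * (E i * (divisorWeight (2 * D) (q i) / q i)) := by
        refine sum_le_sum fun i hi => ?_
        have h1 := le_divisorWeight hD (q := q i) (by have := (hq i hi).1; omega)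
        have h2 := hE i hi
        calc _ ≤ E i * ((D ^ (4 * D) * divisorWeight (2 * D) (q i)) / q i) := by gcongr
          _ = _ := by ring
    _ = (D : ℝ) ^ (4 * D) * 2 ^ (2 * D) * ((1 / 2 : ℝ) ^ (2 * D) *
          ∑ i ∈ s, E i * (divisorWeight (2 * D) (q i) / q i)) := by
        rw [← mul_sum, one_div, inv_pow]; field_simp
    _ ≤ _ := by gcongr

end MomentCurve

namespace MomentCurve

/-- `x` lies within `ε` of an integer. -/
def NearInt (x ε : ℝ) : Prop := ∃ b : ℤ, |x - b| ≤ ε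

lemma NearInt.mono {x ε ε' : ℝ} (h : NearInt x ε) (hε : ε ≤ ε') : NearInt x ε' :=
  let ⟨b, hb⟩ := h; ⟨b, hb.trans hε⟩

lemma NearInt.add {x y ε ε' : ℝ} (h : NearInt x ε) (h' : NearInt y ε') :
    NearInt (x + y) (ε + ε') := by
  obtain ⟨b, hb⟩ := h
  obtain ⟨c, hc⟩ := h'
  refine ⟨b + c, ?_⟩
  push_cast
  calc |x + y - (b + c)| = |(x - b) + (y - c)| := by congr 1; ring
    _ ≤ _ := (abs_add_le _ _).trans (add_le_add hb hc)

lemma NearInt.int_mul {x ε : ℝ} (h : NearInt x ε) (n : ℤ) : NearInt (n * x) (|(n : ℝ)| * ε) := by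
  obtain ⟨b, hb⟩ := h
  refine ⟨n * b, ?_⟩
  push_cast
  rw [← mul_sub, abs_mul]
  gcongr

lemma NearInt.nat_mul {x ε : ℝ} (h : NearInt x ε) (n : ℕ) : NearInt (n * x) (n * ε) := by
  simpa using h.int_mul n

lemma NearInt.sub {x y ε ε' : ℝ} (h : NearInt x ε) (h' : NearInt y ε') :
    NearInt (x - y) (ε + ε') := by
  have := h.add (h'.int_mul (-1))
  simpa [sub_eq_add_neg] using this

lemma NearInt.sum {ι : Type*} (s : Finset ι) {x ε : ι → ℝ} (h : ∀ i ∈ s, NearInt (x i) (ε i)) :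
    NearInt (∑ i ∈ s, x i) (∑ i ∈ s, ε i) := by
  classical
  induction s using Finset.induction_on with
  | empty => exact ⟨0, by simp⟩
  | insert a s ha ih =>
    rw [sum_insert ha, sum_insert ha]
    exact (h a (mem_insert_self _ _)).add (ih fun i hi => h i (mem_insert_of_mem hi))

lemma nearInt_half (x : ℝ) : NearInt x (1 / 2) := ⟨round x, abs_sub_round x⟩

lemma norm_sq_sum_range (z : ℕ → ℂ) (m : ℕ) :
    ‖∑ i ∈ range m, z i‖ ^ 2 = ∑ i ∈ range m, ‖z i‖ ^ 2 +
      2 * ∑ h ∈ range m, (∑ i ∈ range (m - (h + 1)), z (i + (h + 1)) * starRingEnd ℂ (z i)).re := by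
  induction m with
  | zero => simp
  | succ m ih =>
    have h1 : ∑ h ∈ range (m + 1),
        (∑ i ∈ range (m + 1 - (h + 1)), z (i + (h + 1)) * starRingEnd ℂ (z i)).re =
        ∑ h ∈ range m, (∑ i ∈ range (m - (h + 1)), z (i + (h + 1)) * starRingEnd ℂ (z i)).re +
        (z m * starRingEnd ℂ (∑ i ∈ range m, z i)).re := by
      rw [sum_range_succ]
      have h2 : z m * starRingEnd ℂ (∑ i ∈ range m, z i) =
          ∑ h ∈ range m, z m * starRingEnd ℂ (z (m - 1 - h)) := by
        rw [sum_range_reflect (fun i => z m * starRingEnd ℂ (z i)) m, map_sum, mul_sum]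
      rw [h2, Complex.re_sum (s := range m), ← sum_add_distrib]
      have h3 : ∀ h ∈ range m,
          (∑ i ∈ range (m + 1 - (h + 1)), z (i + (h + 1)) * starRingEnd ℂ (z i)).re =
          (∑ i ∈ range (m - (h + 1)), z (i + (h + 1)) * starRingEnd ℂ (z i)).re +
          (z m * starRingEnd ℂ (z (m - 1 - h))).re := by
        intro h hh
        rw [mem_range] at hh
        rw [show m + 1 - (h + 1) = (m - (h + 1)) + 1 by omega, sum_range_succ, Complex.add_re,
          show m - (h + 1) + (h + 1) = m by omega, show m - (h + 1) = m - 1 - h by omega]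
      rw [sum_congr rfl h3]
      simp
    rw [h1, sum_range_succ, sum_range_succ, mul_add, ← add_assoc,
      add_right_comm _ (‖z m‖ ^ 2), ← ih, ← Complex.normSq_eq_norm_sq, ← Complex.normSq_eq_norm_sq,
      ← Complex.normSq_eq_norm_sq, Complex.normSq_add]
    have : (z m * starRingEnd ℂ (∑ i ∈ range m, z i)).re =
        ((∑ i ∈ range m, z i) * starRingEnd ℂ (z m)).re := by
      rw [← Complex.conj_re, map_mul, Complex.conj_conj, mul_comm]
    rw [this]

/-- The van der Corput inequality. -/
lemma norm_sq_sum_range_le (z : ℕ → ℂ) (hz : ∀ i, ‖z i‖ ≤ 1) (m : ℕ) :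
    ‖∑ i ∈ range m, z i‖ ^ 2 ≤ m +
      2 * ∑ h ∈ range m, ‖∑ i ∈ range (m - (h + 1)), z (i + (h + 1)) * starRingEnd ℂ (z i)‖ := by
  rw [norm_sq_sum_range]
  gcongr with h _
  · calc _ ≤ ∑ i ∈ range m, (1 : ℝ) := sum_le_sum fun i _ => pow_le_one₀ (norm_nonneg _) (hz i)
      _ = m := by simp
  · exact Complex.re_le_norm _

set_option maxHeartbeats 1000000 in
/-- If many multiples `hθ` are close to integers, then `θ` is close to a rational with small
denominator. -/
lemma exists_nearInt_of_many {M R : ℕ} (hR : 1 ≤ R) (hM : 200 * R ^ 3 ≤ M) {H : Finset ℕ}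
    (hHM : H ⊆ range M) (hH : M ≤ R * #H) {θ ε : ℝ} (hε : ε * M ≤ R)
    (hθ : ∀ h ∈ H, NearInt (h * θ) ε) :
    ∃ q : ℕ, 1 ≤ q ∧ q ≤ 2 * R ∧ NearInt (q * θ) (300 * R ^ 3 * ε / M) := by
  have hR3 : R ≤ R ^ 3 := le_self_pow₀ hR (by norm_num)
  have hM0 : 0 < M := by omega
  have hHpos : 0 < #H := Nat.pos_of_ne_zero fun h => by rw [h] at hH; omega
  -- two close elements
  obtain ⟨h₁, hh₁, h₂, hh₂, hne, hdiv⟩ : ∃ h₁ ∈ H, ∃ h₂ ∈ H, h₁ ≠ h₂ ∧ h₁ / (2 * R) = h₂ / (2 * R) := by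
    apply exists_ne_map_eq_of_card_lt_of_maps_to (t := range (M / (2 * R) + 1))
    · rw [card_range]
      have h1 := Nat.div_mul_le_self M (2 * R)
      by_contra hcon
      have h2 : #H ≤ M / (2 * R) + 1 := by omega
      have h3 : R * #H ≤ R * (M / (2 * R) + 1) := Nat.mul_le_mul_left _ h2
      nlinarith
    · intro h hh
      have := mem_range.1 (hHM hh)
      exact mem_coe.2 (mem_range.2 (Nat.lt_succ_of_le (Nat.div_le_div_right this.le)))
  wlog hlt : h₁ < h₂ generalizing h₁ h₂
  · exact this h₂ hh₂ h₁ hh₁ hne.symm hdiv.symm (by omega)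
  set q := h₂ - h₁ with hq
  have hq1 : 1 ≤ q := by omega
  have hq2 : q ≤ 2 * R := by
    have h1 := Nat.div_add_mod h₁ (2 * R)
    have h2 := Nat.div_add_mod h₂ (2 * R)
    have h3 := Nat.mod_lt h₂ (show 0 < 2 * R by omega)
    rw [hdiv] at h1
    omega
  refine ⟨q, hq1, hq2, ?_⟩
  obtain ⟨a, ha⟩ : NearInt (q * θ) (ε + ε) := by
    have := (hθ h₂ hh₂).sub (hθ h₁ hh₁)
    rw [hq, Nat.cast_sub hlt.le, sub_mul]; exact this
  set κ := q * θ - a with hκ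
  -- many elements in a window and a residue class
  set L := M / (16 * R) with hL
  have hL1 : 12 ≤ L := by
    rw [hL, Nat.le_div_iff_mul_le (by omega)]; nlinarith
  have hLM : M < 16 * R * (L + 1) := Nat.lt_mul_div_succ M (by omega)
  have hLM2 : 16 * R * L ≤ M := Nat.mul_div_le _ _
  set n := M / (40 * R ^ 3) with hn
  have hnM : M < 40 * R ^ 3 * (n + 1) := Nat.lt_mul_div_succ M (by positivity)
  have hnM2 : 40 * R ^ 3 * n ≤ M := Nat.mul_div_le _ _
  have hn5 : 5 ≤ n := by
    rw [hn, Nat.le_div_iff_mul_le (by positivity)]; omega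
  obtain ⟨⟨w, r⟩, hwr, hcard⟩ : ∃ y ∈ range (20 * R) ×ˢ range (2 * R),
      n ≤ #{h ∈ H | (h / L, h % q) = y} := by
    apply exists_le_card_fiber_of_mul_le_card_of_maps_to
    · intro h hh
      rw [mem_product, mem_range, mem_range]
      have h1 := mem_range.1 (hHM hh)
      refine ⟨?_, (Nat.mod_lt _ hq1).trans_le hq2⟩
      show h / L < 20 * R
      rw [Nat.div_lt_iff_lt_mul (by omega)]
      nlinarith
    · exact ⟨(0, 0), by simp; omega⟩
    · rw [card_product, card_range, card_range]
      have h1 : R * (20 * R * (2 * R) * n) ≤ R * #H := by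
        refine le_trans ?_ hH
        calc _ = 40 * R ^ 3 * n := by ring
          _ ≤ M := hnM2
      exact Nat.le_of_mul_le_mul_left h1 hR
  set S := {h ∈ H | (h / L, h % q) = (w, r)} with hS
  have hSne : S.Nonempty := card_pos.1 (by omega)
  have hmemS : ∀ h ∈ S, h ∈ H ∧ h / L = w ∧ h % q = r := fun h hh => by
    rw [hS, mem_filter, Prod.mk.injEq] at hh; exact hh
  set u := S.min' hSne with hu
  set v := S.max' hSne with hv
  obtain ⟨huH, huw, hur⟩ := hmemS u (min'_mem _ _)
  obtain ⟨hvH, hvw, hvr⟩ := hmemS v (max'_mem _ _)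
  have huv : u ≤ v := min'_le _ _ (max'_mem _ _)
  set m := (v - u) / q with hm
  have hqm : q * m = v - u := by
    rw [hm]; apply Nat.mul_div_cancel'
    exact (Nat.modEq_iff_dvd' huv).1 (by rw [Nat.ModEq, hur, hvr])
  have hnm : n ≤ m + 1 := by
    refine hcard.trans ?_
    calc #S ≤ #((range (m + 1)).image fun i => u + q * i) := by
          refine card_le_card fun h hh => ?_
          obtain ⟨-, -, hhr⟩ := hmemS h hh
          have h1 : u ≤ h := min'_le _ _ hh
          have h2 : h ≤ v := le_max' _ _ hh
          have h3 : q ∣ h - u := (Nat.modEq_iff_dvd' h1).1 (by rw [Nat.ModEq, hur, hhr])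
          rw [mem_image]
          refine ⟨(h - u) / q, ?_, ?_⟩
          · rw [mem_range, Nat.lt_succ_iff]; exact Nat.div_le_div_right (by omega)
          · rw [Nat.mul_div_cancel' h3]; omega
      _ ≤ m + 1 := card_image_le.trans (card_range _).le
  have hqmL : q * m ≤ L := by
    rw [hqm]
    have h1 := Nat.div_add_mod u L
    have h2 := Nat.div_add_mod v L
    have h3 := Nat.mod_lt v (show 0 < L by omega)
    rw [huw] at h1; rw [hvw] at h2
    omega
  have hε0 : 0 ≤ ε := by
    obtain ⟨b, hb⟩ := hθ u huH
    exact (abs_nonneg _).trans hb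
  obtain ⟨b, hb⟩ : NearInt (m * (q * θ)) (ε + ε) := by
    have := (hθ v hvH).sub (hθ u huH)
    rw [← sub_mul, ← Nat.cast_sub huv, ← hqm] at this
    push_cast at this
    rwa [← mul_assoc, mul_comm (m : ℝ)]
  have hMr : (0 : ℝ) < M := by exact_mod_cast hM0
  have hRr : (1 : ℝ) ≤ R := by exact_mod_cast hR
  have hεL : 16 * (L * ε) ≤ 1 := by
    have h1 : (16 * R * L : ℝ) ≤ M := by exact_mod_cast hLM2
    have h2 : (R : ℝ) * (16 * (L * ε)) ≤ R * 1 := by nlinarith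
    exact le_of_mul_le_mul_left h2 (by linarith)
  have hmL : (m : ℝ) ≤ L := by
    have : m ≤ L := le_trans (Nat.le_mul_of_pos_left m hq1) hqmL
    exact_mod_cast this
  have hmκ : |m * κ| ≤ 1 / 8 := by
    rw [abs_mul, Nat.abs_cast]
    calc m * |κ| ≤ L * (ε + ε) := by gcongr
      _ ≤ 1 / 8 := by linarith
  have hε8 : ε + ε ≤ 1 / 8 := by
    have : (12 : ℝ) ≤ L := by exact_mod_cast hL1
    nlinarith
  have hint : b - m * a = 0 := by
    have h1 : |((b - m * a : ℤ) : ℝ)| < 1 := by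
      have h2 : ((b - m * a : ℤ) : ℝ) = m * κ - (m * (q * θ) - b) := by
        rw [hκ]; push_cast; ring
      rw [h2]
      exact (abs_sub _ _).trans_lt (by linarith)
    have h3 : |b - m * a| < 1 := by exact_mod_cast h1
    exact Int.abs_lt_one_iff.1 h3
  have hfin : m * |κ| ≤ ε + ε := by
    have h1 : (b : ℝ) = m * a := by
      have : b = m * a := by linarith
      exact_mod_cast this
    rw [h1] at hb
    rw [← Nat.abs_cast m, ← abs_mul, hκ, mul_sub]; exact hb
  refine ⟨a, ?_⟩
  rw [← hκ, le_div_iff₀ hMr]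
  have hMm : (M : ℝ) ≤ 150 * R ^ 3 * m := by
    have h1 : M ≤ 150 * R ^ 3 * m := by
      have : n + 1 ≤ 3 * m := by omega
      calc M ≤ 40 * R ^ 3 * (n + 1) := hnM.le
        _ ≤ 40 * R ^ 3 * (3 * m) := by gcongr
        _ = 120 * (R ^ 3 * m) := by ring
        _ ≤ 150 * (R ^ 3 * m) := Nat.mul_le_mul_right _ (by norm_num)
        _ = _ := by ring
    exact_mod_cast h1
  calc |κ| * M ≤ |κ| * (150 * R ^ 3 * m) := by gcongr
    _ = 150 * R ^ 3 * (m * |κ|) := by ring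
    _ ≤ 150 * R ^ 3 * (ε + ε) := by gcongr
    _ = _ := by ring

end MomentCurve

namespace MomentCurve

open Polynomial

lemma natDegree_taylor_sub_le {f : ℝ[X]} {k : ℕ} (hf : f.natDegree ≤ k + 1) (h : ℝ) :
    (taylor h f - f).natDegree ≤ k := by
  rw [natDegree_le_iff_coeff_eq_zero]
  intro N hN
  have h1 : (taylor h f).natDegree ≤ k + 1 := by rwa [natDegree_taylor]
  rcases Nat.lt_or_ge (k + 1) N with h2 | h2
  · rw [coeff_sub, coeff_eq_zero_of_natDegree_lt (h1.trans_lt h2),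
      coeff_eq_zero_of_natDegree_lt (hf.trans_lt h2), sub_zero]
  · obtain rfl : N = k + 1 := by omega
    rw [coeff_sub, taylor_coeff, eval_eq_sum_range' (n := 1)]
    · rw [sum_range_one, hasseDeriv_coeff]; simp
    · have := natDegree_hasseDeriv_le f (k + 1)
      omega

lemma coeff_taylor_sub {f : ℝ[X]} {k : ℕ} (hf : f.natDegree ≤ k + 1) (h : ℝ) :
    (taylor h f - f).coeff k = (k + 1) * f.coeff (k + 1) * h := by
  rw [coeff_sub, taylor_coeff, eval_eq_sum_range' (n := 2)]
  · rw [sum_range_succ, sum_range_one, hasseDeriv_coeff, hasseDeriv_coeff]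
    simp [add_comm 1 k]
  · have := natDegree_hasseDeriv_le f k
    omega

lemma norm_le_sum_of_le {m : ℕ} (f : ℝ[X]) :
    ‖∑ i ∈ range m, e (f.eval (i : ℝ))‖ ^ 2 ≤ m +
      2 * ∑ h ∈ range m, ‖∑ i ∈ range (m - h), e ((taylor (h : ℝ) f - f).eval (i : ℝ))‖ := by
  refine (norm_sq_sum_range_le (fun i => e (f.eval (i : ℝ))) (fun i => by simp) m).trans ?_
  have h1 : ∀ h : ℕ, ∑ i ∈ range (m - h), e (f.eval ((i + h : ℕ) : ℝ)) *
      starRingEnd ℂ (e (f.eval (i : ℝ))) =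
      ∑ i ∈ range (m - h), e ((taylor (h : ℝ) f - f).eval (i : ℝ)) := by
    intro h
    refine sum_congr rfl fun i _ => ?_
    rw [← e_sub, eval_sub, taylor_eval]; push_cast; rfl
  simp_rw [h1]
  refine add_le_add le_rfl (mul_le_mul_of_nonneg_left ?_ zero_le_two)
  have h2 := sum_range_succ'
    (fun h : ℕ => ‖∑ i ∈ range (m - h), e ((taylor (h : ℝ) f - f).eval (i : ℝ))‖) m
  rw [sum_range_succ] at h2
  simp only [Nat.sub_self, range_zero, sum_empty, norm_zero, add_zero] at h2
  rw [h2]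
  exact le_add_of_nonneg_right (norm_nonneg _)

lemma exists_card_le_mul_card_fiber {α β : Type*} [DecidableEq β] {s : Finset α} {t : Finset β}
    {f : α → β} (hf : ∀ a ∈ s, f a ∈ t) (hs : s.Nonempty) :
    ∃ y ∈ t, #s ≤ #t * #{x ∈ s | f x = y} := by
  have ht : t.Nonempty := let ⟨a, ha⟩ := hs; ⟨f a, hf a ha⟩
  have ht0 : (0 : ℝ) < #t := by exact_mod_cast card_pos.2 ht
  obtain ⟨y, hy, h⟩ := exists_le_card_fiber_of_nsmul_le_card_of_maps_to (b := (#s : ℝ) / #t) hf ht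
    (by rw [nsmul_eq_mul]; field_simp; exact le_rfl)
  refine ⟨y, hy, ?_⟩
  rw [div_le_iff₀ ht0, mul_comm] at h
  exact_mod_cast h

/-- The linear case of Weyl's inequality. -/
lemma weyl_linear {T M m : ℕ} (hT : 2 ≤ T) (hM : 1 ≤ M) {f : ℝ[X]} (hf : f.natDegree ≤ 1)
    (h : (M : ℝ) ≤ T * ‖∑ i ∈ range m, e (f.eval (i : ℝ))‖) :
    NearInt (f.coeff 1) (T / M) := by
  set α := f.coeff 1 with hα
  set β := α - round α with hβ
  have hβ2 : |β| ≤ 1 / 2 := abs_sub_round α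
  refine ⟨round α, ?_⟩
  rw [← hβ]
  have hMr : (0 : ℝ) < M := by exact_mod_cast hM
  have hTr : (0 : ℝ) < T := by exact_mod_cast (by omega : 0 < T)
  have hS : ∑ i ∈ range m, e (f.eval (i : ℝ)) = e (f.coeff 0) * ∑ i ∈ range m, e β ^ i := by
    rw [mul_sum]
    refine sum_congr rfl fun i _ => ?_
    rw [← e_nat_mul, ← e_add, eval_eq_sum_range' (n := 2) (by omega), sum_range_succ,
      sum_range_one, ← hα]
    refine e_eq_of_sub_int (round α * i) ?_
    rw [hβ]; push_cast; ring
  rw [hS, norm_mul, norm_e, one_mul] at h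
  have h1 : ‖(∑ i ∈ range m, e β ^ i) * (e β - 1)‖ ≤ 2 := by
    rw [geom_sum_mul, ← e_nat_mul]
    refine (norm_sub_le _ _).trans ?_
    rw [norm_e]; simp; norm_num
  rw [norm_mul] at h1
  have h2 := four_mul_le_norm_e_sub_one hβ2
  set G := ‖∑ i ∈ range m, e β ^ i‖
  have h3 : G * (4 * |β|) ≤ 2 := le_trans (by gcongr) h1
  rw [le_div_iff₀ hMr]
  calc |β| * M ≤ |β| * (T * G) := by gcongr
    _ = T * (G * (4 * |β|)) / 4 := by ring
    _ ≤ T * 2 / 4 := by gcongr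
    _ ≤ T := by linarith

/-- Weyl's inequality in inverse form, for the leading coefficient. -/
lemma weyl_leading {k : ℕ} (hk : 1 ≤ k) : ∃ C : ℕ, ∀ T : ℕ, 2 ≤ T → ∀ M m : ℕ, 1 ≤ M → m ≤ M →
    ∀ f : ℝ[X], f.natDegree ≤ k → (M : ℝ) ≤ T * ‖∑ i ∈ range m, e (f.eval (i : ℝ))‖ →
    ∃ q : ℕ, 1 ≤ q ∧ q ≤ T ^ C ∧ NearInt (q * f.coeff k) (T ^ C / M ^ k) := by
  induction k, hk using Nat.le_induction with
  | base =>
    refine ⟨1, fun T hT M m hM hm f hf h => ⟨1, le_rfl, by simp; omega, ?_⟩⟩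
    simpa using weyl_linear hT hM hf h
  | succ k hk ih =>
    obtain ⟨C, hC⟩ := ih
    refine ⟨30 * (C + 1) * (k + 1), fun T hT M m hM hm f hf h => ?_⟩
    set E := 30 * (C + 1) * (k + 1) with hE
    have hEle : 30 * (C + 1) ≤ E := Nat.le_mul_of_pos_right _ (by omega)
    have hEle2 : 30 * (k + 1) ≤ E := by
      rw [hE]; nlinarith [Nat.zero_le (C * (k + 1))]
    set T1 := 8 * T ^ 2 with hT1
    set R := T1 ^ (C + 1) with hR
    have hT1T : T1 ≤ T ^ 5 := by
      have : 8 ≤ T ^ 3 := by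
        calc 8 = 2 ^ 3 := by norm_num
          _ ≤ T ^ 3 := Nat.pow_le_pow_left hT 3
      calc T1 ≤ T ^ 3 * T ^ 2 := Nat.mul_le_mul_right _ this
        _ = T ^ 5 := by ring
    have hT1one : 1 ≤ T1 := by rw [hT1]; nlinarith
    have hT2 : 2 * T ^ 2 ≤ T1 := by omega
    have hR1 : 1 ≤ R := Nat.one_le_pow _ _ hT1one
    have hT1R : T1 ≤ R := by
      rw [hR]; exact Nat.le_self_pow (by omega) _
    have hRT : R ≤ T ^ (5 * (C + 1)) := by
      rw [pow_mul]; exact Nat.pow_le_pow_left hT1T _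
    have hR3T : 300 * R ^ 3 ≤ T ^ (9 + 15 * (C + 1)) := by
      calc 300 * R ^ 3 ≤ 2 ^ 9 * (T ^ (5 * (C + 1))) ^ 3 := by gcongr; norm_num
        _ ≤ T ^ 9 * (T ^ (5 * (C + 1))) ^ 3 := by gcongr
        _ = _ := by rw [← pow_mul, ← pow_add]; congr 1; ring
    have hMr : (0 : ℝ) < M := by exact_mod_cast hM
    have hTr : (0 : ℝ) < T := by exact_mod_cast (by omega : 0 < T)
    rcases Nat.lt_or_ge M (200 * R ^ 3) with hsmall | hbig
    · refine ⟨1, le_rfl, Nat.one_le_pow _ _ (by omega), (nearInt_half _).mono ?_⟩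
      have h1 : M ^ (k + 1) ≤ T ^ E := by
        calc M ^ (k + 1) ≤ (T ^ (9 + 15 * (C + 1))) ^ (k + 1) :=
              Nat.pow_le_pow_left (by omega) _
          _ = T ^ ((9 + 15 * (C + 1)) * (k + 1)) := by rw [← pow_mul]
          _ ≤ T ^ E := Nat.pow_le_pow_right (by omega) (Nat.mul_le_mul_right _ (by omega))
      rw [le_div_iff₀ (by positivity)]
      have h2 : (M : ℝ) ^ (k + 1) ≤ (T : ℝ) ^ E := by exact_mod_cast h1
      have h3 : (0 : ℝ) ≤ (M : ℝ) ^ (k + 1) := by positivity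
      linarith
    · set I : ℕ → ℝ := fun h => ‖∑ i ∈ range (m - h), e ((taylor (h : ℝ) f - f).eval (i : ℝ))‖ with hI
      have hvdc := norm_le_sum_of_le (m := m) f
      set H := {h ∈ range m | (M : ℝ) ≤ T1 * I h} with hH
      have hIM : ∀ h, I h ≤ M := fun h => by
        refine (norm_sum_le _ _).trans ?_
        simp only [norm_e, sum_const, card_range, nsmul_eq_mul, mul_one]
        exact_mod_cast (Nat.sub_le m h).trans hm
      have hT1r : (0 : ℝ) < T1 := by exact_mod_cast hT1one
      have hsum : ∑ h ∈ range m, I h ≤ #H * M + M * (M / T1) := by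
        rw [← sum_filter_add_sum_filter_not (range m) (fun h => (M : ℝ) ≤ T1 * I h)]
        refine add_le_add ?_ ?_
        · rw [← nsmul_eq_mul]
          exact sum_le_card_nsmul _ _ _ fun h _ => hIM h
        · refine (sum_le_card_nsmul _ _ (M / T1 : ℝ) fun h hh => ?_).trans ?_
          · rw [le_div_iff₀ hT1r, mul_comm]
            exact (not_le.1 (mem_filter.1 hh).2).le
          · rw [nsmul_eq_mul]
            gcongr
            refine (card_filter_le _ _).trans ?_
            rw [card_range]; exact hm
      have hHcard : M ≤ T1 * #H := by
        have h1 : (M : ℝ) ^ 2 ≤ T ^ 2 * (M + 2 * (#H * M + M * (M / T1))) := by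
          calc (M : ℝ) ^ 2 ≤ (T * ‖∑ i ∈ range m, e (f.eval (i : ℝ))‖) ^ 2 := by gcongr
            _ = T ^ 2 * ‖∑ i ∈ range m, e (f.eval (i : ℝ))‖ ^ 2 := by ring
            _ ≤ T ^ 2 * (m + 2 * ∑ h ∈ range m, I h) := by gcongr
            _ ≤ _ := by gcongr
        have h2 : (T : ℝ) ^ 2 * (2 * (M * (M / T1))) = M ^ 2 / 4 := by
          rw [hT1]; push_cast; field_simp; norm_num
        have h3 : (2 * T ^ 2 : ℝ) ≤ M := by
          have : R ≤ R ^ 3 := le_self_pow₀ hR1 (by norm_num)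
          have : 2 * T ^ 2 ≤ M := by omega
          exact_mod_cast this
        have h4 : (M : ℝ) * M ≤ M * (8 * T ^ 2 * #H) := by nlinarith
        have h5 := le_of_mul_le_mul_left h4 hMr
        rw [hT1]; exact_mod_cast h5
      have hq : ∀ h ∈ H, ∃ q : ℕ, (1 ≤ q ∧ q ≤ T1 ^ C) ∧
          NearInt (q * ((k + 1) * f.coeff (k + 1) * h)) (T1 ^ C / M ^ k) := by
        intro h hh
        obtain ⟨q, h1, h2, h3⟩ := hC T1 (by nlinarith) M (m - h) hM ((Nat.sub_le _ _).trans hm)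
          (taylor (h : ℝ) f - f) (natDegree_taylor_sub_le hf _) (mem_filter.1 hh).2
        rw [coeff_taylor_sub hf] at h3
        exact ⟨q, ⟨h1, h2⟩, h3⟩
      choose! q hq1 hq2 using hq
      have hHne : H.Nonempty := card_pos.1 (Nat.pos_of_ne_zero fun h0 => by
        rw [h0] at hHcard; omega)
      obtain ⟨q₀, hq₀, hfib⟩ := exists_card_le_mul_card_fiber (t := Icc 1 (T1 ^ C))
        (fun h hh => mem_Icc.2 (hq1 h hh)) hHne
      rw [Nat.card_Icc, Nat.add_sub_cancel] at hfib
      rw [mem_Icc] at hq₀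
      set H' := {h ∈ H | q h = q₀} with hH'
      obtain ⟨r, hr1, hr2, hr3⟩ := exists_nearInt_of_many (H := H') hR1 hbig
        (θ := q₀ * ((k + 1) * f.coeff (k + 1))) (ε := T1 ^ C / M ^ k)
        (fun h hh => by
          have := mem_range.1 (mem_filter.1 (mem_filter.1 hh).1).1
          exact mem_range.2 (by omega))
        (by
          calc M ≤ T1 * #H := hHcard
            _ ≤ T1 * (T1 ^ C * #H') := Nat.mul_le_mul_left _ hfib
            _ = R * #H' := by rw [hR]; ring)
        (by
          obtain ⟨k', rfl⟩ : ∃ k', k = k' + 1 := ⟨k - 1, by omega⟩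
          have hM1 : (1 : ℝ) ≤ (M : ℝ) ^ k' := one_le_pow₀ (by exact_mod_cast hM)
          calc (T1 : ℝ) ^ C / M ^ (k' + 1) * M = T1 ^ C / M ^ k' := by
                rw [pow_succ]; field_simp
            _ ≤ T1 ^ C := div_le_self (by positivity) hM1
            _ ≤ R := by
              rw [hR]; push_cast
              exact pow_le_pow_right₀ (by exact_mod_cast hT1one) (by omega))
        (fun h hh => by
          rw [hH', mem_filter] at hh
          have := hq2 h hh.1
          rw [hh.2] at this
          convert this using 1; ring)
      refine ⟨r * q₀ * (k + 1), by
        have := Nat.mul_pos hr1 hq₀.1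
        exact Nat.mul_pos this (by omega), ?_, ?_⟩
      · calc r * q₀ * (k + 1) ≤ (2 * R) * T1 ^ C * 2 ^ (k + 1) := by
              gcongr
              · exact hq₀.2
              · exact Nat.lt_two_pow_self.le
          _ ≤ (T * T ^ (5 * (C + 1))) * (T ^ 5) ^ C * T ^ (k + 1) := by gcongr
          _ = T ^ (1 + 5 * (C + 1) + 5 * C + (k + 1)) := by ring
          _ ≤ T ^ E := Nat.pow_le_pow_right (by omega) (by omega)
      · have heq : ((r * q₀ * (k + 1) : ℕ) : ℝ) * f.coeff (k + 1) =
            r * (q₀ * ((k + 1) * f.coeff (k + 1))) := by push_cast; ring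
        rw [heq]
        refine hr3.mono ?_
        have h1 : 300 * R ^ 3 * T1 ^ C ≤ T ^ E := by
          calc 300 * R ^ 3 * T1 ^ C ≤ T ^ (9 + 15 * (C + 1)) * (T ^ 5) ^ C := by gcongr
            _ = T ^ (9 + 15 * (C + 1) + 5 * C) := by ring
            _ ≤ T ^ E := Nat.pow_le_pow_right (by omega) (by omega)
        have h2 : (300 * R ^ 3 * T1 ^ C : ℝ) ≤ T ^ E := by exact_mod_cast h1
        calc (300 * R ^ 3 * (T1 ^ C / M ^ k) / M : ℝ) = (300 * R ^ 3 * T1 ^ C) / M ^ (k + 1) := by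
              field_simp; ring
          _ ≤ _ := by gcongr

end MomentCurve

namespace MomentCurve

open Polynomial

lemma norm_sum_range_add_sub_le {F : ℕ → ℂ} (hF : ∀ i, ‖F i‖ ≤ 1) (m c : ℕ) :
    ‖∑ i ∈ range m, F i - ∑ i ∈ range m, F (i + c)‖ ≤ 2 * c := by
  have h1 := sum_range_add F c m
  rw [add_comm c m, sum_range_add F m c] at h1
  have h2 : ∑ i ∈ range m, F i - ∑ i ∈ range m, F (i + c) =
      ∑ i ∈ range c, F i - ∑ i ∈ range c, F (m + i) := by
    simp_rw [add_comm _ c]; linear_combination h1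
  have h3 : ∀ G : ℕ → ℂ, (∀ i, ‖G i‖ ≤ 1) → ‖∑ i ∈ range c, G i‖ ≤ c := fun G hG => by
    simpa using norm_sum_le_of_le (range c) fun i _ => hG i
  rw [h2, two_mul]
  exact (norm_sub_le _ _).trans (add_le_add (h3 _ hF) (h3 _ fun i => hF _))

/-- Averaging a sum over progressions of step `q` and length `L`. -/
lemma norm_averaging_le {F : ℕ → ℂ} (hF : ∀ i, ‖F i‖ ≤ 1) (m L q : ℕ) :
    ‖L * ∑ i ∈ range m, F i - ∑ i ∈ range m, ∑ u ∈ range L, F (i + q * u)‖ ≤ 2 * q * L ^ 2 := by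
  have h1 : (L : ℂ) * ∑ i ∈ range m, F i - ∑ i ∈ range m, ∑ u ∈ range L, F (i + q * u) =
      ∑ u ∈ range L, (∑ i ∈ range m, F i - ∑ i ∈ range m, F (i + q * u)) := by
    rw [sum_sub_distrib, sum_const, card_range, nsmul_eq_mul, sum_comm]
  rw [h1]
  refine (norm_sum_le_of_le _ fun u hu => (norm_sum_range_add_sub_le hF m (q * u)).trans
    (?_ : _ ≤ (2 * q * L : ℝ))).trans ?_
  · have : (u : ℝ) ≤ L := by exact_mod_cast (mem_range.1 hu).le
    push_cast
    rw [mul_assoc]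
    gcongr
  · rw [sum_const, card_range, nsmul_eq_mul]; exact le_of_eq (by ring)

lemma exists_long_sum {F : ℕ → ℂ} (hF : ∀ i, ‖F i‖ ≤ 1) {M L q T : ℕ} (hM : 1 ≤ M)
    (hL : 4 * T * q * L ≤ M) (h : (M : ℝ) ≤ T * ‖∑ i ∈ range M, F i‖) :
    ∃ d < M, (L : ℝ) ≤ 2 * T * ‖∑ u ∈ range L, F (d + q * u)‖ := by
  by_contra! hcon
  have h1 := norm_averaging_le hF M L q
  have h2 : ‖(L : ℂ) * ∑ i ∈ range M, F i‖ ≤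
      2 * q * L ^ 2 + ‖∑ i ∈ range M, ∑ u ∈ range L, F (i + q * u)‖ := by
    have := norm_le_norm_add_norm_sub (∑ i ∈ range M, ∑ u ∈ range L, F (i + q * u))
      ((L : ℂ) * ∑ i ∈ range M, F i)
    rw [norm_sub_rev] at this
    linarith
  rw [norm_mul, Complex.norm_natCast] at h2
  have h3 : 2 * T * ‖∑ i ∈ range M, ∑ u ∈ range L, F (i + q * u)‖ < L * M := by
    calc _ ≤ 2 * T * ∑ i ∈ range M, ‖∑ u ∈ range L, F (i + q * u)‖ := by
          gcongr; exact norm_sum_le _ _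
      _ = ∑ i ∈ range M, 2 * T * ‖∑ u ∈ range L, F (i + q * u)‖ := by rw [mul_sum]
      _ < ∑ i ∈ range M, (L : ℝ) := sum_lt_sum_of_nonempty (by simp; omega)
          fun i hi => hcon i (mem_range.1 hi)
      _ = L * M := by simp [mul_comm]
  have h4 : (4 * T * q * L : ℝ) ≤ M := by exact_mod_cast hL
  have hL0 : (0 : ℝ) ≤ L := by positivity
  have hT0 : (0 : ℝ) ≤ T := by positivity
  have h5 : (L : ℝ) * M ≤ L * (T * ‖∑ i ∈ range M, F i‖) := by gcongr
  have h6 : (T : ℝ) * (L * ‖∑ i ∈ range M, F i‖) ≤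
      T * (2 * q * L ^ 2 + ‖∑ i ∈ range M, ∑ u ∈ range L, F (i + q * u)‖) := by gcongr
  have h7 : (L : ℝ) * (4 * T * q * L) ≤ L * M := by gcongr
  nlinarith

lemma nearInt_coeff_of_taylor {h : ℝ[X]} {k q₀ q d M : ℕ} (hM : 1 ≤ M) (hd : d ≤ M) (hq : 1 ≤ q)
    (hh : h.natDegree ≤ k) {ε : ℝ} (hε : 0 ≤ ε)
    (hg : ∀ j, 1 ≤ j → j ≤ k → NearInt (q₀ * ((taylor (d : ℝ) h).coeff j * q ^ j)) (ε / M ^ j))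
    (j : ℕ) (hj : 1 ≤ j) :
    NearInt ((q ^ k * q₀ : ℕ) * h.coeff j) ((k + 1) * (q ^ k * 2 ^ k * ε / M ^ j)) := by
  set p := taylor (d : ℝ) h with hp
  have hpd : p.natDegree ≤ k := by rwa [hp, natDegree_taylor]
  have hhp : h = taylor (-(d : ℝ)) p := by rw [hp, taylor_taylor]; simp
  have hMr : (1 : ℝ) ≤ M := by exact_mod_cast hM
  have hqr : (1 : ℝ) ≤ q := by exact_mod_cast hq
  have h1 : ((q ^ k * q₀ : ℕ) : ℝ) * h.coeff j =
      ∑ i ∈ range (k + 1), (q ^ k * q₀ : ℕ) *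
        ((((i + j).choose j : ℕ) : ℝ) * p.coeff (i + j) * (-(d : ℝ)) ^ i) := by
    rw [← mul_sum]
    congr 1
    conv_lhs => rw [hhp]
    rw [taylor_coeff, eval_eq_sum_range' (n := k + 1)]
    · simp_rw [hasseDeriv_coeff]
    · have := natDegree_hasseDeriv_le p j
      omega
  have h2 : ((k : ℝ) + 1) * (q ^ k * 2 ^ k * ε / M ^ j) =
      ∑ i ∈ range (k + 1), (q ^ k * 2 ^ k * ε / M ^ j : ℝ) := by simp
  rw [h1, h2]
  refine NearInt.sum _ fun i _ => ?_
  rcases Nat.lt_or_ge k (i + j) with hij | hij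
  · rw [coeff_eq_zero_of_natDegree_lt (hpd.trans_lt hij)]
    refine ⟨0, ?_⟩
    simp; positivity
  · have h3 := (hg (i + j) (by omega) hij).int_mul
      ((q : ℤ) ^ (k - (i + j)) * ((i + j).choose j : ℤ) * (-(d : ℤ)) ^ i)
    have h4 : (((q : ℤ) ^ (k - (i + j)) * ((i + j).choose j : ℤ) * (-(d : ℤ)) ^ i : ℤ) : ℝ) *
        (q₀ * (p.coeff (i + j) * q ^ (i + j))) = (q ^ k * q₀ : ℕ) *
        ((((i + j).choose j : ℕ) : ℝ) * p.coeff (i + j) * (-(d : ℝ)) ^ i) := by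
      rw [show (q : ℕ) ^ k = q ^ (k - (i + j)) * q ^ (i + j) by rw [← pow_add]; congr 1; omega]
      push_cast; ring
    rw [h4] at h3
    refine h3.mono ?_
    have h5 : |(((q : ℤ) ^ (k - (i + j)) * ((i + j).choose j : ℤ) * (-(d : ℤ)) ^ i : ℤ) : ℝ)| ≤
        q ^ k * 2 ^ k * M ^ i := by
      push_cast
      rw [abs_mul, abs_mul, abs_pow, abs_pow, abs_neg, Nat.abs_cast, Nat.abs_cast, Nat.abs_cast]
      have : ((i + j).choose j : ℝ) ≤ 2 ^ k := by
        have := (Nat.choose_le_two_pow (i + j) j).trans (Nat.pow_le_pow_right (by norm_num) hij)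
        exact_mod_cast this
      gcongr
      omega
    calc _ ≤ q ^ k * 2 ^ k * M ^ i * (ε / M ^ (i + j)) := by gcongr
      _ = q ^ k * 2 ^ k * ε / M ^ j := by rw [pow_add]; field_simp

/-- Removing the top monomial along a progression on which it is almost constant modulo one. -/
lemma norm_sum_sub_monomial_le {k q d M L : ℕ} {f : ℝ[X]} (hd : d ≤ M) (hL : q * L ≤ M) {κ : ℝ}
    {b : ℤ} (hκ : q * f.coeff (k + 1) = b + κ) :
    ‖∑ u ∈ range L, e (f.eval ((d + q * u : ℕ) : ℝ))‖ ≤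
      ‖∑ u ∈ range L, e ((taylor (d : ℝ) (f - C (f.coeff (k + 1)) * X ^ (k + 1))).eval
        ((q * u : ℕ) : ℝ))‖ + L * (7 * (|κ| * (L * ((k + 1) * (2 * M) ^ k)))) := by
  set α := f.coeff (k + 1)
  set h := f - C α * X ^ (k + 1) with hh
  set W : ℕ → ℕ := fun u => u * ∑ i ∈ range (k + 1), (d + q * u) ^ i * d ^ (k - i) with hW
  have hWeq : ∀ u, ((d + q * u : ℕ) : ℝ) ^ (k + 1) - d ^ (k + 1) = q * W u := by
    intro u
    have := geom_sum₂_mul ((d + q * u : ℕ) : ℝ) (d : ℝ) (k + 1)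
    rw [← this, hW]
    push_cast
    ring
  have hWle : ∀ u < L, (W u : ℝ) ≤ L * ((k + 1) * (2 * M) ^ k) := by
    intro u hu
    have h1 : ∑ i ∈ range (k + 1), (d + q * u) ^ i * d ^ (k - i) ≤ (k + 1) * (2 * M) ^ k := by
      refine (sum_le_card_nsmul _ _ ((2 * M) ^ k) fun i hi => ?_).trans (by simp)
      have h2 : d + q * u ≤ 2 * M := by
        have := Nat.mul_le_mul_left q hu.le
        omega
      calc (d + q * u) ^ i * d ^ (k - i) ≤ (2 * M) ^ i * (2 * M) ^ (k - i) := by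
            gcongr; omega
        _ = (2 * M) ^ k := by
            rw [← pow_add]; congr 1; have := mem_range.1 hi; omega
    have h3 : W u ≤ L * ((k + 1) * (2 * M) ^ k) := by
      rw [hW]; exact Nat.mul_le_mul hu.le h1
    exact_mod_cast h3
  have hfe : ∀ u ∈ range L, ‖e (f.eval ((d + q * u : ℕ) : ℝ)) -
      e (α * d ^ (k + 1) + (taylor (d : ℝ) h).eval ((q * u : ℕ) : ℝ))‖ ≤
      7 * (|κ| * (L * ((k + 1) * (2 * M) ^ k))) := by
    intro u hu
    refine (norm_e_sub_e_le_of_int _ _ (b * W u)).trans ?_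
    have h1 : f.eval ((d + q * u : ℕ) : ℝ) -
        (α * d ^ (k + 1) + (taylor (d : ℝ) h).eval ((q * u : ℕ) : ℝ)) - ((b * W u : ℤ) : ℝ) =
        κ * W u := by
      have h2 := hWeq u
      rw [taylor_eval, hh, eval_sub, eval_mul, eval_C, eval_pow, eval_X]
      push_cast at h2 ⊢
      rw [add_comm ((q : ℝ) * u)]
      linear_combination α * h2 + (W u : ℝ) * hκ
    rw [h1, abs_mul, Nat.abs_cast]
    have := hWle u (mem_range.1 hu)
    gcongr
  have h1 : ∑ u ∈ range L, e (f.eval ((d + q * u : ℕ) : ℝ)) =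
      e (α * d ^ (k + 1)) * ∑ u ∈ range L, e ((taylor (d : ℝ) h).eval ((q * u : ℕ) : ℝ)) +
      ∑ u ∈ range L, (e (f.eval ((d + q * u : ℕ) : ℝ)) -
        e (α * d ^ (k + 1) + (taylor (d : ℝ) h).eval ((q * u : ℕ) : ℝ))) := by
    rw [sum_sub_distrib]
    simp_rw [e_add, ← mul_sum]
    ring
  rw [h1]
  refine (norm_add_le _ _).trans ?_
  rw [norm_mul, norm_e, one_mul]
  gcongr
  refine (norm_sum_le_of_le _ hfe).trans ?_
  simp

/-- Weyl's inequality in inverse form: a large exponential sum has all its coefficients close to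
rationals with a common small denominator. -/
lemma weyl (k : ℕ) : ∃ C : ℕ, ∀ T : ℕ, 2 ≤ T → ∀ M : ℕ, 1 ≤ M →
    ∀ f : ℝ[X], f.natDegree ≤ k → (M : ℝ) ≤ T * ‖∑ i ∈ range M, e (f.eval (i : ℝ))‖ →
    ∃ q : ℕ, 1 ≤ q ∧ q ≤ T ^ C ∧ ∀ j, 1 ≤ j → j ≤ k → NearInt (q * f.coeff j) (T ^ C / M ^ j) := by
  induction k with
  | zero => exact ⟨0, fun T hT M hM f hf h => ⟨1, le_rfl, by simp, fun j h1 h2 => by omega⟩⟩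
  | succ k ih =>
    obtain ⟨C₁, hC₁⟩ := weyl_leading (k := k + 1) (by omega)
    obtain ⟨C₂, hC₂⟩ := ih
    set E₁ := C₁ + 2 * k + 7 with hE₁
    set E := 3 * C₂ + (E₁ + 1) * (k + 1) + C₁ * (k + 2) + 2 * k + 5 with hE
    refine ⟨E, fun T hT M hM f hf h => ?_⟩
    have hMr : (1 : ℝ) ≤ M := by exact_mod_cast hM
    have hTr : (2 : ℝ) ≤ T := by exact_mod_cast hT
    have hT1 : (1 : ℝ) ≤ T := by linarith
    have hTpow : ∀ n : ℕ, (2 : ℝ) ^ n ≤ (T : ℝ) ^ n := fun n => by gcongr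
    have hk1 : (k : ℝ) + 1 ≤ T ^ k := by
      refine le_trans ?_ (hTpow k)
      have : k + 1 ≤ 2 ^ k := Nat.lt_two_pow_self
      exact_mod_cast this
    rcases Nat.lt_or_ge M (T ^ E₁) with hsmall | hbig
    · refine ⟨1, le_rfl, Nat.one_le_pow _ _ (by omega), fun j hj hjk =>
        (nearInt_half _).mono ?_⟩
      rw [le_div_iff₀ (by positivity)]
      have h1 : (M : ℝ) ^ j ≤ T ^ E := by
        have h2 : (M : ℝ) ≤ T ^ E₁ := by exact_mod_cast hsmall.le
        calc (M : ℝ) ^ j ≤ (T ^ E₁) ^ j := by gcongr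
          _ = T ^ (E₁ * j) := by rw [pow_mul]
          _ ≤ T ^ E := by
            refine pow_le_pow_right₀ hT1 ?_
            have := Nat.mul_le_mul (Nat.le_succ E₁) hjk
            rw [Nat.succ_eq_add_one] at this
            omega
      have h3 : (0 : ℝ) ≤ (M : ℝ) ^ j := by positivity
      linarith
    obtain ⟨q₁, hq1, hq1T, b, hb⟩ := hC₁ T hT M M hM le_rfl f hf h
    set L := M / T ^ E₁ with hL
    have hTE : 0 < T ^ E₁ := by positivity
    have hL1 : 1 ≤ L := (Nat.one_le_div_iff hTE).2 hbig
    have hLM : T ^ E₁ * L ≤ M := Nat.mul_div_le _ _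
    have hML : M ≤ T ^ (E₁ + 1) * L := by
      have h1 : M < T ^ E₁ * (L + 1) := Nat.lt_mul_div_succ M hTE
      calc M ≤ T ^ E₁ * (L + 1) := h1.le
        _ ≤ T ^ E₁ * (2 * L) := Nat.mul_le_mul_left _ (by omega)
        _ ≤ T ^ E₁ * (T * L) := by gcongr
        _ = T ^ (E₁ + 1) * L := by ring
    have hLr : (1 : ℝ) ≤ L := by exact_mod_cast hL1
    have hLMr : (T : ℝ) ^ E₁ * L ≤ M := by exact_mod_cast hLM
    have hMLr : (M : ℝ) ≤ T ^ (E₁ + 1) * L := by exact_mod_cast hML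
    have hqL : 4 * T * q₁ * L ≤ M := by
      calc 4 * T * q₁ * L ≤ 2 ^ 2 * T * T ^ C₁ * L := by gcongr; norm_num
        _ ≤ T ^ 2 * T * T ^ C₁ * L := by gcongr
        _ = T ^ (C₁ + 3) * L := by ring
        _ ≤ T ^ E₁ * L := by gcongr <;> omega
        _ ≤ M := hLM
    obtain ⟨d, hd, hdL⟩ := exists_long_sum (F := fun i => e (f.eval (i : ℝ))) (by simp) hM hqL h
    have hqL2 : q₁ * L ≤ M := by
      refine le_trans ?_ hqL
      rw [mul_assoc (4 * T)]
      exact Nat.le_mul_of_pos_left _ (by omega)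
    set p := f - C (f.coeff (k + 1)) * X ^ (k + 1) with hp
    have hbig2 := norm_sum_sub_monomial_le (k := k) hd.le hqL2
      (show (q₁ : ℝ) * f.coeff (k + 1) = b + (q₁ * f.coeff (k + 1) - b) by ring)
    rw [← hp] at hbig2
    set g := (taylor (d : ℝ) p).comp (C (q₁ : ℝ) * X) with hg
    have hge : ∀ u : ℕ, (taylor (d : ℝ) p).eval ((q₁ * u : ℕ) : ℝ) = g.eval (u : ℝ) := by
      intro u; rw [hg, eval_comp]; simp
    simp_rw [hge] at hbig2
    have herr : 28 * T * (|q₁ * f.coeff (k + 1) - b| * (L * ((k + 1) * (2 * M) ^ k))) ≤ 1 := by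
      calc 28 * T * (|q₁ * f.coeff (k + 1) - b| * (L * ((k + 1) * (2 * M) ^ k)))
          ≤ T ^ 5 * T * (T ^ C₁ / M ^ (k + 1) * (L * (T ^ k * (T * M) ^ k))) := by
            gcongr
            exact le_trans (by norm_num) (hTpow 5)
        _ = T ^ (C₁ + 2 * k + 6) * L / M := by field_simp; ring
        _ ≤ T ^ E₁ * L / M := by
            gcongr
            omega
        _ ≤ 1 := by rw [div_le_one (by positivity)]; exact hLMr
    set S := ‖∑ u ∈ range L, e (g.eval (u : ℝ))‖ with hS
    have hT3 : (L : ℝ) ≤ (T ^ 3 : ℕ) * S := by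
      have h1 : (L : ℝ) ≤ 2 * T * (S + L * (7 * (|q₁ * f.coeff (k + 1) - b| *
          (L * ((k + 1) * (2 * M) ^ k))))) := hdL.trans (by gcongr)
      have h2 : L * (28 * T * (|q₁ * f.coeff (k + 1) - b| * (L * ((k + 1) * (2 * M) ^ k)))) ≤
          (L : ℝ) * 1 := by gcongr
      have h3 : (L : ℝ) ≤ 2 ^ 2 * T * S := by linarith
      refine h3.trans ?_
      push_cast
      calc (2 : ℝ) ^ 2 * T * S ≤ T ^ 2 * T * S := by gcongr
        _ = T ^ 3 * S := by ring
    have hpd : p.natDegree ≤ k := by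
      rw [natDegree_le_iff_coeff_eq_zero]
      intro n hn
      rw [hp, coeff_sub, coeff_C_mul, coeff_X_pow]
      rcases eq_or_ne n (k + 1) with rfl | hne
      · simp
      · rw [if_neg hne, coeff_eq_zero_of_natDegree_lt (by omega)]; simp
    have hpc : ∀ j ≤ k, p.coeff j = f.coeff j := by
      intro j hj
      rw [hp, coeff_sub, coeff_C_mul, coeff_X_pow, if_neg (by omega)]; simp
    have hgd : g.natDegree ≤ k := by
      rw [hg]
      refine natDegree_comp_le.trans ?_
      rw [natDegree_taylor]
      calc p.natDegree * (C (q₁ : ℝ) * X).natDegree ≤ p.natDegree * 1 :=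
            Nat.mul_le_mul_left _ ((natDegree_C_mul_le _ _).trans natDegree_X_le)
        _ ≤ k := by omega
    obtain ⟨q₂, hq2, hq2T, hq2n⟩ := hC₂ (T ^ 3) (hT.trans (Nat.le_self_pow (by norm_num) T)) L hL1
      g hgd hT3
    set ε : ℝ := T ^ (3 * C₂ + (E₁ + 1) * k) with hε
    have hrec := nearInt_coeff_of_taylor (q₀ := q₂) (ε := ε) hM hd.le hq1 hpd (by positivity)
      (fun j hj hjk => by
        have h1 := hq2n j hj hjk
        rw [hg, comp_C_mul_X_coeff] at h1
        refine h1.mono ?_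
        rw [div_le_div_iff₀ (by positivity) (by positivity)]
        push_cast
        calc ((T : ℝ) ^ 3) ^ C₂ * (M : ℝ) ^ j ≤
              ((T : ℝ) ^ 3) ^ C₂ * ((T : ℝ) ^ (E₁ + 1) * (L : ℝ)) ^ j := by gcongr
          _ = (T : ℝ) ^ (3 * C₂ + (E₁ + 1) * j) * (L : ℝ) ^ j := by ring
          _ ≤ ε * L ^ j := by
            rw [hε]
            gcongr)
    have hq1r : (q₁ : ℝ) ≤ T ^ C₁ := by exact_mod_cast hq1T
    have hq2r : (q₂ : ℝ) ≤ T ^ (3 * C₂) := by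
      rw [pow_mul]; exact_mod_cast hq2T
    refine ⟨q₁ ^ (k + 1) * q₂, Nat.mul_pos (by positivity) hq2, ?_, fun j hj hjk => ?_⟩
    · calc q₁ ^ (k + 1) * q₂ ≤ (T ^ C₁) ^ (k + 1) * (T ^ 3) ^ C₂ := by gcongr
        _ = T ^ (C₁ * (k + 1) + 3 * C₂) := by ring
        _ ≤ T ^ E := by
          refine Nat.pow_le_pow_right (by omega) ?_
          have := Nat.mul_le_mul_left C₁ (show k + 1 ≤ k + 2 by omega)
          omega
    · rcases Nat.lt_or_ge k j with hkj | hkj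
      · obtain rfl : j = k + 1 := by omega
        have h1 : NearInt (q₁ * f.coeff (k + 1)) (T ^ C₁ / M ^ (k + 1)) := ⟨b, hb⟩
        have h2 := h1.nat_mul (q₁ ^ k * q₂)
        have h3 : ((q₁ ^ k * q₂ : ℕ) : ℝ) * (q₁ * f.coeff (k + 1)) =
            (q₁ ^ (k + 1) * q₂ : ℕ) * f.coeff (k + 1) := by push_cast; ring
        rw [h3] at h2
        refine h2.mono ?_
        push_cast
        calc (q₁ : ℝ) ^ k * q₂ * (T ^ C₁ / M ^ (k + 1)) ≤
              (T ^ C₁) ^ k * T ^ (3 * C₂) * (T ^ C₁ / M ^ (k + 1)) := by gcongr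
          _ = T ^ (C₁ * (k + 1) + 3 * C₂) / M ^ (k + 1) := by ring
          _ ≤ T ^ E / M ^ (k + 1) := by
            gcongr
            have := Nat.mul_le_mul_left C₁ (show k + 1 ≤ k + 2 by omega)
            omega
      · have h1 := (hrec j hj).nat_mul q₁
        rw [hpc j hkj] at h1
        have h3 : (q₁ : ℝ) * ((q₁ ^ k * q₂ : ℕ) * f.coeff j) =
            (q₁ ^ (k + 1) * q₂ : ℕ) * f.coeff j := by push_cast; ring
        rw [h3] at h1
        refine h1.mono ?_
        calc (q₁ : ℝ) * ((k + 1) * (q₁ ^ k * 2 ^ k * ε / M ^ j)) ≤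
              T ^ C₁ * (T ^ k * ((T ^ C₁) ^ k * T ^ k * ε / M ^ j)) := by gcongr
          _ = T ^ (C₁ * (k + 1) + 2 * k + (3 * C₂ + (E₁ + 1) * k)) / M ^ j := by
            rw [hε]; ring
          _ ≤ T ^ E / M ^ j := by
            gcongr
            have := Nat.mul_le_mul_left C₁ (show k + 1 ≤ k + 2 by omega)
            have := Nat.mul_le_mul_left (E₁ + 1) (show k ≤ k + 1 by omega)
            omega

end MomentCurve

namespace MomentCurve

open Polynomial

/-- Close to a rational with denominator `q`, an exponential sum is controlled by the
corresponding complete sum. -/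
lemma norm_sum_le_gaussSum {k q M : ℕ} (hq : 1 ≤ q) (hqM : q ≤ M) {f : ℝ[X]} {F : ℤ[X]}
    (hf : f.natDegree ≤ k) (hF : F.natDegree ≤ k) {ε : ℝ} (hF0 : F.coeff 0 = 0)
    (h : ∀ j, 1 ≤ j → j ≤ k → |q * f.coeff j - F.coeff j| ≤ ε / M ^ j) :
    q * ‖∑ i ∈ range M, e (f.eval (i : ℝ))‖ ≤
      2 * q ^ 2 + M * (‖gaussSum F q‖ + 7 * (q * ((k + 1) * (k * 2 ^ k * ε / M)))) := by
  have hM1 : 1 ≤ M := hq.trans hqM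
  have hqr : (1 : ℝ) ≤ q := by exact_mod_cast hq
  have hMr : (1 : ℝ) ≤ M := by exact_mod_cast hM1
  have hqM2 : (q : ℝ) ≤ M := by exact_mod_cast hqM
  set κ : ℕ → ℝ := fun j => if j = 0 then 0 else f.coeff j - F.coeff j / q with hκ
  set K : ℝ → ℝ := fun x => ∑ j ∈ range (k + 1), κ j * x ^ j with hK
  have hfK : ∀ n : ℕ, f.eval (n : ℝ) = f.coeff 0 + ((F.eval (n : ℤ) : ℤ) : ℝ) / q + K n := by
    intro n
    rw [eval_eq_sum_range' (n := k + 1) (by omega), eval_eq_sum_range' (n := k + 1) (by omega), hK]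
    dsimp only
    rw [sum_range_succ', sum_range_succ', sum_range_succ']
    simp only [hκ, Nat.succ_ne_zero, if_false, if_true, hF0]
    push_cast
    simp_rw [sub_mul, sum_sub_distrib, add_div, sum_div]
    have : ∀ j : ℕ, (F.coeff (j + 1) : ℝ) * (n : ℝ) ^ (j + 1) / q =
        F.coeff (j + 1) / q * (n : ℝ) ^ (j + 1) := fun j => by ring
    simp_rw [this]
    ring
  have hκle : ∀ j, 1 ≤ j → j ≤ k → |κ j| ≤ ε / M ^ j / q := by
    intro j hj hjk
    have h1 : κ j = (q * f.coeff j - F.coeff j) / q := by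
      simp only [hκ, if_neg (show j ≠ 0 by omega)]
      field_simp
    rw [h1, abs_div, Nat.abs_cast]
    gcongr
    exact h j hj hjk
  have hKle : ∀ i < M, ∀ u < q, |K ((i + u : ℕ) : ℝ) - K i| ≤ (k + 1) * (k * 2 ^ k * ε / M) := by
    intro i hi u hu
    rw [hK]; dsimp only
    rw [← sum_sub_distrib]
    refine (abs_sum_le_sum_abs _ _).trans ((sum_le_card_nsmul _ _ (k * 2 ^ k * ε / M) ?_).trans
      (by simp))
    intro j hj
    have hjk : j ≤ k := by have := mem_range.1 hj; omega
    rcases Nat.eq_zero_or_pos k with rfl | hk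
    · obtain rfl : j = 0 := by omega
      simp
    have hε : 0 ≤ ε := by
      have h1 := (abs_nonneg _).trans (h 1 le_rfl hk)
      have h2 := mul_nonneg h1 (show (0 : ℝ) ≤ M ^ 1 by positivity)
      rwa [div_mul_cancel₀ _ (by positivity)] at h2
    rcases Nat.eq_zero_or_pos j with rfl | hj0
    · simp; positivity
    rw [← mul_sub, abs_mul]
    have h1 := abs_pow_sub_pow_le ((i + u : ℕ) : ℝ) (i : ℝ) j
    have hir : (i : ℝ) ≤ M := by exact_mod_cast hi.le
    have hur : (u : ℝ) ≤ q := by exact_mod_cast hu.le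
    have h2 : |((i + u : ℕ) : ℝ) ^ j - (i : ℝ) ^ j| ≤ q * k * (2 * M) ^ (j - 1) := by
      refine h1.trans ?_
      have h3 : |((i + u : ℕ) : ℝ) - i| = u := by push_cast; simp
      rw [h3]
      have hjr : (j : ℝ) ≤ k := by exact_mod_cast hjk
      have h4 : max |((i + u : ℕ) : ℝ)| |(i : ℝ)| ≤ 2 * M := by
        rw [Nat.abs_cast, Nat.abs_cast, max_le_iff]
        push_cast
        constructor <;> linarith
      gcongr
    obtain ⟨j', rfl⟩ : ∃ j', j = j' + 1 := ⟨j - 1, by omega⟩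
    rw [Nat.add_sub_cancel] at h2
    calc |κ (j' + 1)| * |((i + u : ℕ) : ℝ) ^ (j' + 1) - (i : ℝ) ^ (j' + 1)|
        ≤ ε / M ^ (j' + 1) / q * (q * k * (2 * M) ^ j') := by
          gcongr
          exact hκle _ hj0 hjk
      _ = k * 2 ^ j' * ε / M := by rw [mul_pow]; field_simp; ring
      _ ≤ k * 2 ^ k * ε / M := by
          gcongr
          · norm_num
          · omega
  have hmain : ∀ i ∈ range M, ‖∑ u ∈ range q, e (f.eval ((i + 1 * u : ℕ) : ℝ))‖ ≤
      ‖gaussSum F q‖ + 7 * (q * ((k + 1) * (k * 2 ^ k * ε / M))) := by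
    intro i hi
    have h1 : ∑ u ∈ range q, e (((F.eval ((i + u : ℕ) : ℤ) : ℤ) : ℝ) / q) = gaussSum F q := by
      have := sum_range_add_of_periodic (ψ := fun x : ℤ => e (((F.eval x : ℤ) : ℝ) / q))
        (e_eval_periodic F (by omega : q ≠ 0)) i
      rw [gaussSum, ← this]
      refine sum_congr rfl fun u _ => ?_
      push_cast
      simp only [add_comm]
    have h2 : ∑ u ∈ range q, e (f.eval ((i + 1 * u : ℕ) : ℝ)) =
        e (f.coeff 0 + K i) * gaussSum F q + ∑ u ∈ range q,
          (e (f.eval ((i + 1 * u : ℕ) : ℝ)) -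
            e (f.coeff 0 + ((F.eval ((i + u : ℕ) : ℤ) : ℤ) : ℝ) / q + K i)) := by
      rw [sum_sub_distrib, ← h1, mul_sum]
      have : ∀ u, e (f.coeff 0 + ((F.eval ((i + u : ℕ) : ℤ) : ℤ) : ℝ) / q + K i) =
          e (f.coeff 0 + K i) * e (((F.eval ((i + u : ℕ) : ℤ) : ℤ) : ℝ) / q) := fun u => by
        rw [← e_add]; congr 1; ring
      simp_rw [this]
      ring
    rw [h2]
    refine (norm_add_le _ _).trans ?_
    rw [norm_mul, norm_e, one_mul]
    gcongr
    refine (norm_sum_le_of_le _ fun u hu => (norm_e_sub_e_le _ _).trans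
      (?_ : _ ≤ 7 * ((k + 1) * (k * 2 ^ k * ε / M)))).trans ?_
    · rw [one_mul, hfK]
      have := hKle i (mem_range.1 hi) u (mem_range.1 hu)
      rw [add_sub_add_left_eq_sub]
      gcongr
    · rw [sum_const, card_range, nsmul_eq_mul]; exact le_of_eq (by ring)
  have h1 := norm_averaging_le (F := fun i => e (f.eval (i : ℝ))) (by simp) M q 1
  have h2 : ‖(q : ℂ) * ∑ i ∈ range M, e (f.eval (i : ℝ))‖ ≤
      2 * q ^ 2 + ‖∑ i ∈ range M, ∑ u ∈ range q, e (f.eval ((i + 1 * u : ℕ) : ℝ))‖ := by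
    have := norm_le_norm_add_norm_sub
      (∑ i ∈ range M, ∑ u ∈ range q, e (f.eval ((i + 1 * u : ℕ) : ℝ)))
      ((q : ℂ) * ∑ i ∈ range M, e (f.eval (i : ℝ)))
    rw [norm_sub_rev] at this
    push_cast at h1 this ⊢
    linarith
  rw [norm_mul, Complex.norm_natCast] at h2
  refine h2.trans (add_le_add le_rfl ?_)
  refine (norm_sum_le_of_le _ hmain).trans ?_
  rw [sum_const, card_range, nsmul_eq_mul]

/-- A large exponential sum comes from a rational approximation with small denominator `q`, and its
size is controlled in terms of `q`. -/
lemma weyl_major {k : ℕ} (hk : 1 ≤ k) : ∃ C : ℕ, ∀ T : ℕ, 2 ≤ T → ∀ M : ℕ, T ^ C ≤ M →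
    ∀ f : ℝ[X], f.natDegree ≤ k → (M : ℝ) ≤ T * ‖∑ i ∈ range M, e (f.eval (i : ℝ))‖ →
    ∃ q : ℕ, 1 ≤ q ∧ q ≤ T ^ C ∧ (∀ j, 1 ≤ j → j ≤ k → NearInt (q * f.coeff j) (T ^ C / M ^ j)) ∧
      ‖∑ i ∈ range M, e (f.eval (i : ℝ))‖ ^ k * q ≤
        (2 * M) ^ k * (((k * huaConst k) ^ k : ℕ) : ℝ) ^ #q.primeFactors := by
  classical
  obtain ⟨C₀, hC₀⟩ := weyl k
  refine ⟨C₀ + 3 * k + 7, fun T hT M hM f hf h => ?_⟩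
  set E := C₀ + 3 * k + 7 with hE
  have hTr : (2 : ℝ) ≤ T := by exact_mod_cast hT
  have hTpow : ∀ n : ℕ, (2 : ℝ) ^ n ≤ (T : ℝ) ^ n := fun n => by gcongr
  have hT1 : (1 : ℝ) ≤ T := by linarith
  have hM1 : 1 ≤ M := le_trans (Nat.one_le_pow _ _ (by omega)) hM
  have hMr : (1 : ℝ) ≤ M := by exact_mod_cast hM1
  have hMTr : (T : ℝ) ^ E ≤ M := by exact_mod_cast hM
  have hex : ∃ q : ℕ, 1 ≤ q ∧ ∀ j, 1 ≤ j → j ≤ k → NearInt (q * f.coeff j) (T ^ C₀ / M ^ j) :=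
    let ⟨q, h1, _, h3⟩ := hC₀ T hT M hM1 f hf h; ⟨q, h1, h3⟩
  set q := Nat.find hex with hqdef
  obtain ⟨hq1, hqn⟩ := Nat.find_spec hex
  rw [← hqdef] at hq1 hqn
  have hqT : q ≤ T ^ C₀ := by
    obtain ⟨q', h1, h2, h3⟩ := hC₀ T hT M hM1 f hf h
    exact (Nat.find_min' hex ⟨h1, h3⟩).trans h2
  have hCE : T ^ C₀ ≤ T ^ E := Nat.pow_le_pow_right (by omega) (by omega)
  have hCEr : (T : ℝ) ^ C₀ ≤ T ^ E := by exact_mod_cast hCE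
  choose! a ha using hqn
  set F : ℤ[X] := ∑ j ∈ Icc 1 k, C (a j) * X ^ j with hF
  have hFc : ∀ i, F.coeff i = if 1 ≤ i ∧ i ≤ k then a i else 0 := by
    intro i
    rw [hF, finsetSum_coeff]
    simp only [coeff_C_mul, coeff_X_pow, mul_ite, mul_one, mul_zero]
    rw [sum_ite_eq]
    simp
  have hFd : F.natDegree ≤ k := by
    rw [natDegree_le_iff_coeff_eq_zero]
    intro n hn
    rw [hFc, if_neg (by omega)]
  have hnc : ∀ p, p.Prime → p ∣ q → NonconstMod p F := by
    intro p hp hpq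
    by_contra hcon
    simp only [NonconstMod] at hcon
    push Not at hcon
    obtain ⟨q', hq'⟩ := hpq
    have hq'1 : 1 ≤ q' := Nat.pos_of_ne_zero fun h0 => by rw [h0] at hq'; omega
    have hlt : q' < q := by rw [hq']; have := hp.two_le; nlinarith
    refine Nat.find_min hex hlt ⟨hq'1, fun j hj hjk => ?_⟩
    obtain ⟨b, hb⟩ := hcon j hj
    rw [hFc, if_pos ⟨hj, hjk⟩] at hb
    refine ⟨b, ?_⟩
    have h1 := ha j hj hjk
    have hpr : (1 : ℝ) ≤ p := by exact_mod_cast hp.one_lt.le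
    have h2 : (q : ℝ) * f.coeff j - a j = p * (q' * f.coeff j - b) := by
      rw [hq', hb]; push_cast; ring
    rw [h2, abs_mul, Nat.abs_cast] at h1
    exact (le_mul_of_one_le_left (abs_nonneg _) hpr).trans h1
  have hcomp := norm_sum_le_gaussSum hq1 ((hqT.trans hCE).trans hM) hf hFd
    (by rw [hFc, if_neg (by omega)])
    (fun j hj hjk => by rw [hFc, if_pos ⟨hj, hjk⟩]; exact ha j hj hjk)
  have hgauss := gaussSum_le hk q (by omega) F hFd hnc
  set S := ‖∑ i ∈ range M, e (f.eval (i : ℝ))‖ with hS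
  set G := ‖gaussSum F q‖ with hG
  have hqr : (1 : ℝ) ≤ q := by exact_mod_cast hq1
  have hqTr : (q : ℝ) ≤ T ^ C₀ := by exact_mod_cast hqT
  have hk1 : (k : ℝ) + 1 ≤ T ^ k := by
    refine le_trans ?_ (hTpow k)
    have : k + 1 ≤ 2 ^ k := Nat.lt_two_pow_self
    exact_mod_cast this
  have herr1 : 8 * T * (q : ℝ) ≤ M := by
    calc 8 * T * (q : ℝ) ≤ T ^ 3 * T * T ^ C₀ := by
          gcongr
          exact le_trans (by norm_num) (hTpow 3)
      _ = T ^ (C₀ + 4) := by ring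
      _ ≤ T ^ E := pow_le_pow_right₀ hT1 (by omega)
      _ ≤ M := hMTr
  have herr2 : 28 * T * ((k + 1) * (k * 2 ^ k * T ^ C₀)) ≤ (M : ℝ) := by
    calc 28 * T * ((k + 1) * (k * 2 ^ k * T ^ C₀)) ≤
          (T : ℝ) ^ 5 * T * (T ^ k * (T ^ k * T ^ k * T ^ C₀)) := by
          gcongr
          · exact le_trans (by norm_num) (hTpow 5)
          · linarith
      _ = T ^ (C₀ + 3 * k + 6) := by ring
      _ ≤ T ^ E := pow_le_pow_right₀ hT1 (by omega)
      _ ≤ M := hMTr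
  have hSG : q * S ≤ 2 * M * G := by
    have h1 : (M : ℝ) * (7 * (q * ((k + 1) * (k * 2 ^ k * T ^ C₀ / M)))) =
        q * (7 * ((k + 1) * (k * 2 ^ k * T ^ C₀))) := by field_simp
    have h2 : 4 * T * (q * (7 * ((k + 1) * (k * 2 ^ k * T ^ C₀)))) ≤ (q : ℝ) * M := by
      calc _ = (q : ℝ) * (28 * T * ((k + 1) * (k * 2 ^ k * T ^ C₀))) := by ring
        _ ≤ (q : ℝ) * M := by gcongr
    have h3 : 4 * T * (2 * (q : ℝ) ^ 2) ≤ q * M := by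
      calc 4 * T * (2 * (q : ℝ) ^ 2) = q * (8 * T * q) := by ring
        _ ≤ q * M := by gcongr
    have h4 : (q : ℝ) * M ≤ q * (T * S) := by gcongr
    rw [mul_add, h1] at hcomp
    have h5 : 4 * T * (q * S) ≤ 4 * T * (2 * q ^ 2 + (M * G +
      q * (7 * ((k + 1) * (k * 2 ^ k * T ^ C₀))))) := by gcongr
    have h6 : T * (q * S) ≤ T * (2 * M * G) := by linarith
    exact le_of_mul_le_mul_left h6 (by linarith)
  refine ⟨q, hq1, hqT.trans hCE, fun j hj hjk => ?_, ?_⟩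
  · refine NearInt.mono ⟨a j, ha j hj hjk⟩ ?_
    gcongr
  · have h1 : (q : ℝ) ^ k * (S ^ k * q) ≤
        q ^ k * ((2 * M) ^ k * (((k * huaConst k) ^ k : ℕ) : ℝ) ^ #q.primeFactors) := by
      calc (q : ℝ) ^ k * (S ^ k * q) = (q * S) ^ k * q := by ring
        _ ≤ (2 * M * G) ^ k * q := by gcongr
        _ = (2 * M) ^ k * (G ^ k * q) := by ring
        _ ≤ (2 * M) ^ k * (((k * huaConst k : ℕ) : ℝ) ^ #q.primeFactors * q) ^ k := by
            have : (0 : ℝ) ≤ (2 * M) ^ k := by positivity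
            exact mul_le_mul_of_nonneg_left hgauss this
        _ = _ := by
            push_cast; ring
    exact le_of_mul_le_mul_left h1 (by positivity)

end MomentCurve

namespace MomentCurve

/-- The pairing of a frequency with an integer vector. -/
def pairing {k : ℕ} (θ : Fin k → ℝ) (v : Fin k → ℤ) : ℝ := ∑ j, θ j * v j

lemma pairing_add {k : ℕ} (θ : Fin k → ℝ) (v w : Fin k → ℤ) :
    pairing θ (v + w) = pairing θ v + pairing θ w := by
  simp [pairing, mul_add, sum_add_distrib]

lemma pairing_sub {k : ℕ} (θ : Fin k → ℝ) (v w : Fin k → ℤ) :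
    pairing θ (v - w) = pairing θ v - pairing θ w := by
  simp [pairing, mul_sub, sum_sub_distrib]

@[simp] lemma pairing_zero {k : ℕ} (θ : Fin k → ℝ) : pairing θ 0 = 0 := by simp [pairing]

lemma sum_range_e_eq {R : ℕ} (hR : R ≠ 0) (w : ℤ) :
    ∑ a ∈ range R, e ((a : ℝ) / R * w) = if (R : ℤ) ∣ w then (R : ℂ) else 0 := by
  have hRr : (R : ℝ) ≠ 0 := by exact_mod_cast hR
  have h1 : ∀ a ∈ range R, e ((a : ℝ) / R * w) = e (w / R) ^ a := fun a _ => by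
    rw [← e_nat_mul]; congr 1; ring
  rw [sum_congr rfl h1]
  split_ifs with h
  · obtain ⟨b, rfl⟩ := h
    have : e (((R * b : ℤ) : ℝ) / R) = 1 := by
      rw [e_eq_one_iff]; exact ⟨b, by push_cast; field_simp⟩
    rw [this]; simp
  · have hne : e ((w : ℝ) / R) ≠ 1 := by
      rw [Ne, e_eq_one_iff]
      rintro ⟨b, hb⟩
      refine h ⟨b, ?_⟩
      rw [div_eq_iff hRr] at hb
      have : (w : ℝ) = ((R * b : ℤ) : ℝ) := by rw [hb]; push_cast; ring
      exact_mod_cast this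
    rw [geom_sum_eq hne, ← e_nat_mul]
    have : (R : ℝ) * (w / R) = (w : ℝ) := by field_simp
    rw [this, e_int]; simp

lemma sum_piFinset_e_eq {k : ℕ} {R : Fin k → ℕ} (hR : ∀ j, R j ≠ 0) {w : Fin k → ℤ}
    (hw : ∀ j, |w j| < R j) :
    ∑ a ∈ Fintype.piFinset fun j => range (R j), e (pairing (fun j => (a j : ℝ) / R j) w) =
      if w = 0 then ∏ j, (R j : ℂ) else 0 := by
  simp_rw [pairing, e_sum]
  rw [← prod_univ_sum (fun j => range (R j)) fun j (a : ℕ) => e ((a : ℝ) / R j * w j)]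
  simp_rw [fun j => sum_range_e_eq (hR j) (w j)]
  have h1 : ∀ j, ((R j : ℤ) ∣ w j) ↔ w j = 0 := fun j =>
    ⟨fun h => Int.eq_zero_of_abs_lt_dvd h (hw j), fun h => by rw [h]; exact dvd_zero _⟩
  simp_rw [h1]
  split_ifs with h
  · exact prod_congr rfl fun j _ => by simp [h]
  · obtain ⟨j, hj⟩ := Function.ne_iff.1 h
    exact prod_eq_zero (mem_univ j) (if_neg hj)

/-- The autocorrelation of a function supported on a box is a nonnegative combination of
characters. -/
lemma exists_spectral {k : ℕ} (m : Fin k → ℕ) {X : Finset (Fin k → ℤ)}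
    (hX : ∀ x ∈ X, ∀ j, 1 ≤ x j ∧ x j ≤ m j) {f : (Fin k → ℤ) → ℝ} (hf : ∀ x ∉ X, f x = 0) :
    ∃ (s : Finset (Fin k → ℕ)) (θ : (Fin k → ℕ) → Fin k → ℝ) (E : (Fin k → ℕ) → ℝ),
      (∀ a, 0 ≤ E a) ∧ ∀ v : Fin k → ℤ, (∀ j, |v j| ≤ 2 * m j) →
        ((∑ x ∈ X, f x * f (x + v) : ℝ) : ℂ) = ∑ a ∈ s, (E a : ℂ) * e (pairing (θ a) v) := by
  classical
  set R : Fin k → ℕ := fun j => 3 * m j + 1 with hRdef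
  have hR : ∀ j, R j ≠ 0 := fun j => by simp [hRdef]
  have hP : (∏ j, (R j : ℝ)) ≠ 0 := prod_ne_zero_iff.2 fun j _ => by exact_mod_cast hR j
  set θ : (Fin k → ℕ) → Fin k → ℝ := fun a j => (a j : ℝ) / R j with hθ
  set G : (Fin k → ℕ) → ℂ := fun a => ∑ x ∈ X, (f x : ℂ) * e (pairing (θ a) x) with hG
  refine ⟨Fintype.piFinset fun j => range (R j), θ, fun a => ‖G a‖ ^ 2 / ∏ j, (R j : ℝ),
    fun a => by positivity, fun v hv => ?_⟩
  have h1 : ∀ a, ((‖G a‖ ^ 2 / ∏ j, (R j : ℝ) : ℝ) : ℂ) * e (pairing (θ a) v) =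
      ∑ x ∈ X, ∑ y ∈ X, (f x * f y / ∏ j, (R j : ℂ)) * e (pairing (θ a) (x - y + v)) := by
    intro a
    have h2 : ((‖G a‖ ^ 2 : ℝ) : ℂ) = G a * starRingEnd ℂ (G a) := by
      rw [Complex.mul_conj, Complex.normSq_eq_norm_sq]
    rw [Complex.ofReal_div, h2, hG]
    simp only [map_sum, map_mul, Complex.conj_ofReal]
    rw [sum_mul_sum, sum_div, sum_mul]
    refine sum_congr rfl fun x _ => ?_
    rw [sum_div, sum_mul]
    refine sum_congr rfl fun y _ => ?_
    rw [pairing_add, pairing_sub, e_add, e_sub]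
    push_cast
    ring
  simp_rw [h1]
  rw [sum_comm]
  push_cast
  refine sum_congr rfl fun x hx => ?_
  rw [sum_comm]
  have h3 : ∀ y ∈ X, ∑ a ∈ Fintype.piFinset fun j => range (R j),
      (f x * f y / ∏ j, (R j : ℂ)) * e (pairing (θ a) (x - y + v)) =
      if x + v = y then (f x : ℂ) * f y else 0 := by
    intro y hy
    rw [← mul_sum, sum_piFinset_e_eq hR]
    · have h4 : x - y + v = 0 ↔ x + v = y := by
        rw [sub_add_eq_add_sub, sub_eq_zero]
      simp only [h4]
      split_ifs
      · have : (∏ j, (R j : ℂ)) ≠ 0 := by exact_mod_cast hP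
        field_simp
      · simp
    · intro j
      have h5 := hX x hx j
      have h6 := hX y hy j
      have h7 := abs_le.1 (hv j)
      rw [abs_lt]
      simp only [Pi.add_apply, Pi.sub_apply, hRdef]
      push_cast
      constructor <;> omega
  rw [sum_congr rfl h3, sum_ite_eq]
  split_ifs with h
  · rfl
  · rw [hf _ h]; simp

lemma card_piFinset_sdiff_le {k : ℕ} {I J : Fin k → Finset ℤ} {ε : Fin k → ℝ}
    (h : ∀ j, (#(I j \ J j) : ℝ) ≤ ε j * #(I j)) :
    (#(Fintype.piFinset I \ Fintype.piFinset J) : ℝ) ≤ (∑ j, ε j) * #(Fintype.piFinset I) := by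
  classical
  have h1 : Fintype.piFinset I \ Fintype.piFinset J ⊆
      univ.biUnion fun j => Fintype.piFinset (Function.update I j (I j \ J j)) := by
    intro x hx
    rw [mem_sdiff, Fintype.mem_piFinset, Fintype.mem_piFinset] at hx
    obtain ⟨h2, h3⟩ := hx
    push Not at h3
    obtain ⟨j, hj⟩ := h3
    refine mem_biUnion.2 ⟨j, mem_univ j, Fintype.mem_piFinset.2 fun i => ?_⟩
    rcases eq_or_ne i j with rfl | hij
    · rw [Function.update_self]; exact mem_sdiff.2 ⟨h2 i, hj⟩
    · rw [Function.update_of_ne hij]; exact h2 i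
  have h2 : ∀ j, (#(Fintype.piFinset (Function.update I j (I j \ J j))) : ℝ) ≤
      ε j * #(Fintype.piFinset I) := by
    intro j
    rw [Fintype.card_piFinset, Fintype.card_piFinset]
    push_cast
    rw [← mul_prod_erase univ _ (mem_univ j), ← mul_prod_erase univ (fun i => (#(I i) : ℝ)) (mem_univ j),
      Function.update_self, ← mul_assoc]
    have h3 : ∏ i ∈ univ.erase j, (#(Function.update I j (I j \ J j) i) : ℝ) =
        ∏ i ∈ univ.erase j, (#(I i) : ℝ) :=
      prod_congr rfl fun i hi => by rw [Function.update_of_ne (ne_of_mem_erase hi)]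
    rw [h3]
    exact mul_le_mul_of_nonneg_right (h j) (prod_nonneg fun _ _ => by positivity)
  calc _ ≤ ((∑ j, #(Fintype.piFinset (Function.update I j (I j \ J j))) : ℕ) : ℝ) := by
        exact_mod_cast (card_le_card h1).trans card_biUnion_le
    _ ≤ ∑ j, ε j * #(Fintype.piFinset I) := by
        push_cast; exact sum_le_sum fun j _ => h2 j
    _ = _ := by rw [sum_mul]

/-- The box `∏ [1, n ^ (j + 1)]`. -/
noncomputable def box (k n : ℕ) : Finset (Fin k → ℤ) := Fintype.piFinset fun j => Icc 1 ((n : ℤ) ^ (j.1 + 1))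

/-- The moment curve `(d, d ^ 2, …, d ^ k)`. -/
def curve (k : ℕ) (d : ℤ) : Fin k → ℤ := fun j => d ^ (j.1 + 1)

/-- No two points of `B` differ by a nonzero point of the moment curve. -/
def CurveFree {k : ℕ} (B : Finset (Fin k → ℤ)) : Prop :=
  ∀ d : ℤ, d ≠ 0 → ∀ x ∈ B, x + curve k d ∉ B

lemma mem_box {k n : ℕ} {x : Fin k → ℤ} :
    x ∈ box k n ↔ ∀ j, 1 ≤ x j ∧ x j ≤ (n : ℤ) ^ (j.1 + 1) := by
  simp [box, Fintype.mem_piFinset]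

lemma card_box (k n : ℕ) : #(box k n) = ∏ j : Fin k, n ^ (j.1 + 1) := by
  rw [box, Fintype.card_piFinset]
  refine prod_congr rfl fun j _ => ?_
  rw [Int.card_Icc]
  have : ((n : ℤ) ^ (j.1 + 1) + 1 - 1) = ((n ^ (j.1 + 1) : ℕ) : ℤ) := by push_cast; ring
  rw [this, Int.toNat_natCast]

lemma card_box_pos {k n : ℕ} (hn : 1 ≤ n) : 0 < #(box k n) := by
  rw [card_box]; exact prod_pos fun j _ => by positivity

/-- Few points of a box leave it under a small translation. -/
lemma card_box_filter_notMem_le {k n : ℕ} {v : Fin k → ℤ} {ε : ℝ}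
    (hv : ∀ j, (|v j| : ℝ) ≤ ε * (n : ℝ) ^ (j.1 + 1)) :
    (#{x ∈ box k n | x + v ∉ box k n} : ℝ) ≤ k * ε * #(box k n) := by
  set I : Fin k → Finset ℤ := fun j => Icc 1 ((n : ℤ) ^ (j.1 + 1)) with hI
  set J : Fin k → Finset ℤ := fun j => Icc (1 - v j) ((n : ℤ) ^ (j.1 + 1) - v j) with hJ
  have h1 : {x ∈ box k n | x + v ∉ box k n} ⊆ Fintype.piFinset I \ Fintype.piFinset J := by
    intro x hx
    rw [mem_filter] at hx
    refine mem_sdiff.2 ⟨hx.1, fun h => hx.2 ?_⟩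
    rw [mem_box]
    intro j
    have := mem_Icc.1 (Fintype.mem_piFinset.1 h j)
    rw [Pi.add_apply]
    constructor <;> linarith
  have h2 := card_piFinset_sdiff_le (I := I) (J := J) (ε := fun _ => ε) (fun j => by
    have h3 : I j \ J j ⊆ Icc 1 (-v j) ∪ Icc ((n : ℤ) ^ (j.1 + 1) - v j + 1) ((n : ℤ) ^ (j.1 + 1)) := by
      intro t ht
      rw [mem_sdiff, hI, hJ, mem_Icc, mem_Icc] at ht
      rw [mem_union, mem_Icc, mem_Icc]
      omega
    have h4 : #(I j \ J j) ≤ (|v j|).toNat := by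
      refine (card_le_card h3).trans ((card_union_le _ _).trans ?_)
      rw [Int.card_Icc, Int.card_Icc]
      rcases abs_cases (v j) with h | h <;> omega
    have h5 : ((|v j|).toNat : ℝ) = |(v j : ℝ)| := by
      rw [← Int.cast_abs, ← Int.cast_natCast, Int.toNat_of_nonneg (abs_nonneg _)]
    have h6 : (#(I j) : ℝ) = (n : ℝ) ^ (j.1 + 1) := by
      rw [hI, Int.card_Icc, add_sub_cancel_right]
      have : ((n : ℤ) ^ (j.1 + 1)) = ((n ^ (j.1 + 1) : ℕ) : ℤ) := by push_cast; ring
      rw [this, Int.toNat_natCast]; push_cast; rfl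
    rw [h6]
    refine le_trans ?_ (hv j)
    rw [← h5]
    exact_mod_cast h4)
  refine le_trans (by exact_mod_cast card_le_card h1) (h2.trans (le_of_eq ?_))
  simp [box, hI]

end MomentCurve

namespace MomentCurve

open Polynomial

/-- The balanced function of a subset `B` of `X`. -/
noncomputable def balanced {G : Type*} [DecidableEq G] (X B : Finset G) (δ : ℝ) (x : G) : ℝ :=
  (if x ∈ B then 1 else 0) - δ * (if x ∈ X then 1 else 0)

lemma balanced_of_notMem {G : Type*} [DecidableEq G] {X B : Finset G} {δ : ℝ} (hB : B ⊆ X)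
    {x : G} (hx : x ∉ X) : balanced X B δ x = 0 := by
  have h : x ∉ B := fun h => hx (hB h)
  simp [balanced, hx, h]

section balanced

variable {G : Type*} [AddCommGroup G] [DecidableEq G] {X B : Finset G} {δ : ℝ}

lemma sum_balanced_mul_le (hB : B ⊆ X) (hδ : (#B : ℝ) = δ * #X) {v : G} {η : ℝ}
    (hv : ∀ x ∈ B, x + v ∉ B) (h₁ : (#{x ∈ X | x + v ∉ X} : ℝ) ≤ η * #X)
    (h₂ : (#{x ∈ X | x + -v ∉ X} : ℝ) ≤ η * #X) (hδ0 : 0 ≤ δ) :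
    ∑ x ∈ X, balanced X B δ x * balanced X B δ (x + v) ≤ (2 * δ * η - δ ^ 2) * #X := by
  set a := #{x ∈ B | x + v ∈ X} with ha
  set b := #{x ∈ X | x + v ∈ B} with hb
  set c := #{x ∈ X | x + v ∈ X} with hc
  have h3 : ∑ x ∈ X, balanced X B δ x * balanced X B δ (x + v) = -δ * a - δ * b + δ ^ 2 * c := by
    have h4 : ∀ x ∈ X, balanced X B δ x * balanced X B δ (x + v) =
        -δ * (if x ∈ B ∧ x + v ∈ X then 1 else 0) - δ * (if x + v ∈ B then 1 else 0) +
          δ ^ 2 * (if x + v ∈ X then 1 else 0) := by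
      intro x hx
      have := hv x
      simp only [balanced]
      by_cases h5 : x ∈ B <;> by_cases h6 : x + v ∈ B <;> by_cases h7 : x + v ∈ X <;>
        simp_all <;> ring
    rw [sum_congr rfl h4, sum_add_distrib, sum_sub_distrib, ← mul_sum, ← mul_sum, ← mul_sum,
      sum_boole, sum_boole, sum_boole]
    have h5 : {x ∈ X | x ∈ B ∧ x + v ∈ X} = {x ∈ B | x + v ∈ X} := by
      ext x; simp only [mem_filter]
      exact ⟨fun h => h.2, fun h => ⟨hB h.1, h⟩⟩
    rw [h5]
  have h4 : (#B : ℝ) ≤ a + η * #X := by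
    have h5 : #B ≤ a + #{x ∈ X | x + v ∉ X} := by
      rw [← card_filter_add_card_filter_not (s := B) (fun x => x + v ∈ X)]
      exact Nat.add_le_add_left (card_le_card (filter_subset_filter _ hB)) _
    have h6 : (#B : ℝ) ≤ a + #{x ∈ X | x + v ∉ X} := by exact_mod_cast h5
    linarith
  have h5 : (#B : ℝ) ≤ b + η * #X := by
    have h5 : #B ≤ b + #{x ∈ X | x + -v ∉ X} := by
      rw [← card_filter_add_card_filter_not (s := B) (fun x => x + -v ∈ X)]
      refine Nat.add_le_add ?_ (card_le_card (filter_subset_filter _ hB))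
      refine card_le_card_of_injOn (fun x => x + -v) (fun x hx => ?_)
        (fun x _ y _ h => add_right_cancel h)
      have hx' := mem_filter.1 (mem_coe.1 hx)
      exact mem_coe.2 (mem_filter.2 ⟨hx'.2, by simpa using hx'.1⟩)
    have h6 : (#B : ℝ) ≤ b + #{x ∈ X | x + -v ∉ X} := by exact_mod_cast h5
    linarith
  have h6 : (c : ℝ) ≤ #X := by exact_mod_cast card_filter_le _ _
  rw [h3]
  have h7 : δ * #B ≤ δ * (a + η * #X) := by gcongr
  have h8 : δ * #B ≤ δ * (b + η * #X) := by gcongr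
  have h9 : δ ^ 2 * c ≤ δ ^ 2 * #X := by gcongr
  rw [hδ] at h7 h8
  nlinarith

lemma sum_balanced_sq_le (hB : B ⊆ X) (hδ : (#B : ℝ) = δ * #X) :
    ∑ x ∈ X, balanced X B δ x * balanced X B δ (x + 0) ≤ δ * #X := by
  have h4 : ∀ x ∈ X, balanced X B δ x * balanced X B δ (x + 0) =
      (1 - 2 * δ) * (if x ∈ B then 1 else 0) + δ ^ 2 := by
    intro x hx
    rw [add_zero]
    simp only [balanced, hx, if_true]
    split_ifs <;> ring
  rw [sum_congr rfl h4, sum_add_distrib, ← mul_sum, sum_boole, filter_mem_eq_inter,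
    inter_eq_right.2 hB, hδ, sum_const, nsmul_eq_mul]
  have : 0 ≤ δ ^ 2 * #X := by positivity
  nlinarith

end balanced

/-- The phase polynomial of a frequency along the moment curve. -/
noncomputable def phase {k : ℕ} (θ : Fin k → ℝ) : ℝ[X] := ∑ j, C (θ j) * X ^ (j.1 + 1)

lemma eval_phase {k : ℕ} (θ : Fin k → ℝ) (d : ℕ) :
    (phase θ).eval (d : ℝ) = pairing θ (curve k d) := by
  simp [phase, pairing, curve, eval_finsetSum]

lemma natDegree_phase_le {k : ℕ} (θ : Fin k → ℝ) : (phase θ).natDegree ≤ k :=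
  natDegree_sum_le_of_forall_le _ _ fun j _ =>
    (natDegree_C_mul_X_pow_le _ _).trans (by omega)

lemma coeff_phase {k : ℕ} (θ : Fin k → ℝ) (j : Fin k) : (phase θ).coeff (j.1 + 1) = θ j := by
  rw [phase, finsetSum_coeff, sum_eq_single j]
  · simp
  · intro i _ hij
    rw [coeff_C_mul, coeff_X_pow, if_neg (fun h => hij (Fin.ext (by omega))), mul_zero]
  · simp

lemma abs_curve_le {k n M d : ℕ} (hM : M ≤ n) (hn : 1 ≤ n) (hd : d ≤ M) (j : Fin k) :
    |((curve k d j : ℤ) : ℝ)| ≤ (M / n : ℝ) * (n : ℝ) ^ (j.1 + 1) := by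
  have hnr : (0 : ℝ) < n := by exact_mod_cast hn
  have h1 : |((curve k d j : ℤ) : ℝ)| = (d : ℝ) ^ (j.1 + 1) := by
    simp [curve, abs_pow]
  have h2 : (M / n : ℝ) * (n : ℝ) ^ (j.1 + 1) = M * (n : ℝ) ^ j.1 := by
    rw [pow_succ]; field_simp
  rw [h1, h2, pow_succ, mul_comm]
  have : (d : ℝ) ≤ M := by exact_mod_cast hd
  have : (M : ℝ) ≤ n := by exact_mod_cast hM
  gcongr
  linarith

/-- For a set without differences on the moment curve, the spectral mass weighted by the
exponential sums along the curve is large. -/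
lemma le_sum_spectrum {k n M : ℕ} (hn : 1 ≤ n) (hM : M ≤ n)
    {B : Finset (Fin k → ℤ)} {δ : ℝ} (hB : B ⊆ box k n) (hδ : (#B : ℝ) = δ * #(box k n))
    (hδ0 : 0 ≤ δ) (hfree : CurveFree B) (hMn : 4 * k * (M : ℝ) ≤ δ * n) (hMδ : 6 ≤ δ * M)
    {s : Finset (Fin k → ℕ)} {θ : (Fin k → ℕ) → Fin k → ℝ} {E : (Fin k → ℕ) → ℝ}
    (hE : ∀ a, 0 ≤ E a)
    (hspec : ∀ v : Fin k → ℤ, (∀ j, |v j| ≤ 2 * (n : ℤ) ^ (j.1 + 1)) →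
      ((∑ x ∈ box k n, balanced (box k n) B δ x * balanced (box k n) B δ (x + v) : ℝ) : ℂ) =
        ∑ a ∈ s, (E a : ℂ) * e (pairing (θ a) v)) :
    ∑ a ∈ s, E a ≤ δ * #(box k n) ∧
      δ ^ 2 / 4 * M * #(box k n) ≤
        ∑ a ∈ s, E a * ‖∑ d ∈ range M, e ((phase (θ a)).eval (d : ℝ))‖ := by
  have hnr : (0 : ℝ) < n := by exact_mod_cast hn
  set X := box k n with hX
  have hzero : ∑ a ∈ s, E a ≤ δ * #X := by
    have h1 := hspec 0 (fun j => by simp)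
    simp only [pairing_zero, e_zero, mul_one] at h1
    have h2 := sum_balanced_sq_le hB hδ
    have h3 : ∑ a ∈ s, E a = ∑ x ∈ X, balanced X B δ x * balanced X B δ (x + 0) := by
      exact_mod_cast h1.symm
    rw [h3]; exact h2
  refine ⟨hzero, ?_⟩
  set c : ℕ → ℝ := fun d => ∑ x ∈ X, balanced X B δ x * balanced X B δ (x + curve k d) with hc
  have hc0 : c 0 ≤ δ * #X := by
    have h1 : curve k ((0 : ℕ) : ℤ) = 0 := by ext j; simp [curve]
    rw [hc]; dsimp only; rw [h1]; exact sum_balanced_sq_le hB hδ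
  have hcd : ∀ d, d ≠ 0 → d < M → c d ≤ -(δ ^ 2 / 2) * #X := by
    intro d hd hdM
    have h1 : ∀ j : Fin k, (|curve k d j| : ℝ) ≤ (M / n : ℝ) * (n : ℝ) ^ (j.1 + 1) :=
      fun j => abs_curve_le hM hn hdM.le j
    have h2 := sum_balanced_mul_le hB hδ (v := curve k d) (η := k * (M / n : ℝ))
      (hfree d (by exact_mod_cast hd)) (card_box_filter_notMem_le h1)
      (card_box_filter_notMem_le fun j => by
        rw [Pi.neg_apply, Int.cast_neg, abs_neg]; exact h1 j) hδ0
    refine h2.trans ?_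
    have h3 : k * (M / n : ℝ) ≤ δ / 4 := by
      rw [← mul_div_assoc, div_le_iff₀ hnr]; linarith
    have h4 : 2 * δ * (k * (M / n : ℝ)) ≤ 2 * δ * (δ / 4) := by gcongr
    have h5 : (0 : ℝ) ≤ #X := by positivity
    nlinarith
  have hM1 : 1 ≤ M := Nat.pos_of_ne_zero fun h0 => by
    rw [h0] at hMδ; norm_num at hMδ
  have hsumc : ∑ d ∈ range M, c d ≤ -(δ ^ 2 / 4 * M * #X) := by
    obtain ⟨M', rfl⟩ : ∃ M', M = M' + 1 := ⟨M - 1, by omega⟩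
    rw [sum_range_succ']
    have h1 : ∑ d ∈ range M', c (d + 1) ≤ M' * (-(δ ^ 2 / 2) * #X) := by
      refine (sum_le_card_nsmul _ _ _ fun d hd => hcd (d + 1) (by omega)
        (by have := mem_range.1 hd; omega)).trans ?_
      simp
    have h2 : (0 : ℝ) ≤ #X := by positivity
    push_cast at hMδ ⊢
    have h3 : 6 * (δ * #X) ≤ (δ * (M' + 1)) * (δ * #X) := by gcongr
    have h4 : δ ≤ 1 := by
      have h5 : (#B : ℝ) ≤ #X := by exact_mod_cast card_le_card hB
      have h6 : (0 : ℝ) < #X := by exact_mod_cast card_box_pos hn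
      rw [hδ] at h5
      nlinarith
    have h5 : δ * (δ * #X) ≤ 1 * (δ * #X) := by gcongr
    nlinarith
  have hcs : ((∑ d ∈ range M, c d : ℝ) : ℂ) =
      ∑ a ∈ s, (E a : ℂ) * ∑ d ∈ range M, e ((phase (θ a)).eval (d : ℝ)) := by
    rw [Complex.ofReal_sum]
    simp_rw [mul_sum, eval_phase]
    rw [sum_comm (s := s)]
    refine sum_congr rfl fun d hd => hspec (curve k d) fun j => ?_
    have h1 : d ≤ n := (mem_range.1 hd).le.trans hM
    have h2 : |curve k d j| = (d : ℤ) ^ (j.1 + 1) := by simp [curve, abs_pow]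
    rw [h2]
    have h3 : (d : ℤ) ^ (j.1 + 1) ≤ (n : ℤ) ^ (j.1 + 1) := by gcongr
    have h4 : (0 : ℤ) ≤ (n : ℤ) ^ (j.1 + 1) := by positivity
    linarith
  calc δ ^ 2 / 4 * M * #X ≤ |∑ d ∈ range M, c d| := by
        rw [le_abs]; right; linarith
    _ = ‖((∑ d ∈ range M, c d : ℝ) : ℂ)‖ := by rw [Complex.norm_real, Real.norm_eq_abs]
    _ ≤ _ := by
        rw [hcs]
        refine norm_sum_le_of_le _ fun a _ => ?_
        rw [norm_mul, Complex.norm_real, Real.norm_of_nonneg (hE a)]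

end MomentCurve

namespace MomentCurve

open Polynomial

/-- The spectrum of a set without differences on the moment curve concentrates near rationals
with a common denominator. -/
lemma exists_large_spectrum {k : ℕ} (hk : 1 ≤ k) : ∃ C K : ℕ, 1 ≤ K ∧ ∀ T : ℕ, 2 ≤ T → ∀ n : ℕ,
    T ^ C ≤ n → ∀ (B : Finset (Fin k → ℤ)) (δ : ℝ), B ⊆ box k n → (#B : ℝ) = δ * #(box k n) →
    0 < δ → 64 * k ≤ T * δ → CurveFree B →
    ∀ (s : Finset (Fin k → ℕ)) (θ : (Fin k → ℕ) → Fin k → ℝ) (E : (Fin k → ℕ) → ℝ),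
    (∀ a, 0 ≤ E a) → (∀ v : Fin k → ℤ, (∀ j, |v j| ≤ 2 * (n : ℤ) ^ (j.1 + 1)) →
      ((∑ x ∈ box k n, balanced (box k n) B δ x * balanced (box k n) B δ (x + v) : ℝ) : ℂ) =
        ∑ a ∈ s, (E a : ℂ) * e (pairing (θ a) v)) →
    ∃ Q : ℕ, 1 ≤ Q ∧ Q ≤ T ^ C ∧ ∃ s' ⊆ s, δ ^ (k + 1) * #(box k n) ≤ K * ∑ a ∈ s', E a ∧
      ∀ a ∈ s', ∀ j : Fin k, NearInt (Q * θ a j) (T ^ C / n ^ (j.1 + 1)) := by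
  classical
  obtain ⟨C, hC⟩ := weyl_major hk
  set D : ℕ := (k * huaConst k) ^ k with hD
  have hD1 : 1 ≤ D := by
    have : 1 ≤ huaConst k := by
      have := Nat.pow_pos (n := 3) hk
      rw [huaConst]; omega
    exact Nat.one_le_pow _ _ (Nat.mul_pos hk this)
  refine ⟨2 * D * C + C + 2 * k + 2, 16 ^ k * (D ^ (4 * D) * 2 ^ (2 * D)), by
    have : 0 < D := hD1
    have : 0 < 16 ^ k * (D ^ (4 * D) * 2 ^ (2 * D)) := by positivity
    omega, ?_⟩
  intro T hT n hn B δ hB hδ hδ0 hTδ hfree s θ E hE hspec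
  have hT0 : 0 < T := by omega
  have hT1 : 1 ≤ T := hT0
  have hT1r : (1 : ℝ) ≤ T := by exact_mod_cast hT1
  have hkr : (1 : ℝ) ≤ k := by exact_mod_cast hk
  set M := n / T with hMdef
  have hn1 : 1 ≤ n := (Nat.one_le_pow _ _ hT0).trans hn
  have hM' : T ^ (C + 1) ≤ M := by
    rw [hMdef, Nat.le_div_iff_mul_le hT0, ← pow_succ]
    exact (Nat.pow_le_pow_right hT0 (by omega)).trans hn
  have hMC : T ^ C ≤ M := (Nat.pow_le_pow_right hT0 (by omega)).trans hM'
  have hTM : T ≤ M := (Nat.le_self_pow (by omega) T).trans hM'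
  have hTMr : (T : ℝ) ≤ M := by exact_mod_cast hTM
  have hM0 : (0 : ℝ) < M := by linarith
  have hMn : (M : ℝ) * T ≤ n := by exact_mod_cast Nat.div_mul_le_self n T
  have hnM : (n : ℝ) ≤ 2 * T * M := by
    have h1 : n < T * (M + 1) := by
      rw [mul_comm]; exact Nat.lt_mul_of_div_lt (Nat.lt_succ_self _) hT0
    have h2 : (n : ℝ) ≤ T * (M + 1) := by exact_mod_cast h1.le
    nlinarith
  have hδ1 : δ ≤ 1 := by
    have h5 : (#B : ℝ) ≤ #(box k n) := by exact_mod_cast card_le_card hB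
    have h6 : (0 : ℝ) < #(box k n) := by exact_mod_cast card_box_pos hn1
    rw [hδ] at h5
    nlinarith
  obtain ⟨hsum, hlow⟩ := le_sum_spectrum hn1 (Nat.div_le_self n T) hB hδ hδ0.le hfree
    (by
      have : 4 * k * (M : ℝ) ≤ T * δ * M := by refine mul_le_mul_of_nonneg_right ?_ hM0.le; linarith
      nlinarith)
    (by nlinarith) hE hspec
  set S : (Fin k → ℕ) → ℝ := fun a => ‖∑ d ∈ range M, e ((phase (θ a)).eval (d : ℝ))‖ with hS
  change _ ≤ ∑ a ∈ s, E a * S a at hlow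
  set X : ℝ := (#(box k n) : ℝ) with hX
  have hX0 : 0 ≤ X := by positivity
  set L := {a ∈ s | δ / 8 * M ≤ S a} with hL
  have hbig : ∀ a ∈ L, ∃ q : ℕ, 1 ≤ q ∧ q ≤ T ^ C ∧
      (∀ j, 1 ≤ j → j ≤ k → NearInt (q * (phase (θ a)).coeff j) (T ^ C / M ^ j)) ∧
      S a ^ k * q ≤ (2 * M) ^ k * (D : ℝ) ^ #q.primeFactors := fun a ha => by
    refine hC T hT M hMC (phase (θ a)) (natDegree_phase_le _) ?_
    have h1 := (mem_filter.1 ha).2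
    have h2 : (T : ℝ) * (δ / 8 * M) ≤ T * S a := by gcongr
    refine le_trans ?_ h2
    nlinarith
  choose! q hq1 hqC hqnear hqS using hbig
  have hlowL : δ ^ 2 / 8 * M * X ≤ ∑ a ∈ L, E a * S a := by
    have h1 : ∑ a ∈ s with ¬ δ / 8 * M ≤ S a, E a * S a ≤ δ / 8 * M * (δ * X) := by
      calc _ ≤ ∑ a ∈ s with ¬ δ / 8 * M ≤ S a, E a * (δ / 8 * M) := by
            refine sum_le_sum fun a ha => mul_le_mul_of_nonneg_left ?_ (hE a)
            exact (not_le.1 (mem_filter.1 ha).2).le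
        _ ≤ ∑ a ∈ s, E a * (δ / 8 * M) :=
            sum_le_sum_of_subset_of_nonneg (filter_subset _ _) fun a _ _ =>
              mul_nonneg (hE a) (by positivity)
        _ = δ / 8 * M * ∑ a ∈ s, E a := by rw [← sum_mul, mul_comm]
        _ ≤ _ := by gcongr
    rw [← sum_filter_add_sum_filter_not s (fun a => δ / 8 * M ≤ S a)] at hlow
    nlinarith
  have hSle : ∀ a ∈ L, (δ / 8) ^ (k - 1) * S a ≤ 2 ^ k * M * ((D : ℝ) ^ #(q a).primeFactors / q a) := by
    intro a ha
    have h1 := (mem_filter.1 ha).2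
    have hq0 : (0 : ℝ) < q a := by exact_mod_cast hq1 a ha
    have hSa : 0 ≤ S a := norm_nonneg _
    rw [mul_div_assoc', le_div_iff₀ hq0]
    refine le_of_mul_le_mul_left ?_ (pow_pos hM0 (k - 1))
    calc (M : ℝ) ^ (k - 1) * ((δ / 8) ^ (k - 1) * S a * q a)
        = (δ / 8 * M) ^ (k - 1) * S a * q a := by rw [mul_pow]; ring
      _ ≤ S a ^ (k - 1) * S a * q a := by gcongr
      _ = S a ^ k * q a := by rw [← pow_succ, Nat.sub_add_cancel hk]
      _ ≤ (2 * M) ^ k * (D : ℝ) ^ #(q a).primeFactors := hqS a ha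
      _ = (M : ℝ) ^ (k - 1) * (2 ^ k * M * (D : ℝ) ^ #(q a).primeFactors) := by
          have : (M : ℝ) ^ k = M ^ (k - 1) * M := by rw [← pow_succ, Nat.sub_add_cancel hk]
          rw [mul_pow, this]; ring
  obtain ⟨Q, hQ1, hQB, hQ⟩ := exists_divisor_pigeonhole hD1 L (fun a _ => hE a)
    (Nat.one_le_pow C T hT0) q fun a ha => ⟨hq1 a ha, hqC a ha⟩
  refine ⟨Q, hQ1, ?_, {a ∈ L | q a ∣ Q}, (filter_subset _ _).trans (filter_subset _ _), ?_, ?_⟩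
  · refine hQB.trans ?_
    rw [← pow_mul]
    refine Nat.pow_le_pow_right hT0 ?_
    nlinarith
  · refine le_of_mul_le_mul_left ?_ hM0
    have h1 : (δ / 8) ^ (k - 1) * (δ ^ 2 / 8 * M * X) ≤
        2 ^ k * M * ((D : ℝ) ^ (4 * D) * 2 ^ (2 * D) * ∑ a ∈ L with q a ∣ Q, E a) := by
      calc (δ / 8) ^ (k - 1) * (δ ^ 2 / 8 * M * X)
          ≤ (δ / 8) ^ (k - 1) * ∑ a ∈ L, E a * S a := by gcongr
        _ = ∑ a ∈ L, E a * ((δ / 8) ^ (k - 1) * S a) := by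
            rw [mul_sum]; exact sum_congr rfl fun a _ => by ring
        _ ≤ ∑ a ∈ L, E a * (2 ^ k * M * ((D : ℝ) ^ #(q a).primeFactors / q a)) :=
            sum_le_sum fun a ha => mul_le_mul_of_nonneg_left (hSle a ha) (hE a)
        _ = 2 ^ k * M * ∑ a ∈ L, E a * ((D : ℝ) ^ #(q a).primeFactors / q a) := by
            rw [mul_sum]; exact sum_congr rfl fun a _ => by ring
        _ ≤ _ := by gcongr
    have h2 : (M : ℝ) * (δ ^ (k + 1) * X) = 8 ^ k * ((δ / 8) ^ (k - 1) * (δ ^ 2 / 8 * M * X)) := by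
      obtain ⟨k', rfl⟩ : ∃ k', k = k' + 1 := ⟨k - 1, by omega⟩
      rw [Nat.add_sub_cancel, div_pow]
      field_simp
      ring
    rw [h2]
    refine (mul_le_mul_of_nonneg_left h1 (by positivity)).trans (le_of_eq ?_)
    have h3 : (16 : ℝ) ^ k = 8 ^ k * 2 ^ k := by rw [← mul_pow]; norm_num
    push_cast
    rw [h3]; ring
  · intro a ha j
    obtain ⟨haL, r, hr⟩ := mem_filter.1 ha
    have h1 := (hqnear a haL (j.1 + 1) (by omega) (by omega)).nat_mul r
    rw [coeff_phase] at h1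
    have h2 : (Q : ℝ) * θ a j = r * (q a * θ a j) := by
      rw [hr]; push_cast; ring
    rw [h2]
    refine h1.mono ?_
    have hn0 : (0 : ℝ) < n := by exact_mod_cast hn1
    have hrQ : (r : ℝ) ≤ T ^ (2 * D * C) := by
      have h3 : r ≤ Q := Nat.le_of_dvd hQ1 ⟨q a, by rw [hr, mul_comm]⟩
      have h4 : r ≤ T ^ (2 * D * C) := by
        refine (h3.trans hQB).trans (le_of_eq ?_)
        rw [← pow_mul]; congr 1; ring
      exact_mod_cast h4
    have h5 : (n : ℝ) ^ (j.1 + 1) ≤ T ^ (2 * k) * M ^ (j.1 + 1) := by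
      calc (n : ℝ) ^ (j.1 + 1) ≤ (2 * T * M) ^ (j.1 + 1) := by gcongr
        _ = (2 * T) ^ (j.1 + 1) * M ^ (j.1 + 1) := by rw [mul_pow]
        _ ≤ (T ^ 2) ^ k * M ^ (j.1 + 1) := by
            have h6 : (2 : ℝ) * T ≤ T ^ 2 := by
              have : (2 : ℝ) ≤ T := by exact_mod_cast hT
              nlinarith
            have h7 : j.1 + 1 ≤ k := j.2
            exact mul_le_mul_of_nonneg_right ((pow_le_pow_left₀ (by positivity) h6 _).trans
              (pow_le_pow_right₀ (one_le_pow₀ hT1r) h7)) (by positivity)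
        _ = _ := by rw [← pow_mul]
    rw [mul_div_assoc', div_le_div_iff₀ (by positivity) (by positivity)]
    calc (r : ℝ) * T ^ C * n ^ (j.1 + 1)
        ≤ T ^ (2 * D * C) * T ^ C * (T ^ (2 * k) * M ^ (j.1 + 1)) := by gcongr
      _ = T ^ (2 * D * C + C + 2 * k) * M ^ (j.1 + 1) := by rw [pow_add, pow_add]; ring
      _ ≤ _ := mul_le_mul_of_nonneg_right
          (pow_le_pow_right₀ hT1r (Nat.le_add_right _ _)) (by positivity)

end MomentCurve

namespace MomentCurve

lemma sum_shift_eq {G : Type*} [AddCommGroup G] {X X' : Finset G} {f : G → ℝ}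
    (hf : ∀ x ∉ X, f x = 0) {w : G} (hw : ∀ z ∈ X, z - w ∈ X') (h : G → ℝ) :
    ∑ x ∈ X', f (x + w) * h (x + w) = ∑ z ∈ X, f z * h z := by
  classical
  have h1 : ∑ x ∈ X', f (x + w) * h (x + w) = ∑ z ∈ X'.image (· + w), f z * h z := by
    rw [sum_image fun x _ y _ hxy => add_right_cancel hxy]
  rw [h1]
  refine (sum_subset (fun z hz => ?_) fun z _ hz => by rw [hf z hz, zero_mul]).symm
  exact mem_image.2 ⟨z - w, hw z hz, sub_add_cancel z w⟩

lemma sum_sq_shift_eq {k : ℕ} {X X' Y : Finset (Fin k → ℤ)} {g : (Fin k → ℤ) → Fin k → ℤ}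
    {f : (Fin k → ℤ) → ℝ} (hf : ∀ x ∉ X, f x = 0) (hX' : ∀ z ∈ X, ∀ y ∈ Y, z - g y ∈ X')
    {s : Finset (Fin k → ℕ)} {θ : (Fin k → ℕ) → Fin k → ℝ} {E : (Fin k → ℕ) → ℝ}
    (hspec : ∀ y ∈ Y, ∀ y' ∈ Y, ((∑ x ∈ X, f x * f (x + (g y - g y')) : ℝ) : ℂ) =
      ∑ a ∈ s, (E a : ℂ) * e (pairing (θ a) (g y - g y'))) :
    ∑ x ∈ X', (∑ y ∈ Y, f (x + g y)) ^ 2 =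
      ∑ a ∈ s, E a * ‖∑ y ∈ Y, e (pairing (θ a) (g y))‖ ^ 2 := by
  have h1 : ∑ x ∈ X', (∑ y ∈ Y, f (x + g y)) ^ 2 =
      ∑ y ∈ Y, ∑ y' ∈ Y, ∑ x ∈ X, f x * f (x + (g y - g y')) := by
    simp_rw [sq, sum_mul_sum]
    rw [sum_comm]
    refine sum_congr rfl fun y hy => ?_
    rw [sum_comm]
    refine sum_congr rfl fun y' hy' => ?_
    rw [← sum_shift_eq hf (hX' · · y' hy') fun x => f (x + (g y - g y'))]
    refine sum_congr rfl fun x _ => ?_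
    rw [mul_comm]
    congr 2
    abel
  have h2 : ((∑ x ∈ X', (∑ y ∈ Y, f (x + g y)) ^ 2 : ℝ) : ℂ) =
      ((∑ a ∈ s, E a * ‖∑ y ∈ Y, e (pairing (θ a) (g y))‖ ^ 2 : ℝ) : ℂ) := by
    rw [h1, Complex.ofReal_sum]
    have h3 : ∀ a ∈ s, ((E a * ‖∑ y ∈ Y, e (pairing (θ a) (g y))‖ ^ 2 : ℝ) : ℂ) =
        ∑ y ∈ Y, ∑ y' ∈ Y, (E a : ℂ) * e (pairing (θ a) (g y - g y')) := fun a _ => by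
      rw [Complex.ofReal_mul, ← Complex.normSq_eq_norm_sq, ← Complex.mul_conj, map_sum,
        sum_mul_sum, mul_sum]
      refine sum_congr rfl fun y _ => ?_
      rw [mul_sum]
      refine sum_congr rfl fun y' _ => ?_
      rw [pairing_sub, e_sub]
    rw [Complex.ofReal_sum, sum_congr rfl h3, sum_comm]
    refine sum_congr rfl fun y hy => ?_
    rw [Complex.ofReal_sum, sum_comm]
    exact sum_congr rfl fun y' hy' => hspec y hy y' hy'
  exact_mod_cast h2

/-- A function with mean zero that is bounded below and nowhere large on most of its domain has
small second moment. -/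
lemma sum_sq_le_of_forall_le {ι : Type*} [DecidableEq ι] {X Z : Finset ι} {F : ι → ℝ} {δ τ Y : ℝ}
    (hδ0 : 0 ≤ δ) (hδ1 : δ ≤ 1) (hτ0 : 0 ≤ τ) (hτ1 : τ ≤ 1) (hY : 0 ≤ Y) (hZ : Z ⊆ X)
    (h0 : ∑ x ∈ X, F x = 0) (hlow : ∀ x, -(δ * Y) ≤ F x) (hup : ∀ x, F x ≤ Y)
    (hle : ∀ x ∈ Z, F x ≤ δ * τ * Y) :
    ∑ x ∈ X, F x ^ 2 ≤ (2 * δ ^ 2 * τ * #Z + 2 * #(X \ Z)) * Y ^ 2 := by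
  have h1 : ∑ x ∈ X, F x ^ 2 = ∑ x ∈ X, F x * (F x + δ * Y) := by
    have : ∑ x ∈ X, F x * (F x + δ * Y) = ∑ x ∈ X, F x ^ 2 + (∑ x ∈ X, F x) * (δ * Y) := by
      rw [sum_mul, ← sum_add_distrib]
      exact sum_congr rfl fun x _ => by ring
    rw [this, h0, zero_mul, add_zero]
  have h2 : ∀ x ∈ Z, F x * (F x + δ * Y) ≤ 2 * δ ^ 2 * τ * Y ^ 2 := fun x hx => by
    have h3 : 0 ≤ F x + δ * Y := by linarith [hlow x]
    have h4 : δ * τ * Y ≤ δ * 1 * Y := by gcongr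
    calc F x * (F x + δ * Y) ≤ (δ * τ * Y) * (F x + δ * Y) :=
          mul_le_mul_of_nonneg_right (hle x hx) h3
      _ ≤ (δ * τ * Y) * (2 * (δ * Y)) :=
          mul_le_mul_of_nonneg_left (by linarith [hle x hx]) (by positivity)
      _ = _ := by ring
  have h5 : ∀ x ∈ X \ Z, F x * (F x + δ * Y) ≤ 2 * Y ^ 2 := fun x _ => by
    have h3 : 0 ≤ F x + δ * Y := by linarith [hlow x]
    have h4 : δ * Y ≤ 1 * Y := by gcongr
    calc F x * (F x + δ * Y) ≤ Y * (F x + δ * Y) := mul_le_mul_of_nonneg_right (hup x) h3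
      _ ≤ Y * (2 * Y) := mul_le_mul_of_nonneg_left (by linarith [hup x]) hY
      _ = _ := by ring
  rw [h1, ← sum_sdiff hZ]
  refine (add_le_add (sum_le_card_nsmul _ _ _ h5) (sum_le_card_nsmul _ _ _ h2)).trans (le_of_eq ?_)
  rw [nsmul_eq_mul, nsmul_eq_mul]
  ring

/-- Dilation by the powers of `Q`, matching the moment curve. -/
def dilate {k : ℕ} (Q : ℕ) (y : Fin k → ℤ) : Fin k → ℤ := fun j => (Q : ℤ) ^ (j.1 + 1) * y j

lemma dilate_curve {k : ℕ} (Q : ℕ) (d : ℤ) : dilate Q (curve k d) = curve k (Q * d) := by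
  ext j; simp [dilate, curve, mul_pow]

lemma dilate_mem {k n Q : ℕ} {y : Fin k → ℤ} (hy : y ∈ box k n) (j : Fin k) :
    0 ≤ dilate Q y j ∧ dilate Q y j ≤ ((Q : ℤ) * n) ^ (j.1 + 1) := by
  obtain ⟨h1, h2⟩ := mem_box.1 hy j
  rw [dilate, mul_pow]
  exact ⟨mul_nonneg (by positivity) (by linarith), by gcongr⟩

lemma CurveFree.dilate {k Q : ℕ} (hQ : 1 ≤ Q) {B : Finset (Fin k → ℤ)} (hB : CurveFree B)
    (Y : Finset (Fin k → ℤ)) (x : Fin k → ℤ) :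
    CurveFree {y ∈ Y | x + MomentCurve.dilate Q y ∈ B} := by
  intro d hd y hy hy'
  refine hB (Q * d) (mul_ne_zero (by exact_mod_cast (by omega : Q ≠ 0)) hd) _ (mem_filter.1 hy).2 ?_
  have h1 := (mem_filter.1 hy').2
  rw [← dilate_curve, add_assoc]
  convert h1 using 2
  ext j
  simp [MomentCurve.dilate, mul_add]

lemma half_card_le_norm_sum {k n n' Q : ℕ} {R : ℝ} (hQ : 1 ≤ Q) (hn : 1 ≤ n) (hR : 0 ≤ R)
    (hQn : Q * n' ≤ n) (h : 14 * k * R * (Q * n') ≤ n) {θ : Fin k → ℝ}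
    (hθ : ∀ j : Fin k, NearInt (Q * θ j) (R / n ^ (j.1 + 1))) :
    (#(box k n') : ℝ) / 2 ≤ ‖∑ y ∈ box k n', e (pairing θ (dilate Q y))‖ := by
  have hn0 : (0 : ℝ) < n := by exact_mod_cast hn
  have hQ1 : (1 : ℝ) ≤ Q := by exact_mod_cast hQ
  have hQn' : (Q * n' : ℝ) ≤ n := by exact_mod_cast hQn
  have h1 : ∀ y ∈ box k n', NearInt (pairing θ (dilate Q y)) (1 / 14) := fun y hy => by
    have h2 : ∀ j ∈ (univ : Finset (Fin k)),
        NearInt (θ j * (dilate Q y j : ℤ)) (R * (Q * n') / n) := fun j _ => by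
      have h3 := (hθ j).int_mul ((Q : ℤ) ^ j.1 * y j)
      have h4 : θ j * ((dilate Q y j : ℤ) : ℝ) = (((Q : ℤ) ^ j.1 * y j : ℤ) : ℝ) * (Q * θ j) := by
        rw [dilate]; push_cast; ring
      rw [h4]
      refine h3.mono ?_
      obtain ⟨h5, h6⟩ := mem_box.1 hy j
      have h7 : |(((Q : ℤ) ^ j.1 * y j : ℤ) : ℝ)| ≤ (Q * n' : ℝ) ^ (j.1 + 1) := by
        have h8 : (0 : ℝ) ≤ y j := by exact_mod_cast (by linarith : (0 : ℤ) ≤ y j)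
        have h9 : (y j : ℝ) ≤ (n' : ℝ) ^ (j.1 + 1) := by exact_mod_cast h6
        push_cast
        rw [abs_of_nonneg (by positivity), mul_pow]
        have h10 : (Q : ℝ) ^ j.1 ≤ Q ^ (j.1 + 1) := pow_le_pow_right₀ hQ1 (by omega)
        gcongr
      rw [mul_div_assoc', div_le_div_iff₀ (by positivity) hn0]
      calc |(((Q : ℤ) ^ j.1 * y j : ℤ) : ℝ)| * R * n
          ≤ ((Q * n' : ℝ) ^ (j.1 + 1)) * R * n := by gcongr
        _ = (Q * n' : ℝ) ^ j.1 * (R * (Q * n')) * n := by ring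
        _ ≤ (n : ℝ) ^ j.1 * (R * (Q * n')) * n := by gcongr
        _ = _ := by ring
    refine (NearInt.sum univ h2).mono ?_
    rw [sum_const, card_univ, Fintype.card_fin, nsmul_eq_mul, mul_div_assoc', div_le_iff₀ hn0]
    linarith
  have h2 : ‖∑ y ∈ box k n', (e (pairing θ (dilate Q y)) - 1)‖ ≤ #(box k n') / 2 := by
    refine (norm_sum_le_of_le (n := fun _ => (1 / 2 : ℝ)) _ fun y hy => ?_).trans (le_of_eq ?_)
    · obtain ⟨b, hb⟩ := h1 y hy
      have h3 := norm_e_sub_e_le_of_int (pairing θ (dilate Q y)) 0 b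
      rw [e_zero, sub_zero] at h3
      linarith
    · rw [sum_const, nsmul_eq_mul]; ring
  rw [sum_sub_distrib, sum_const, nsmul_eq_mul, mul_one] at h2
  have h3 := norm_sub_norm_le (#(box k n') : ℂ) (∑ y ∈ box k n', e (pairing θ (dilate Q y)))
  rw [norm_sub_rev, Complex.norm_natCast] at h3
  linarith

end MomentCurve

namespace MomentCurve

lemma card_Icc_one_sub {m W : ℕ} : #(Icc (1 - (W : ℤ)) m) = m + W := by
  rw [Int.card_Icc]; omega

/-- The points all of whose dilated translates stay in a box make up most of those with some
translate in it. -/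
lemma card_boundary_le {k n Q n' : ℕ} (hn : 1 ≤ n) (hQn : Q * n' ≤ n) :
    (#((Fintype.piFinset fun j : Fin k => Icc (1 - (((Q * n') ^ (j.1 + 1) : ℕ) : ℤ))
          ((n ^ (j.1 + 1) : ℕ) : ℤ)) \
        Fintype.piFinset fun j : Fin k => Icc 1
          (((n ^ (j.1 + 1) : ℕ) : ℤ) - (((Q * n') ^ (j.1 + 1) : ℕ) : ℤ))) : ℝ) ≤
      k * (2 * (Q * n' / n)) * (2 ^ k * #(box k n)) := by
  have hn0 : (0 : ℝ) < n := by exact_mod_cast hn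
  have hW : ∀ j : Fin k, (Q * n') ^ (j.1 + 1) ≤ n ^ (j.1 + 1) := fun j =>
    Nat.pow_le_pow_left hQn _
  refine (card_piFinset_sdiff_le (ε := fun _ => 2 * (Q * n' / n)) fun j => ?_).trans ?_
  · have h1 : #(Icc (1 - (((Q * n') ^ (j.1 + 1) : ℕ) : ℤ)) ((n ^ (j.1 + 1) : ℕ) : ℤ) \
        Icc 1 (((n ^ (j.1 + 1) : ℕ) : ℤ) - (((Q * n') ^ (j.1 + 1) : ℕ) : ℤ))) ≤
        2 * (Q * n') ^ (j.1 + 1) := by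
      have h2 := hW j
      rw [card_sdiff_of_subset (Icc_subset_Icc (by omega) (by omega)), card_Icc_one_sub, Int.card_Icc]
      omega
    have h2 : ((#(Icc (1 - (((Q * n') ^ (j.1 + 1) : ℕ) : ℤ)) ((n ^ (j.1 + 1) : ℕ) : ℤ) \
        Icc 1 (((n ^ (j.1 + 1) : ℕ) : ℤ) - (((Q * n') ^ (j.1 + 1) : ℕ) : ℤ))) : ℕ) : ℝ) ≤
        2 * (Q * n' : ℝ) ^ (j.1 + 1) := by exact_mod_cast h1
    refine h2.trans ?_
    rw [card_Icc_one_sub]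
    push_cast
    have h3 : (Q * n' : ℝ) ^ (j.1 + 1) ≤ Q * n' / n * n ^ (j.1 + 1) := by
      have h4 : (Q * n' : ℝ) ≤ n := by exact_mod_cast hQn
      calc (Q * n' : ℝ) ^ (j.1 + 1) = Q * n' * (Q * n') ^ j.1 := by ring
        _ ≤ Q * n' * n ^ j.1 := by gcongr
        _ = _ := by field_simp; ring
    have h5 : (0 : ℝ) ≤ Q * n' / n * (Q * n') ^ (j.1 + 1) := by positivity
    nlinarith
  · rw [sum_const, card_univ, Fintype.card_fin, nsmul_eq_mul]
    refine mul_le_mul_of_nonneg_left ?_ (by positivity)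
    rw [Fintype.card_piFinset, card_box]
    have h6 : ∏ j : Fin k, #(Icc (1 - (((Q * n') ^ (j.1 + 1) : ℕ) : ℤ)) ((n ^ (j.1 + 1) : ℕ) : ℤ)) ≤
        2 ^ k * ∏ j : Fin k, n ^ (j.1 + 1) := by
      have h7 : (2 : ℕ) ^ k = ∏ _j : Fin k, 2 := by simp
      rw [h7, ← prod_mul_distrib]
      refine prod_le_prod' fun j _ => ?_
      rw [card_Icc_one_sub]
      have := hW j
      omega
    exact_mod_cast h6

lemma abs_balanced_le {G : Type*} [DecidableEq G] {X B : Finset G} {δ : ℝ} (hB : B ⊆ X)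
    (hδ0 : 0 ≤ δ) (x : G) : -δ ≤ balanced X B δ x ∧ balanced X B δ x ≤ 1 := by
  have h1 := @hB x
  simp only [balanced]
  split_ifs with h2 h3 h3
  · constructor <;> linarith
  · exact absurd (h1 h2) h3
  · constructor <;> linarith
  · constructor <;> linarith

lemma sum_balanced_eq_zero {G : Type*} [DecidableEq G] {X B : Finset G} {δ : ℝ} (hB : B ⊆ X)
    (hδ : (#B : ℝ) = δ * #X) : ∑ x ∈ X, balanced X B δ x = 0 := by
  simp only [balanced]
  rw [sum_sub_distrib, ← mul_sum, sum_boole, sum_boole, filter_mem_eq_inter, filter_mem_eq_inter,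
    inter_eq_right.2 hB, inter_self, hδ, sub_self]

lemma increment_scale {k : ℕ} (hk : 1 ≤ k) {δ K : ℝ} (hK : 0 < K) :
    4 * K * (2 * δ ^ 2 * (δ ^ (k - 1) / (32 * K))) = 1 / 4 * δ ^ (k + 1) := by
  obtain ⟨k, rfl⟩ : ∃ k', k = k' + 1 := ⟨k - 1, by omega⟩
  rw [Nat.add_sub_cancel]
  field_simp
  ring

set_option maxHeartbeats 800000 in
/-- The density increment step. -/
lemma density_increment {k : ℕ} (hk : 1 ≤ k) : ∃ C K : ℕ, 1 ≤ K ∧ ∀ T n : ℕ, T ^ C ≤ n →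
    ∀ (B : Finset (Fin k → ℤ)) (δ : ℝ), B ⊆ box k n → (#B : ℝ) = δ * #(box k n) →
    0 < δ → 64 * k ≤ T * δ → CurveFree B →
    ∃ (n' : ℕ) (B' : Finset (Fin k → ℤ)), 1 ≤ n' ∧ n ≤ T ^ C * n' ∧ B' ⊆ box k n' ∧
      CurveFree B' ∧ δ * (1 + δ ^ (k - 1) / K) * #(box k n') ≤ #B' := by
  obtain ⟨C, K, hK1, h⟩ := exists_large_spectrum hk
  set A : ℕ := 32 * K * k * 2 ^ k with hA
  set C₂ : ℕ := 2 * C + A + (k + 1) with hC₂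
  refine ⟨C₂ + 1, 32 * K, by omega, fun T n hn B δ hB hδ hδ0 hTδ hfree => ?_⟩
  have hkr : (1 : ℝ) ≤ k := by exact_mod_cast hk
  have hKr : (1 : ℝ) ≤ K := by exact_mod_cast hK1
  have hT0 : 0 < T := Nat.pos_of_ne_zero fun h0 => by
    rw [h0] at hTδ; norm_num at hTδ; linarith
  have hn1 : 1 ≤ n := (Nat.one_le_pow _ _ hT0).trans hn
  set X := box k n with hX
  have hX0 : (0 : ℝ) < #X := by exact_mod_cast card_box_pos hn1
  have hδ1 : δ ≤ 1 := by
    have h5 : (#B : ℝ) ≤ #X := by exact_mod_cast card_le_card hB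
    rw [hδ] at h5
    nlinarith
  have hTr : 64 * (k : ℝ) ≤ T := by
    refine hTδ.trans ?_
    have : (T : ℝ) * δ ≤ T * 1 := by gcongr
    linarith
  have hT64 : 64 * k ≤ T := by exact_mod_cast hTr
  have hT1r : (1 : ℝ) ≤ T := by linarith
  obtain ⟨s, θ, E, hE, hspec⟩ := exists_spectral (fun j : Fin k => n ^ (j.1 + 1))
    (X := X) (fun x hx j => by exact_mod_cast mem_box.1 hx j) (f := balanced X B δ)
    fun x hx => balanced_of_notMem hB hx
  push_cast at hspec
  obtain ⟨Q, hQ1, hQC, s', hs', hmass, hnear⟩ := h T (by omega) n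
    ((Nat.pow_le_pow_right hT0 (by omega)).trans hn) B δ hB hδ hδ0 hTδ hfree s θ E hE
    (fun v hv => by push_cast; exact hspec v hv)
  set n' := n / T ^ C₂ with hn'
  have hTC₂ : 0 < T ^ C₂ := Nat.pow_pos hT0
  have hn'1 : 1 ≤ n' := by
    rw [hn', Nat.le_div_iff_mul_le hTC₂, one_mul]
    exact (Nat.pow_le_pow_right hT0 (Nat.le_succ _)).trans hn
  have hn'n : n' * T ^ C₂ ≤ n := Nat.div_mul_le_self _ _
  have hn0 : (0 : ℝ) < n := by exact_mod_cast hn1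
  set Y := box k n' with hY
  have hY0 : (0 : ℝ) < #Y := by exact_mod_cast card_box_pos hn'1
  set F : (Fin k → ℤ) → ℝ := fun x => ∑ y ∈ Y, balanced X B δ (x + dilate Q y) with hF
  set τ : ℝ := δ ^ (k - 1) / ((32 * K : ℕ) : ℝ) with hτ
  have hQn : Q * n' * T ^ (C + A + (k + 1)) ≤ n := by
    refine le_trans ?_ hn'n
    calc Q * n' * T ^ (C + A + (k + 1)) ≤ T ^ C * n' * T ^ (C + A + (k + 1)) := by gcongr
      _ = n' * T ^ C₂ := by rw [hC₂]; ring
  have hQn1 : Q * n' ≤ n := (Nat.le_mul_of_pos_right _ (Nat.pow_pos hT0)).trans hQn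
  set W : Fin k → ℕ := fun j => (Q * n') ^ (j.1 + 1) with hW
  set m : Fin k → ℕ := fun j => n ^ (j.1 + 1) with hm
  have hWm : ∀ j, W j ≤ m j := fun j => Nat.pow_le_pow_left hQn1 _
  set X' : Finset (Fin k → ℤ) := Fintype.piFinset fun j => Icc (1 - (W j : ℤ)) (m j) with hX'
  set Z : Finset (Fin k → ℤ) := Fintype.piFinset fun j => Icc 1 ((m j : ℤ) - W j) with hZ
  have hYW : ∀ y ∈ Y, ∀ j, 0 ≤ dilate Q y j ∧ dilate Q y j ≤ W j := fun y hy j => by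
    have := dilate_mem (Q := Q) hy j
    rw [hW]; push_cast; exact this
  have hXm : ∀ x, x ∈ X ↔ ∀ j, 1 ≤ x j ∧ x j ≤ m j := fun x => by
    rw [hX, mem_box, hm]; push_cast; rfl
  have hXX' : ∀ z ∈ X, ∀ y ∈ Y, z - dilate Q y ∈ X' := fun z hz y hy => by
    rw [hX', Fintype.mem_piFinset]
    intro j
    have h1 := (hXm z).1 hz j
    have h2 := hYW y hy j
    rw [mem_Icc, Pi.sub_apply]
    constructor <;> linarith
  have hZX : ∀ x ∈ Z, ∀ y ∈ Y, x + dilate Q y ∈ X := fun x hx y hy => by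
    rw [hXm]
    intro j
    have h1 := mem_Icc.1 (Fintype.mem_piFinset.1 hx j)
    have h2 := hYW y hy j
    rw [Pi.add_apply]
    constructor <;> linarith
  have hZX' : Z ⊆ X' := Fintype.piFinset_subset _ _ fun j =>
    Icc_subset_Icc (by linarith [Int.natCast_nonneg (W j)]) (by linarith [Int.natCast_nonneg (W j)])
  have hZcard : (#Z : ℝ) ≤ #X := by
    have : Z ⊆ X := fun x hx => (hXm x).2 fun j => by
      have h1 := mem_Icc.1 (Fintype.mem_piFinset.1 hx j)
      exact ⟨h1.1, by linarith [Int.natCast_nonneg (W j)]⟩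
    exact_mod_cast card_le_card this
  have hsumF : ∑ x ∈ X', F x = 0 := by
    rw [hF, sum_comm]
    refine sum_eq_zero fun y hy => ?_
    have h1 := sum_shift_eq (f := balanced X B δ) (fun x hx => balanced_of_notMem hB hx)
      (hXX' · · y hy) (fun _ => 1)
    simp only [mul_one] at h1
    rw [h1, sum_balanced_eq_zero hB hδ]
  have hFlow : ∀ x, -(δ * #Y) ≤ F x := fun x => by
    have := card_nsmul_le_sum Y (fun y => balanced X B δ (x + dilate Q y)) (-δ)
      fun y _ => (abs_balanced_le hB hδ0.le _).1
    rw [nsmul_eq_mul] at this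
    linarith
  have hFup : ∀ x, F x ≤ #Y := fun x => by
    have := sum_le_card_nsmul Y (fun y => balanced X B δ (x + dilate Q y)) 1
      fun y _ => (abs_balanced_le hB hδ0.le _).2
    rwa [nsmul_eq_mul, mul_one] at this
  have hsq : ∑ x ∈ X', F x ^ 2 = ∑ a ∈ s, E a * ‖∑ y ∈ Y, e (pairing (θ a) (dilate Q y))‖ ^ 2 := by
    refine sum_sq_shift_eq (fun x hx => balanced_of_notMem hB hx) hXX' fun y hy y' hy' => ?_
    push_cast
    refine hspec _ fun j => ?_
    have h1 := hYW y hy j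
    have h2 := hYW y' hy' j
    have h3 : (W j : ℤ) ≤ m j := by exact_mod_cast hWm j
    have h4 : (m j : ℤ) = (n : ℤ) ^ (j.1 + 1) := by rw [hm]; push_cast; rfl
    rw [Pi.sub_apply, abs_le, ← h4]
    constructor <;> linarith
  have hτ0 : 0 ≤ τ := by positivity
  have hτ1 : τ ≤ 1 := by
    rw [hτ, div_le_one (by positivity)]
    push_cast
    have := pow_le_one₀ (n := k - 1) hδ0.le hδ1
    linarith
  have hlower : δ ^ (k + 1) * #X * (#Y : ℝ) ^ 2 ≤ 4 * K * ∑ x ∈ X', F x ^ 2 := by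
    have h1 : (∑ a ∈ s', E a) * ((#Y : ℝ) / 2) ^ 2 ≤ ∑ x ∈ X', F x ^ 2 := by
      rw [hsq, sum_mul]
      refine le_trans (sum_le_sum fun a ha => ?_) (sum_le_sum_of_subset_of_nonneg hs'
        fun a _ _ => mul_nonneg (hE a) (by positivity))
      refine mul_le_mul_of_nonneg_left (pow_le_pow_left₀ (by positivity) ?_ 2) (hE a)
      refine half_card_le_norm_sum hQ1 hn1 (by positivity) hQn1 ?_ (hnear a ha)
      have h2 : (14 * k : ℝ) ≤ T ^ (A + (k + 1)) := by
        have : (T : ℝ) ≤ T ^ (A + (k + 1)) := le_self_pow₀ hT1r (by omega)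
        linarith
      calc 14 * (k : ℝ) * T ^ C * (Q * n') ≤ T ^ (A + (k + 1)) * T ^ C * (Q * n') := by gcongr
        _ = Q * n' * T ^ (C + A + (k + 1)) := by ring
        _ ≤ n := by exact_mod_cast hQn
    calc δ ^ (k + 1) * #X * (#Y : ℝ) ^ 2 ≤ (K * ∑ a ∈ s', E a) * (#Y : ℝ) ^ 2 := by gcongr
      _ = 4 * K * ((∑ a ∈ s', E a) * ((#Y : ℝ) / 2) ^ 2) := by ring
      _ ≤ _ := by gcongr
  obtain ⟨x, hxZ, hx⟩ : ∃ x ∈ Z, δ * τ * #Y < F x := by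
    by_contra! hcon
    have h1 := sum_sq_le_of_forall_le hδ0.le hδ1 hτ0 hτ1 hY0.le hZX' hsumF hFlow hFup hcon
    have h2 : (#(X' \ Z) : ℝ) ≤ k * (2 * (Q * n' / n)) * (2 ^ k * #X) := card_boundary_le hn1 hQn1
    have h3 : (A : ℝ) * (Q * n' / n) ≤ δ ^ (k + 1) := by
      have h4 : (1 : ℝ) ≤ T ^ (k + 1) * δ ^ (k + 1) := by
        rw [← mul_pow]; exact one_le_pow₀ (by linarith)
      have h5 : (A : ℝ) ≤ T ^ A := by
        have h6 : A ≤ T ^ A := (Nat.lt_pow_self (by omega)).le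
        exact_mod_cast h6
      have h7 : (Q * n' : ℝ) * T ^ (C + A + (k + 1)) ≤ n := by exact_mod_cast hQn
      have h8 : (A : ℝ) * (Q * n') * T ^ (k + 1) ≤ n := by
        refine le_trans ?_ h7
        have h9 : (1 : ℝ) ≤ T ^ C := one_le_pow₀ hT1r
        calc (A : ℝ) * (Q * n') * T ^ (k + 1) ≤ T ^ A * (Q * n') * T ^ (k + 1) * 1 := by
              rw [mul_one]; gcongr
          _ ≤ T ^ A * (Q * n') * T ^ (k + 1) * T ^ C := by gcongr
          _ = _ := by ring
      rw [mul_div_assoc', div_le_iff₀ hn0]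
      calc (A : ℝ) * (Q * n') ≤ A * (Q * n') * (T ^ (k + 1) * δ ^ (k + 1)) :=
            le_mul_of_one_le_right (by positivity) h4
        _ = (A * (Q * n') * T ^ (k + 1)) * δ ^ (k + 1) := by ring
        _ ≤ n * δ ^ (k + 1) := by gcongr
        _ = _ := by ring
    have h4 : δ ^ (k + 1) * #X * (#Y : ℝ) ^ 2 ≤
        (3 / 4 * δ ^ (k + 1)) * #X * (#Y : ℝ) ^ 2 := by
      refine (hlower.trans (mul_le_mul_of_nonneg_left h1 (by positivity))).trans ?_
      rw [← mul_assoc]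
      refine mul_le_mul_of_nonneg_right ?_ (by positivity)
      have h5 : 4 * K * (2 * δ ^ 2 * τ * #Z) ≤ 1 / 4 * δ ^ (k + 1) * #X := by
        have h6 : 4 * K * (2 * δ ^ 2 * τ) = 1 / 4 * δ ^ (k + 1) := by
          rw [hτ]; push_cast; exact increment_scale hk (by positivity)
        calc _ = 4 * K * (2 * δ ^ 2 * τ) * #Z := by ring
          _ ≤ 4 * K * (2 * δ ^ 2 * τ) * #X := by gcongr
          _ = _ := by rw [h6]
      have h6 : 4 * K * (2 * (#(X' \ Z) : ℝ)) ≤ 1 / 2 * δ ^ (k + 1) * #X := by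
        calc _ ≤ 4 * K * (2 * (k * (2 * (Q * n' / n)) * (2 ^ k * (#X : ℝ)))) := by gcongr
          _ = 1 / 2 * (A * (Q * n' / n)) * #X := by rw [hA]; push_cast; ring
          _ ≤ _ := by gcongr
      linarith
    have h5 : 0 < δ ^ (k + 1) * #X * (#Y : ℝ) ^ 2 := by positivity
    linarith
  refine ⟨n', {y ∈ Y | x + dilate Q y ∈ B}, hn'1, ?_, filter_subset _ _,
    hfree.dilate hQ1 Y x, ?_⟩
  · have h1 : n < T ^ C₂ * (n' + 1) := by
      rw [mul_comm]; exact Nat.lt_mul_of_div_lt (Nat.lt_succ_self _) hTC₂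
    calc n ≤ T ^ C₂ * (n' + 1) := h1.le
      _ ≤ T ^ C₂ * (T * n') := by
          refine Nat.mul_le_mul_left _ ?_
          nlinarith
      _ = _ := by rw [pow_succ]; ring
  · have h1 : F x = #{y ∈ Y | x + dilate Q y ∈ B} - δ * #Y := by
      rw [hF]
      simp only [balanced]
      rw [sum_sub_distrib, sum_boole, ← mul_sum, sum_congr rfl fun y hy => if_pos (hZX x hxZ y hy)]
      simp
    rw [h1] at hx
    have : δ * (1 + τ) * #Y = δ * #Y + δ * τ * #Y := by ring
    rw [this]
    linarith

end MomentCurve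

namespace MomentCurve

/-- Iterating the density increment. -/
lemma le_pow_of_curveFree {k : ℕ} (hk : 2 ≤ k) : ∃ C K : ℕ, 1 ≤ K ∧ ∀ (T : ℕ) (δ₀ : ℝ), 0 < δ₀ →
    64 * k ≤ T * δ₀ → ∀ (s n : ℕ) (B : Finset (Fin k → ℤ)) (δ : ℝ), 1 ≤ n → B ⊆ box k n →
    CurveFree B → (#B : ℝ) = δ * #(box k n) → δ₀ ≤ δ → 2 * K ≤ s * δ ^ (k - 1) →
    n ≤ T ^ (C * (s + 1)) := by
  obtain ⟨C, K, hK, h⟩ := density_increment (k := k) (by omega)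
  refine ⟨C, K, hK, fun T δ₀ hδ₀ hT s => ?_⟩
  have hKr : (1 : ℝ) ≤ K := by exact_mod_cast hK
  have hT0 : 0 < T := Nat.pos_of_ne_zero fun h0 => by
    have : (2 : ℝ) ≤ k := by exact_mod_cast hk
    rw [h0] at hT; norm_num at hT; linarith
  induction s with
  | zero =>
    intro n B δ _ _ _ _ _ hs
    rw [Nat.cast_zero, zero_mul] at hs
    linarith
  | succ s ih =>
    intro n B δ hn hB hfree hδ hδδ hs
    rcases lt_or_ge n (T ^ C) with hlt | hge
    · exact hlt.le.trans (Nat.pow_le_pow_right hT0 (Nat.le_mul_of_pos_right _ (by omega)))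
    have hδ0 : 0 < δ := hδ₀.trans_le hδδ
    have hδ1 : δ ≤ 1 := by
      have h5 : (#B : ℝ) ≤ #(box k n) := by exact_mod_cast card_le_card hB
      have h6 : (0 : ℝ) < #(box k n) := by exact_mod_cast card_box_pos hn
      rw [hδ] at h5
      nlinarith
    obtain ⟨n', B', hn', hnn', hB', hfree', hdens⟩ := h T n hge B δ hB hδ hδ0
      (hT.trans (by gcongr)) hfree
    have hY : (0 : ℝ) < #(box k n') := by exact_mod_cast card_box_pos hn'
    have hd1 : δ * (1 + δ ^ (k - 1) / K) ≤ #B' / #(box k n') := by rwa [le_div_iff₀ hY]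
    have hone : 1 ≤ 1 + δ ^ (k - 1) / K := le_add_of_nonneg_right (by positivity)
    have hδδ' : δ ≤ #B' / #(box k n') := (le_mul_of_one_le_right hδ0.le hone).trans hd1
    have hmain := ih n' B' (#B' / #(box k n')) hn' hB' hfree' (by field_simp) (hδδ.trans hδδ') ?_
    · calc n ≤ T ^ C * n' := hnn'
        _ ≤ T ^ C * T ^ (C * (s + 1)) := by gcongr
        _ = _ := by rw [← pow_add]; congr 1; ring
    · have h1 : δ ^ (k - 1) * (1 + δ ^ (k - 1) / K) ≤ (#B' / #(box k n') : ℝ) ^ (k - 1) := by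
        calc δ ^ (k - 1) * (1 + δ ^ (k - 1) / K)
            ≤ δ ^ (k - 1) * (1 + δ ^ (k - 1) / K) ^ (k - 1) := by
              have := le_self_pow₀ hone (n := k - 1) (by omega)
              gcongr
          _ = (δ * (1 + δ ^ (k - 1) / K)) ^ (k - 1) := (mul_pow _ _ _).symm
          _ ≤ _ := by gcongr
      refine le_trans ?_ (mul_le_mul_of_nonneg_left h1 (Nat.cast_nonneg s))
      set u := δ ^ (k - 1) with hu
      have hu0 : 0 < u := by positivity
      have hu1 : u ≤ 1 := pow_le_one₀ hδ0.le hδ1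
      have huK : u / K ≤ 1 := by rw [div_le_one (by positivity)]; linarith
      push_cast at hs
      have h2 : (2 * K - u) * (1 + u / K) ≤ s * u * (1 + u / K) :=
        mul_le_mul_of_nonneg_right (by linarith) (by positivity)
      have h3 : (2 * K - u) * (1 + u / K) = 2 * K + u * (1 - u / K) := by field_simp; ring
      have h4 : 0 ≤ u * (1 - u / K) := mul_nonneg hu0.le (by linarith)
      linarith

/-- A quantitative bound for sets without differences on the moment curve. -/
lemma density_pow_mul_log_le {k : ℕ} (hk : 2 ≤ k) : ∃ K : ℝ, 0 < K ∧
    ∀ (n : ℕ) (B : Finset (Fin k → ℤ)) (δ : ℝ), 1 ≤ n → B ⊆ box k n → CurveFree B →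
    (#B : ℝ) = δ * #(box k n) → 0 < δ → δ ≤ 1 →
    δ ^ (k - 1) * Real.log n ≤ K * (1 + Real.log (1 / δ)) := by
  obtain ⟨C, K, hK, h⟩ := le_pow_of_curveFree hk
  have hkr : (2 : ℝ) ≤ k := by exact_mod_cast hk
  have hlog : 0 ≤ Real.log (65 * k) := Real.log_nonneg (by linarith)
  refine ⟨(C + 1) * (2 * K + 2) * (1 + Real.log (65 * k)), by positivity, ?_⟩
  intro n B δ hn hB hfree hδ hδ0 hδ1
  have hu0 : 0 < δ ^ (k - 1) := by positivity
  have hu1 : δ ^ (k - 1) ≤ 1 := pow_le_one₀ hδ0.le hδ1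
  set T := ⌈64 * k / δ⌉₊ with hT
  set s := ⌈2 * K / δ ^ (k - 1)⌉₊ with hs
  have h1 : 64 * (k : ℝ) ≤ T * δ := by
    rw [← div_le_iff₀ hδ0]; exact Nat.le_ceil _
  have h2 : 2 * (K : ℝ) ≤ s * δ ^ (k - 1) := by
    rw [← div_le_iff₀ hu0]; exact Nat.le_ceil _
  have hn2 := h T δ hδ0 h1 s n B δ hn hB hfree hδ le_rfl h2
  have hT0 : (0 : ℝ) < T := by
    by_contra hcon
    nlinarith
  have hT2 : (T : ℝ) ≤ 65 * k * (1 / δ) := by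
    have h3 : (T : ℝ) < 64 * k / δ + 1 := Nat.ceil_lt_add_one (by positivity)
    have h4 : 64 * k / δ + 1 ≤ 65 * k * (1 / δ) := by
      rw [mul_one_div, div_add_one hδ0.ne', div_le_div_iff_of_pos_right hδ0]
      linarith
    linarith
  have hs2 : ((s : ℝ) + 1) * δ ^ (k - 1) ≤ 2 * K + 2 := by
    have h3 : (s : ℝ) < 2 * K / δ ^ (k - 1) + 1 := Nat.ceil_lt_add_one (by positivity)
    have h4 : ((s : ℝ) + 1) * δ ^ (k - 1) ≤ (2 * K / δ ^ (k - 1) + 1 + 1) * δ ^ (k - 1) := by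
      gcongr
    have h5 : (2 * K / δ ^ (k - 1) + 1 + 1) * δ ^ (k - 1) = 2 * K + 2 * δ ^ (k - 1) := by
      field_simp; ring
    linarith
  have hδlog : 0 ≤ Real.log (1 / δ) := Real.log_nonneg (by rw [le_div_iff₀ hδ0]; linarith)
  have hlogn : Real.log n ≤ C * (s + 1) * Real.log T := by
    have h3 : (n : ℝ) ≤ (T : ℝ) ^ (C * (s + 1)) := by exact_mod_cast hn2
    have h4 := Real.log_le_log (by exact_mod_cast hn) h3
    rw [Real.log_pow] at h4
    push_cast at h4
    exact h4
  have hlogT : Real.log T ≤ Real.log (65 * k) + Real.log (1 / δ) := by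
    rw [← Real.log_mul (by positivity) (by positivity)]
    exact Real.log_le_log hT0 hT2
  calc δ ^ (k - 1) * Real.log n ≤ δ ^ (k - 1) * (C * (s + 1) * Real.log T) := by gcongr
    _ = C * ((s + 1) * δ ^ (k - 1)) * Real.log T := by ring
    _ ≤ C * ((s + 1) * δ ^ (k - 1)) * (Real.log (65 * k) + Real.log (1 / δ)) := by gcongr
    _ ≤ (C + 1) * (2 * K + 2) * ((1 + Real.log (65 * k)) * (1 + Real.log (1 / δ))) := by
        refine mul_le_mul ?_ (by nlinarith) (by positivity) (by positivity)
        exact mul_le_mul (by linarith) hs2 (by positivity) (by positivity)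
    _ = _ := by ring

/-- The densities of polynomial configurations transfer to the moment curve. -/
lemma exists_curveFree {ℓ k : ℕ} {P : Fin ℓ → Polynomial ℤ} (hP0 : ∀ i, (P i).eval 0 = 0)
    (hPdeg : ∀ i, (P i).natDegree ≤ k) : ∃ h : ℕ, 1 ≤ h ∧ ∀ N n : ℕ, 1 ≤ n → n ^ k ≤ N →
    ∀ A : Finset ℤ, A ⊆ Icc 1 (N : ℤ) → (∀ d : ℤ, d ≠ 0 → ∃ i : Fin ℓ, (P i).eval d ∉ A - A) →
    ∃ B ⊆ box k n, CurveFree B ∧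
      ((#A : ℝ) / N / h) ^ ℓ * #(box k n) ≤ #B := by
  classical
  set c : Fin ℓ → Fin k → ℤ := fun i j => (P i).coeff (j.1 + 1) with hc
  set L : (Fin k → ℤ) → Fin ℓ → ℤ := fun b i => ∑ j, c i j * b j with hL
  have hLadd : ∀ b b' i, L (b + b') i = L b i + L b' i := fun b b' i => by
    simp [hL, mul_add, sum_add_distrib]
  have hLcurve : ∀ d i, L (curve k d) i = (P i).eval d := fun d i => by
    rw [Polynomial.eval_eq_sum_range' (Nat.lt_succ_of_le (hPdeg i)), sum_range_succ',
      ← Fin.sum_univ_eq_sum_range (fun j => (P i).coeff (j + 1) * d ^ (j + 1)),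
      Polynomial.coeff_zero_eq_eval_zero, hP0 i, zero_mul, add_zero]
    rfl
  set H : ℕ := ∑ i, ∑ j, (c i j).natAbs with hH
  refine ⟨2 * H + 1, by omega, fun N n hn hnN A hA hfree => ?_⟩
  have hN : 1 ≤ N := (Nat.one_le_pow _ _ hn).trans hnN
  have hLabs : ∀ b ∈ box k n, ∀ i, |L b i| ≤ H * N := fun b hb i => by
    have h1 : ∀ j ∈ (univ : Finset (Fin k)), |c i j * b j| ≤ (c i j).natAbs * (N : ℤ) := by
      intro j _
      obtain ⟨h2, h3⟩ := mem_box.1 hb j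
      rw [abs_mul, Int.natCast_natAbs, abs_of_nonneg (by linarith : 0 ≤ b j)]
      refine mul_le_mul_of_nonneg_left (h3.trans ?_) (abs_nonneg _)
      have : n ^ (j.1 + 1) ≤ N := (Nat.pow_le_pow_right hn j.2).trans hnN
      exact_mod_cast this
    refine (abs_sum_le_sum_abs _ _).trans ((sum_le_sum h1).trans ?_)
    rw [← sum_mul]
    refine mul_le_mul_of_nonneg_right ?_ (by positivity)
    have h4 : ∑ j, (c i j).natAbs ≤ H :=
      single_le_sum (f := fun i => ∑ j, (c i j).natAbs) (fun _ _ => Nat.zero_le _) (mem_univ i)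
    exact_mod_cast h4
  set R : Finset (Fin ℓ → ℤ) := Fintype.piFinset fun _ => Icc (1 - (H * N : ℤ)) (N + H * N) with hR
  have hRcard : #R = ((2 * H + 1) * N) ^ ℓ := by
    rw [hR, Fintype.card_piFinset, prod_const, card_univ, Fintype.card_fin, Int.card_Icc]
    congr 1
    have : (N : ℤ) + H * N + 1 - (1 - H * N) = (((2 * H + 1) * N : ℕ) : ℤ) := by push_cast; ring
    rw [this, Int.toNat_natCast]
  set S : (Fin ℓ → ℤ) → Finset (Fin k → ℤ) := fun t => {b ∈ box k n | ∀ i, t i + L b i ∈ A} with hS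
  have hcount : #A ^ ℓ * #(box k n) ≤ ∑ t ∈ R, #(S t) := by
    simp only [hS, card_filter]
    rw [sum_comm, mul_comm, ← smul_eq_mul]
    refine card_nsmul_le_sum _ _ _ fun b hb => ?_
    rw [← card_filter]
    have h1 : #(Fintype.piFinset fun _ : Fin ℓ => A) = #A ^ ℓ := by
      rw [Fintype.card_piFinset, prod_const, card_univ, Fintype.card_fin]
    rw [← h1]
    refine card_le_card_of_injOn (fun a => a - L b) (fun a ha => ?_) fun x _ y _ h => sub_left_injective h
    have h2 := Fintype.mem_piFinset.1 (mem_coe.1 ha)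
    refine mem_coe.2 (mem_filter.2 ⟨Fintype.mem_piFinset.2 fun i => ?_, fun i => ?_⟩)
    · have h3 := mem_Icc.1 (hA (h2 i))
      have h4 := abs_le.1 (hLabs b hb i)
      change a i - L b i ∈ _
      rw [mem_Icc]
      constructor <;> linarith
    · change a i - L b i + L b i ∈ A
      rw [sub_add_cancel]; exact h2 i
  have hRne : R.Nonempty := by
    rw [← card_pos, hRcard]; positivity
  obtain ⟨t, _, ht⟩ : ∃ t ∈ R, #A ^ ℓ * #(box k n) ≤ #R * #(S t) := by
    by_contra! hcon
    have h1 : ∑ t ∈ R, #R * #(S t) < ∑ t ∈ R, #A ^ ℓ * #(box k n) := sum_lt_sum_of_nonempty hRne hcon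
    rw [← mul_sum, sum_const, smul_eq_mul] at h1
    exact absurd (Nat.lt_of_mul_lt_mul_left h1) (not_lt.2 hcount)
  refine ⟨S t, filter_subset _ _, fun d hd b hb hb' => ?_, ?_⟩
  · obtain ⟨i, hi⟩ := hfree d hd
    refine hi (mem_sub.2 ⟨_, (mem_filter.1 hb').2 i, _, (mem_filter.1 hb).2 i, ?_⟩)
    rw [hLadd, hLcurve]; ring
  · have h1 : ((#A : ℝ)) ^ ℓ * #(box k n) ≤ ((2 * H + 1 : ℕ) * N : ℝ) ^ ℓ * #(S t) := by
      rw [hRcard] at ht; exact_mod_cast ht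
    have hN0 : (0 : ℝ) < N := by exact_mod_cast hN
    rw [div_div, div_pow, div_mul_eq_mul_div, div_le_iff₀ (by positivity), mul_comm (N : ℝ)]
    linarith

end MomentCurve

namespace MomentCurve

lemma one_lt_log_of_three_le {N : ℕ} (hN : 3 ≤ N) : Real.log 3 ≤ Real.log N ∧ 1 < Real.log 3 := by
  refine ⟨Real.log_le_log (by norm_num) (by exact_mod_cast hN), ?_⟩
  rw [Real.lt_log_iff_exp_lt (by norm_num)]
  have := Real.exp_one_lt_d9
  linarith

lemma exists_pow_le_lt {k N : ℕ} (hk : 1 ≤ k) (hN : 1 ≤ N) :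
    ∃ n : ℕ, 1 ≤ n ∧ n ^ k ≤ N ∧ Real.log N ≤ k * (1 + Real.log n) := by
  set n := Nat.findGreatest (fun n => n ^ k ≤ N) N with hn
  have hn1 : 1 ≤ n := Nat.le_findGreatest hN (by rwa [one_pow])
  have hnN : n ^ k ≤ N := Nat.findGreatest_spec (P := fun n => n ^ k ≤ N) hN (by rwa [one_pow])
  refine ⟨n, hn1, hnN, ?_⟩
  have hlt : N < (n + 1) ^ k := by
    by_contra! hcon
    have h1 : n + 1 ≤ N := (Nat.le_self_pow (by omega) _).trans hcon
    have := Nat.le_findGreatest (P := fun n => n ^ k ≤ N) h1 hcon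
    omega
  have h2 : (N : ℝ) ≤ (2 * n) ^ k := by
    have : N ≤ (2 * n) ^ k := hlt.le.trans (Nat.pow_le_pow_left (by omega) k)
    exact_mod_cast this
  have h3 := Real.log_le_log (by exact_mod_cast hN) h2
  have hn0 : (n : ℝ) ≠ 0 := by exact_mod_cast (by omega : n ≠ 0)
  rw [Real.log_pow, Real.log_mul two_ne_zero hn0] at h3
  refine h3.trans (mul_le_mul_of_nonneg_left ?_ (Nat.cast_nonneg k))
  have := Real.log_two_lt_d9
  linarith

lemma pow_le_of_mul_le {p : ℕ} (hp : 1 ≤ p) {δ y l K : ℝ} (hδ0 : 0 < δ) (hl : 0 < l)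
    (hK : 0 ≤ K) (hy : 0 < y) (hly : l ≤ Real.log y)
    (h : δ ^ p * y ≤ K * (1 + Real.log (1 / δ))) :
    δ ^ p ≤ (K + 1) * (1 / l + 1) * (Real.log y / y) := by
  have h1 : 1 ≤ 1 / l * Real.log y := by
    rw [one_div_mul_eq_div, le_div_iff₀ hl, one_mul]; exact hly
  have h2 : 1 + Real.log y ≤ (1 / l + 1) * Real.log y := by rw [add_mul, one_mul]; linarith
  rw [mul_div_assoc', le_div_iff₀ hy, mul_assoc]
  rcases le_or_gt (δ ^ p * y) 1 with h3 | h3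
  · have h4 : 0 ≤ K * ((1 / l + 1) * Real.log y) := by
      have : 0 ≤ Real.log y := hl.le.trans hly
      positivity
    linarith
  · have h4 : 1 / δ ^ p < y := by
      rw [div_lt_iff₀ (by positivity), mul_comm]; exact h3
    have h5 : p * Real.log (1 / δ) ≤ Real.log y := by
      rw [← Real.log_pow, one_div_pow]
      exact Real.log_le_log (by positivity) h4.le
    have h6 : Real.log (1 / δ) ≤ Real.log y := by
      rcases le_or_gt (Real.log (1 / δ)) 0 with h7 | h7
      · linarith
      · refine le_trans (le_mul_of_one_le_left h7.le ?_) h5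
        exact_mod_cast hp
    calc δ ^ p * y ≤ K * (1 + Real.log (1 / δ)) := h
      _ ≤ K * ((1 / l + 1) * Real.log y) := mul_le_mul_of_nonneg_left (by linarith) hK
      _ ≤ (K + 1) * ((1 / l + 1) * Real.log y) :=
          mul_le_mul_of_nonneg_right (by linarith) (by linarith)

end MomentCurve

/-- **Theorem 1 (Lyall–Magyar).** If `A ⊆ [1,N]` and for every nonzero `d` the set
`{P₁(d),…,P_ℓ(d)}` is not contained in the difference set `A - A`, then
`|A|/N ≤ C (log log N / log N)^(1/(ℓ(k-1)))`. -/
theorem stmt_0 (ℓ k : ℕ) (hk : 2 ≤ k) (hℓ : 1 ≤ ℓ)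
    (P : Fin ℓ → Polynomial ℤ)
    (hP0 : ∀ i, (P i).eval 0 = 0)
    (hPdeg : ∀ i, (P i).natDegree ≤ k)
    (hPmax : ∃ i, (P i).natDegree = k) :
    ∃ C : ℝ, 0 < C ∧ ∀ N : ℕ, 3 ≤ N → ∀ A : Finset ℤ,
      A ⊆ Finset.Icc 1 (N : ℤ) →
      (∀ d : ℤ, d ≠ 0 → ∃ i : Fin ℓ, (P i).eval d ∉ A - A) →
      (A.card : ℝ) / N ≤
        C * (Real.log (Real.log N) / Real.log N) ^ ((1 : ℝ) / ((ℓ * (k - 1) : ℕ) : ℝ)) := by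
  obtain ⟨h, hh, hlift⟩ := MomentCurve.exists_curveFree hP0 hPdeg
  obtain ⟨K, hK, hcurve⟩ := MomentCurve.density_pow_mul_log_le hk
  set l := Real.log (Real.log 3) with hl
  have hl0 : 0 < l := Real.log_pos (MomentCurve.one_lt_log_of_three_le le_rfl).2
  set K' : ℝ := (k * (1 + K) + 1) * (1 / l + 1) with hK'
  have hK'0 : 0 < K' := by positivity
  have hh0 : (0 : ℝ) < h := by exact_mod_cast hh
  set q := ℓ * (k - 1) with hq
  have hq0 : q ≠ 0 := Nat.mul_ne_zero (by omega) (by omega)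
  refine ⟨h * K' ^ ((1 : ℝ) / (q : ℝ)), by positivity, fun N hN A hA hfree => ?_⟩
  obtain ⟨hy3, h3⟩ := MomentCurve.one_lt_log_of_three_le hN
  set y := Real.log N with hy
  have hy0 : 0 < y := by linarith
  have hly : l ≤ Real.log y := Real.log_le_log (by linarith) hy3
  have hr0 : 0 ≤ Real.log y / y := div_nonneg (by linarith) hy0.le
  set α : ℝ := #A / N / h with hα
  have hα0 : 0 ≤ α := by positivity
  suffices hmain : α ^ q ≤ K' * (Real.log y / y) by
    have h1 : α ≤ (K' * (Real.log y / y)) ^ ((1 : ℝ) / (q : ℝ)) := by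
      rw [one_div, ← Real.pow_rpow_inv_natCast hα0 hq0]
      exact Real.rpow_le_rpow (by positivity) hmain (by positivity)
    rw [Real.mul_rpow hK'0.le hr0] at h1
    rw [mul_assoc, ← div_le_iff₀' hh0]
    exact h1
  rcases hα0.eq_or_lt with h0 | hα1
  · rw [← h0, zero_pow hq0]; positivity
  obtain ⟨n, hn, hnN, hlogn⟩ := MomentCurve.exists_pow_le_lt (k := k) (by omega) (by omega : 1 ≤ N)
  obtain ⟨B, hB, hBfree, hdens⟩ := hlift N n hn hnN A hA hfree
  have hX : (0 : ℝ) < #(MomentCurve.box k n) := by exact_mod_cast MomentCurve.card_box_pos hn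
  set δ : ℝ := #B / #(MomentCurve.box k n) with hδ
  have hαδ : α ^ ℓ ≤ δ := by rwa [hδ, le_div_iff₀ hX]
  have hδ0 : 0 < δ := (pow_pos hα1 ℓ).trans_le hαδ
  have hδ1 : δ ≤ 1 := by
    rw [hδ, div_le_one hX]; exact_mod_cast card_le_card hB
  have h4 := hcurve n B δ hn hB hBfree (by rw [hδ]; field_simp) hδ0 hδ1
  have hδlog : 0 ≤ Real.log (1 / δ) := Real.log_nonneg (by rw [le_div_iff₀ hδ0]; linarith)
  have h5 : δ ^ (k - 1) * y ≤ k * (1 + K) * (1 + Real.log (1 / δ)) := by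
    have h6 : δ ^ (k - 1) ≤ 1 := pow_le_one₀ hδ0.le hδ1
    calc δ ^ (k - 1) * y ≤ δ ^ (k - 1) * (k * (1 + Real.log n)) := by gcongr
      _ = k * (δ ^ (k - 1) + δ ^ (k - 1) * Real.log n) := by ring
      _ ≤ k * ((1 + Real.log (1 / δ)) + K * (1 + Real.log (1 / δ))) := by
          refine mul_le_mul_of_nonneg_left ?_ (Nat.cast_nonneg k)
          linarith
      _ = _ := by ring
  have h6 := MomentCurve.pow_le_of_mul_le (by omega) hδ0 hl0 (by positivity) hy0 hly h5
  calc α ^ q = (α ^ ℓ) ^ (k - 1) := by rw [hq, pow_mul]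
    _ ≤ δ ^ (k - 1) := by gcongr
    _ ≤ _ := h6
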